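/- Let Φ_T be the time-T flow map of a Hamiltonian equation ż = JAz + J∇h(z) satisfying assumptions (H1), (H2), (H3). If Φ_T sends a ball B_r = {z ∈ Z : ‖z − z̄‖ < r} (z̄ ∈ Z fixed) into a cylinder C_{R,j₀} = {z = Σ_j p_j φ_j^+ + q_j φ_j^- : (p_{j₀} − p̄_{j₀})² + (q_{j₀} − q̄_{j₀})² < R²} (j₀ ≥ 1 and p̄_{j₀}, q̄_{j₀} ∈ ℝ fixed), then r ≤ R. -/

import Mathlib

open scoped RealInnerProductSpace BigOperators ENNReal NNReal
open Metric

noncomputable section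

namespace Kuksin

variable {Z : Type*} [NormedAddCommGroup Z] [InnerProductSpace ℝ Z] [CompleteSpace Z]

/-- The family `b (j, true) = φ_j^+`, `b (j, false) = φ_j^-` (indexed by `j : ℕ`,
standing for `j ≥ 1`) is a Hilbert basis of `Z`. -/
def IsHilbertBasis (b : ℕ × Bool → Z) : Prop :=
  Orthonormal ℝ b ∧ (Submodule.span ℝ (Set.range b)).topologicalClosure = ⊤

/-- The operator `J` acts by `J φ_j^± = ∓ φ_j^∓`. -/
def IsJ (b : ℕ × Bool → Z) (J : Z →L[ℝ] Z) : Prop :=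
  ∀ j : ℕ, J (b (j, true)) = - b (j, false) ∧ J (b (j, false)) = b (j, true)

/-- The orthogonal projector `Π^n` onto `Z^n = span {φ_j^± : j < n}`. -/
def proj (b : ℕ × Bool → Z) (n : ℕ) (z : Z) : Z :=
  ∑ j ∈ Finset.range n, (⟪b (j, true), z⟫ • b (j, true) + ⟪b (j, false), z⟫ • b (j, false))

/-- A (global-in-time) trajectory of the Hamiltonian vector field `X_{f_n} = J ∇ f_n` of
`f_n = f|_{O ∩ Z^n}` on `O^n = O ∩ Z^n`  (the gradient of the restriction of `f` to `Z^n`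
is `Π^n ∇f`). -/
def IsTrajectory (b : ℕ × Bool → Z) (J : Z →L[ℝ] Z) (O : Set Z) (f : Z → ℝ) (n : ℕ)
    (z : ℝ → Z) : Prop :=
  (∀ t : ℝ, z t ∈ O) ∧ (∀ t : ℝ, proj b n (z t) = z t) ∧
  (∀ t : ℝ, HasDerivAt z (J (proj b n (gradient f (z t)))) t)

/-- A fast trajectory: a nonconstant periodic trajectory of period `≤ 1`. -/
def IsFastTrajectory (b : ℕ × Bool → Z) (J : Z →L[ℝ] Z) (O : Set Z) (f : Z → ℝ) (n : ℕ)
    (z : ℝ → Z) : Prop :=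
  IsTrajectory b J O f n z ∧ (∃ t₁ t₂ : ℝ, z t₁ ≠ z t₂) ∧
  (∃ T : ℝ, 0 < T ∧ T ≤ 1 ∧ ∀ t : ℝ, z (t + T) = z t)

/-- `f` is an `m`-admissible function on the open set `O`. -/
def IsAdmissible (O : Set Z) (m : ℝ) (f : Z → ℝ) : Prop :=
  0 < m ∧ ContDiffOn ℝ (⊤ : ℕ∞) f O ∧ (∀ z ∈ O, 0 ≤ f z ∧ f z ≤ m) ∧
  (∃ U : Set Z, IsOpen U ∧ U.Nonempty ∧ U ⊆ O ∧ ∀ z ∈ U, f z = 0) ∧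
  (∀ z ∈ frontier O, f z = m) ∧
  Bornology.IsBounded {z ∈ O | f z < m} ∧
  (∃ d : ℝ, 0 < d ∧ ∀ x ∈ {z ∈ O | f z < m}, ∀ y ∈ frontier O, d ≤ dist x y)

/-- An `m`-admissible function `f` is fast if for all large enough `n` the Hamiltonian
vector field `X_{f_n}` has a fast trajectory. -/
def IsFastFunction (b : ℕ × Bool → Z) (J : Z →L[ℝ] Z) (O : Set Z) (f : Z → ℝ) : Prop :=
  ∃ n₀ : ℕ, ∀ n ≥ n₀, ∃ z : ℝ → Z, IsFastTrajectory b J O f n z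

/-- The set of thresholds `m*` such that every `m`-admissible function with `m > m*` is fast. -/
def capSet (b : ℕ × Bool → Z) (J : Z →L[ℝ] Z) (O : Set Z) : Set ℝ :=
  {m' | 0 ≤ m' ∧ ∀ m : ℝ, ∀ f : Z → ℝ, m' < m → IsAdmissible O m f → IsFastFunction b J O f}

/-- Kuksin's symplectic capacity of an open set `O ⊆ Z` (with value in `[0, ∞]`). -/
def cap (b : ℕ × Bool → Z) (J : Z →L[ℝ] Z) (O : Set Z) : ℝ≥0∞ :=
  sInf (ENNReal.ofReal '' capSet b J O)

set_option linter.unusedSimpArgs false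
set_option linter.unusedVariables false
set_option linter.unusedSectionVars false
set_option linter.deprecated false

section

section brouwer
open MeasureTheory

variable {E : Type*} [NormedAddCommGroup E] [InnerProductSpace ℝ E] [FiniteDimensional ℝ E]

theorem det_poly (L : E →L[ℝ] E) : ∃ p : Polynomial ℝ, p.natDegree ≤ Module.finrank ℝ E ∧
    ∀ t : ℝ, (ContinuousLinearMap.id ℝ E + t • L).det = p.eval t := by
  classical
  let bb := Module.finBasis ℝ E
  let M := LinearMap.toMatrix bb bb (L : E →ₗ[ℝ] E)
  refine ⟨Matrix.det ((Polynomial.X : Polynomial ℝ) • M.map Polynomial.C + (1 : Matrix _ _ ℝ).map Polynomial.C), ?_, ?_⟩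
  · refine (Polynomial.natDegree_det_X_add_C_le M 1).trans ?_
    simp
  · intro t
    have h1 : (ContinuousLinearMap.id ℝ E + t • L).det
        = LinearMap.det (LinearMap.id + t • (L : E →ₗ[ℝ] E)) := rfl
    rw [h1, ← LinearMap.det_toMatrix bb, map_add, map_smul, LinearMap.toMatrix_id]
    rw [← Polynomial.coe_evalRingHom, RingHom.map_det]
    congr 1
    ext i j
    by_cases hij : i = j
    · simp [M, hij, Polynomial.eval_add]; ring
    · simp [M, hij]; ring

theorem extend_lip (ψ : E → E) (ρ : ℝ) (C : ℝ≥0) (hC : LipschitzOnWith C ψ (closedBall 0 ρ))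
    (h0 : ∀ x, ‖x‖ = ρ → ψ x = 0) :
    LipschitzWith C (fun x => if ‖x‖ ≤ ρ then ψ x else 0) := by
  have key : ∀ x y : E, ‖x‖ ≤ ρ → ¬ ‖y‖ ≤ ρ → dist (ψ x) 0 ≤ C * dist x y := by
    intro x y hx hy
    push Not at hy
    have hcont : ContinuousOn (fun t : ℝ => ‖x + t • (y - x)‖) (Set.Icc 0 1) := by fun_prop
    have := intermediate_value_Icc (zero_le_one' ℝ) hcont
    have hm : ρ ∈ Set.Icc (‖x + (0:ℝ) • (y - x)‖) (‖x + (1:ℝ) • (y - x)‖) := by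
      constructor
      · simpa using hx
      · simpa using hy.le
    obtain ⟨t, ht, hts⟩ := this hm
    simp only at hts
    rw [← h0 _ hts]
    refine (hC.dist_le_mul x (by simpa using hx) _ (by simpa using hts.le)).trans ?_
    gcongr
    rw [dist_eq_norm, dist_eq_norm]
    have : x - (x + t • (y - x)) = t • (x - y) := by
      rw [smul_sub, smul_sub]; abel
    rw [this, norm_smul, Real.norm_of_nonneg ht.1]
    exact mul_le_of_le_one_left (norm_nonneg _) ht.2
  refine LipschitzWith.of_dist_le_mul fun x y => ?_
  by_cases hx : ‖x‖ ≤ ρ <;> by_cases hy : ‖y‖ ≤ ρ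
  · simp only [hx, hy, if_true]
    exact hC.dist_le_mul x (by simpa using hx) y (by simpa using hy)
  · simp only [hx, hy, if_true, if_false]
    exact key x y hx hy
  · simp only [hx, hy, if_true, if_false]
    rw [dist_comm, dist_comm x y]
    exact key y x hy hx
  · simp only [hx, hy, if_false, dist_self]
    positivity

variable [MeasurableSpace E] [BorelSpace E]

theorem vol_invariant (ψ : E → E) (hψ : ContDiff ℝ 1 ψ) (ρ : ℝ)
    (h0 : ∀ x, ‖x‖ = ρ → ψ x = 0) :
    ∃ t0 : ℝ, 0 < t0 ∧ ∀ t : ℝ, 0 ≤ t → t ≤ t0 →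
      ∫ x in closedBall (0:E) ρ, (ContinuousLinearMap.id ℝ E + t • fderiv ℝ ψ x).det
        = ∫ x in closedBall (0:E) ρ, (1:ℝ) := by
  obtain ⟨C0, hC0⟩ := (isCompact_closedBall (0:E) ρ).exists_bound_of_continuousOn
    (f := fderiv ℝ ψ) (hψ.continuous_fderiv one_ne_zero).continuousOn
  set C : ℝ≥0 := ⟨max C0 0, le_max_right _ _⟩ with hCdef
  have hC : ∀ x ∈ closedBall (0:E) ρ, ‖fderiv ℝ ψ x‖ ≤ C := fun x hx =>
    (hC0 x hx).trans (le_max_left _ _)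
  have hlip : LipschitzOnWith C ψ (closedBall 0 ρ) :=
    (convex_closedBall 0 ρ).lipschitzOnWith_of_nnnorm_fderiv_le
      (fun x _ => hψ.differentiable (by norm_num) x) (fun x hx => hC x hx)
  have hL := extend_lip ψ ρ C hlip h0
  set φ : E → E := fun x => if ‖x‖ ≤ ρ then ψ x else 0 with hφ
  have hdet : ∀ᶠ N in nhds (ContinuousLinearMap.id ℝ E), 0 < N.det := by
    have : ContinuousAt (fun N : E →L[ℝ] E => N.det) (ContinuousLinearMap.id ℝ E) :=
      ContinuousLinearMap.continuous_det.continuousAt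
    refine this.eventually_const_lt ?_
    have : (ContinuousLinearMap.id ℝ E).det = 1 := LinearMap.det_id
    change 0 < (ContinuousLinearMap.id ℝ E).det
    rw [this]; exact one_pos
  obtain ⟨ε, hε, hεd⟩ := Metric.eventually_nhds_iff.1 hdet
  refine ⟨min (1/2) (ε/2) / (C + 1), by positivity, fun t ht0 ht => ?_⟩
  have htC : t * (C + 1) ≤ min (1/2) (ε/2) := by
    rwa [le_div_iff₀ (by positivity)] at ht
  have htC1 : t * C ≤ 1/2 := by
    have := htC.trans (min_le_left _ _); nlinarith
  have htC2 : t * C ≤ ε/2 := by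
    have := htC.trans (min_le_right _ _); nlinarith
  have happ : ApproximatesLinearOn (fun x => x + t • φ x)
      ((ContinuousLinearEquiv.refl ℝ E : E ≃L[ℝ] E) : E →L[ℝ] E) Set.univ (⟨t, ht0⟩ * C) := by
    intro x _ y _
    simp only [ContinuousLinearEquiv.coe_refl, ContinuousLinearMap.coe_id', id]
    have : x + t • φ x - (y + t • φ y) - (x - y) = t • (φ x - φ y) := by
      rw [smul_sub]; abel
    rw [this, norm_smul, Real.norm_of_nonneg ht0]
    have := hL.dist_le_mul x y
    rw [dist_eq_norm, dist_eq_norm] at this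
    calc t * ‖φ x - φ y‖ ≤ t * (C * ‖x - y‖) := by gcongr
      _ = (t * C) * ‖x - y‖ := by ring
  have hinj_surj : Function.Bijective (fun x => x + t • φ x) := by
    have hc : Subsingleton E ∨ (⟨t, ht0⟩ * C : ℝ≥0) <
        ‖((ContinuousLinearEquiv.refl ℝ E : E ≃L[ℝ] E).symm : E →L[ℝ] E)‖₊⁻¹ := by
      rcases subsingleton_or_nontrivial E with h | h
      · exact Or.inl h
      · right
        have : ‖((ContinuousLinearEquiv.refl ℝ E : E ≃L[ℝ] E).symm : E →L[ℝ] E)‖₊ = 1 := by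
          simp
        rw [this, inv_one, ← NNReal.coe_lt_coe]
        push_cast
        change t * C < 1
        linarith
    exact (happ.toHomeomorph _ hc).bijective
  have himg : (fun x => x + t • φ x) '' closedBall 0 ρ = closedBall 0 ρ := by
    have hout : ∀ x, ¬ ‖x‖ ≤ ρ → x + t • φ x = x := by
      intro x hx; simp [hφ, hx]
    ext y
    constructor
    · rintro ⟨x, hx, rfl⟩
      by_contra hcon
      have h1 : ¬ ‖x + t • φ x‖ ≤ ρ := by simpa using hcon
      have h2 := hout _ h1
      have h3 := hinj_surj.1 h2
      rw [h3] at h1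
      exact h1 (by simpa using hx)
    · intro hy
      obtain ⟨x, rfl⟩ := hinj_surj.2 y
      refine ⟨x, ?_, rfl⟩
      by_contra hcon
      have h1 : ¬ ‖x‖ ≤ ρ := by simpa using hcon
      have h2 := hout _ h1
      simp only [h2] at hy
      exact hcon hy
  have hder : ∀ x ∈ closedBall (0:E) ρ, HasFDerivWithinAt (fun x => x + t • φ x)
      (ContinuousLinearMap.id ℝ E + t • fderiv ℝ ψ x) (closedBall 0 ρ) x := by
    intro x hx
    have h1 : HasFDerivAt (fun x => x + t • ψ x)
        (ContinuousLinearMap.id ℝ E + t • fderiv ℝ ψ x) x :=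
      (hasFDerivAt_id x).add (((hψ.differentiable (by norm_num)) x).hasFDerivAt.const_smul t)
    refine h1.hasFDerivWithinAt.congr ?_ ?_
    · intro y hy
      have : ‖y‖ ≤ ρ := by simpa using hy
      simp [hφ, this]
    · have : ‖x‖ ≤ ρ := by simpa using hx
      simp [hφ, this]
  have hcv := integral_image_eq_integral_abs_det_fderiv_smul (volume : Measure E)
    measurableSet_closedBall hder hinj_surj.1.injOn (fun _ => (1:ℝ))
  rw [himg] at hcv
  rw [hcv]
  refine setIntegral_congr_fun measurableSet_closedBall fun x hx => ?_
  have hpos : 0 < (ContinuousLinearMap.id ℝ E + t • fderiv ℝ ψ x).det := by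
    apply hεd
    rw [dist_eq_norm, add_sub_cancel_left, norm_smul, Real.norm_of_nonneg ht0]
    have : t * ‖fderiv ℝ ψ x‖ ≤ t * C := by gcongr; exact hC x hx
    linarith
  simp [abs_of_pos hpos]

theorem no_retraction (r : E → E) (hr : ContDiff ℝ 1 r) (ρ : ℝ) (hρ : 0 < ρ)
    (h1 : ∀ x, ‖r x‖ = ρ) (h2 : ∀ x, ‖x‖ = ρ → r x = x) : False := by
  classical
  set ψ : E → E := fun x => r x - x with hψd
  have hψ : ContDiff ℝ 1 ψ := hr.sub contDiff_id
  obtain ⟨t0, ht0, hvol⟩ := vol_invariant ψ hψ ρ (fun x hx => by simp [hψd, h2 x hx])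
  set d := Module.finrank ℝ E with hd
  let s : Finset ℕ := Finset.range (d + 1)
  let v : ℕ → ℝ := fun i => t0 * (i / (d + 1))
  have hv : Set.InjOn v s := by
    intro i _ j _ hij
    have h3 : t0 * ((i:ℝ) / (d + 1)) = t0 * ((j:ℝ) / (d + 1)) := hij
    have h4 := mul_left_cancel₀ ht0.ne' h3
    rw [div_left_inj' (by positivity)] at h4
    exact_mod_cast h4
  have hint : ∀ p : Polynomial ℝ, p.natDegree ≤ d →
      p.eval 1 = ∑ i ∈ s, p.eval (v i) * (Lagrange.basis s v i).eval 1 := by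
    intro p hp
    have : p = Lagrange.interpolate s v (fun i => p.eval (v i)) := by
      apply Lagrange.eq_interpolate hv
      refine lt_of_le_of_lt Polynomial.degree_le_natDegree ?_
      simp only [s, Finset.card_range]
      exact_mod_cast Nat.lt_succ_of_le hp
    conv_lhs => rw [this]
    simp [Lagrange.interpolate_apply, Polynomial.eval_finsetSum]
  set w : ℕ → ℝ := fun i => (Lagrange.basis s v i).eval 1 with hw
  have hwsum : ∑ i ∈ s, w i = 1 := by
    have := hint 1 (by simp)
    simpa using this.symm
  have hdet0 : ∀ x, (ContinuousLinearMap.id ℝ E + (1:ℝ) • fderiv ℝ ψ x).det = 0 := by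
    intro x
    have e1 : ContinuousLinearMap.id ℝ E + (1:ℝ) • fderiv ℝ ψ x = fderiv ℝ r x := by
      have : fderiv ℝ ψ x = fderiv ℝ r x - ContinuousLinearMap.id ℝ E := by
        have := ((hr.differentiable (by norm_num) x).hasFDerivAt.sub (hasFDerivAt_id x)).fderiv
        exact this
      rw [this]; simp
    rw [e1]
    by_contra hne
    have hsurj : Function.Surjective (fderiv ℝ r x) := by
      have := (LinearMap.equivOfDetNeZero (fderiv ℝ r x : E →ₗ[ℝ] E) hne).surjective
      intro y
      obtain ⟨z, hz⟩ := this y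
      exact ⟨z, hz⟩
    obtain ⟨z, hz⟩ := hsurj (r x)
    have hd1 : HasFDerivAt (fun y => ⟪r y, r y⟫) _ x :=
      ((hr.differentiable (by norm_num) x).hasFDerivAt.inner ℝ
        (hr.differentiable (by norm_num) x).hasFDerivAt)
    have hd2 : HasFDerivAt (fun y => ⟪r y, r y⟫) (0 : E →L[ℝ] ℝ) x := by
      have : (fun y => ⟪r y, r y⟫) = fun _ => ρ^2 := by
        ext y; rw [real_inner_self_eq_norm_sq, h1]
      rw [this]; exact hasFDerivAt_const _ _
    have := congrArg (fun L => L z) (hd1.unique hd2)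
    simp [hz, real_inner_self_eq_norm_sq, h1] at this
    exact hρ.ne' this
  have hintg : ∀ t : ℝ, IntegrableOn (fun x =>
      (ContinuousLinearMap.id ℝ E + t • fderiv ℝ ψ x).det) (closedBall (0:E) ρ) := by
    intro t
    apply ContinuousOn.integrableOn_compact (isCompact_closedBall _ _)
    apply Continuous.continuousOn
    exact ContinuousLinearMap.continuous_det.comp
      (continuous_const.add ((hψ.continuous_fderiv one_ne_zero).const_smul t))
  have hkey : ∫ x in closedBall (0:E) ρ, (ContinuousLinearMap.id ℝ E + (1:ℝ) • fderiv ℝ ψ x).det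
      = ∫ x in closedBall (0:E) ρ, (1:ℝ) := by
    have : ∀ x, (ContinuousLinearMap.id ℝ E + (1:ℝ) • fderiv ℝ ψ x).det =
        ∑ i ∈ s, (ContinuousLinearMap.id ℝ E + (v i) • fderiv ℝ ψ x).det * w i := by
      intro x
      obtain ⟨p, hp, hpe⟩ := det_poly (fderiv ℝ ψ x)
      simp only [hpe]
      exact hint p hp
    simp only [this]
    rw [integral_finsetSum _ (fun i _ => (hintg (v i)).mul_const (w i))]
    simp only [integral_mul_const]
    have hi : ∀ i ∈ s, (∫ x in closedBall (0:E) ρ,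
        (ContinuousLinearMap.id ℝ E + (v i) • fderiv ℝ ψ x).det) * w i
        = (∫ x in closedBall (0:E) ρ, (1:ℝ)) * w i := by
      intro i hi
      rw [hvol (v i) (by positivity)]
      have : (i:ℝ) / (d+1) ≤ 1 := by
        rw [div_le_one (by positivity)]
        have := Finset.mem_range.1 hi
        exact_mod_cast this.le
      exact mul_le_of_le_one_right ht0.le this
    rw [Finset.sum_congr rfl hi, ← Finset.mul_sum, hwsum, mul_one]
  simp only [hdet0] at hkey
  simp at hkey
  have hpos : 0 < (volume (closedBall (0:E) ρ)).toReal :=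
    ENNReal.toReal_pos (measure_closedBall_pos _ _ hρ).ne' measure_closedBall_lt_top.ne
  rw [Measure.real] at hkey
  exact hpos.ne hkey

theorem zero_of_bounded_aux (F : E → E) (hF : Continuous F) (M : ℝ) (hM0 : 0 < M)
    (hM : ∀ x, M ≤ ‖x‖ → F x = x) : ∃ x, F x = 0 := by
  by_contra hcon
  push Not at hcon
  -- lower bound
  obtain ⟨ε, hε, hεF⟩ : ∃ ε > 0, ∀ x, ε ≤ ‖F x‖ := by
    obtain ⟨x0, hx0, hmin⟩ := (isCompact_closedBall (0:E) M).exists_isMinOn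
      ⟨0, by simp [hM0.le]⟩ (hF.norm.continuousOn)
    refine ⟨min ‖F x0‖ M, lt_min (norm_pos_iff.2 (hcon x0)) hM0, fun x => ?_⟩
    by_cases hx : ‖x‖ ≤ M
    · exact (min_le_left _ _).trans (hmin (by simpa using hx))
    · push Not at hx
      rw [hM x hx.le]
      exact (min_le_right _ _).trans hx.le
  obtain ⟨G, hGc, hGd⟩ : ∃ G : E → E, ContDiff ℝ 1 G ∧ ∀ x, ‖G x - F x‖ ≤ ε / 2 := by
    have huc : UniformContinuous F := by
      have h1 : UniformContinuous (fun x => F x - x) := by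
        apply Continuous.uniformContinuous_of_tendsto_cocompact (x := 0) (hF.sub continuous_id)
        refine HasCompactSupport.is_zero_at_infty ?_
        apply HasCompactSupport.intro (isCompact_closedBall (0:E) M)
        intro x hx
        have : M ≤ ‖x‖ := by
          have : ¬ ‖x‖ ≤ M := by simpa using hx
          exact (not_le.1 this).le
        simp [hM x this]
      have := h1.add uniformContinuous_id
      simpa using this
    obtain ⟨g, hg1, hg2⟩ := huc.exists_contDiff_dist_le (half_pos hε)
    exact ⟨g, hg1.of_le (by exact_mod_cast le_top), fun x => by
      have := (hg2 x).le
      rwa [dist_eq_norm] at this⟩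
  let χ : ContDiffBump (0:E) := ⟨M, 2 * M, hM0, by linarith⟩
  let G2 : E → E := fun x => χ x • G x + (1 - χ x) • x
  have hG2c : ContDiff ℝ 1 G2 := by
    have hχ : ContDiff ℝ 1 (fun x => χ x) := χ.contDiff
    exact (hχ.smul hGc).add ((contDiff_const.sub hχ).smul contDiff_id)
  have hG2d : ∀ x, ‖G2 x - F x‖ ≤ ε / 2 := by
    intro x
    by_cases hx : ‖x‖ ≤ M
    · have : χ x = 1 := χ.one_of_mem_closedBall (by simpa using hx)
      simp only [G2, this, one_smul, sub_self, zero_smul, add_zero]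
      exact hGd x
    · push Not at hx
      have hFx := hM x hx.le
      have : G2 x - F x = χ x • (G x - F x) := by
        simp only [G2]
        rw [hFx, sub_smul, smul_sub, one_smul]; abel
      rw [this, norm_smul, Real.norm_of_nonneg χ.nonneg]
      exact (mul_le_of_le_one_left (norm_nonneg _) χ.le_one).trans (hGd x)
  have hG20 : ∀ x, G2 x ≠ 0 := by
    intro x hx
    have h1 := hG2d x
    rw [hx, zero_sub, norm_neg] at h1
    have := hεF x
    linarith
  refine no_retraction (fun x => (2 * M / ‖G2 x‖) • G2 x) ?_ (2 * M) (by linarith) ?_ ?_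
  · apply ContDiff.smul _ hG2c
    exact contDiff_const.div (hG2c.norm ℝ hG20) (fun x => norm_ne_zero_iff.2 (hG20 x))
  · intro x
    rw [norm_smul, norm_div, norm_norm, Real.norm_of_nonneg (by linarith : 0 ≤ 2 * M)]
    exact div_mul_cancel₀ _ (norm_ne_zero_iff.2 (hG20 x))
  · intro x hx
    have : χ x = 0 := χ.zero_of_le_dist (by simp [χ, hx])
    have h3 : G2 x = x := by simp [G2, this]
    simp only [h3, hx]
    rw [div_self (by linarith), one_smul]

end brouwer

/-- A continuous map at bounded distance from the identity has a zero. -/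
theorem zero_of_bounded {E : Type*} [NormedAddCommGroup E] [InnerProductSpace ℝ E]
    [FiniteDimensional ℝ E] (F : E → E) (hF : Continuous F) (M : ℝ)
    (hM : ∀ x, ‖F x - x‖ ≤ M) : ∃ x, F x = 0 := by
  borelize E
  have hM0 : 0 ≤ M := (norm_nonneg _).trans (hM 0)
  let χ : ContDiffBump (0:E) := ⟨M + 1, M + 2, by linarith, by linarith⟩
  obtain ⟨x, hx⟩ := zero_of_bounded_aux (fun x => x + χ x • (F x - x))
    (continuous_id.add (χ.continuous.smul (hF.sub continuous_id))) (M + 2) (by linarith) (by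
      intro x hx
      have : χ x = 0 := χ.zero_of_le_dist (by simpa [χ] using hx)
      simp [this])
  refine ⟨x, ?_⟩
  have hxn : ‖x‖ ≤ M := by
    have : x = - (χ x • (F x - x)) := eq_neg_of_add_eq_zero_left hx
    rw [this, norm_neg, norm_smul, Real.norm_of_nonneg χ.nonneg]
    exact (mul_le_of_le_one_left (norm_nonneg _) χ.le_one).trans (hM x)
  have : χ x = 1 := χ.one_of_mem_closedBall (by simp [χ]; linarith)
  simpa [this] using hx

end

section

theorem deform {E : Type*} [NormedAddCommGroup E] [InnerProductSpace ℝ E]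
    (Ac : E → ℝ) (hA : Continuous Ac) (V : E → E) (hV : Continuous V)
    (hexp : ∀ ρ ε : ℝ, 0 < ε → ∃ s : ℝ, 0 < s ∧ ∀ c v : E, ‖c‖ ≤ ρ → ‖v‖ ≤ s →
      Ac (c + v) ≤ Ac c + ⟪V c, v⟫ + ε * ‖v‖)
    (β τ C0 δ : ℝ) (hβ : 0 < β) (hδ : 0 < δ) (hno : ∀ c, β / 2 ≤ Ac c → δ ≤ ‖V c‖) :
    ∃ (γ : E → E) (M : ℝ), Continuous γ ∧ (∀ c, ‖γ c - c‖ ≤ M) ∧ (∀ c, Ac c ≤ 0 → γ c = c) ∧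
      (∀ c, ‖c‖ ≤ τ → Ac c ≤ C0 → Ac (γ c) < β) := by
  set D : ℝ := 2 * |C0| / δ + 1 with hD
  obtain ⟨s', hs', hs'e⟩ := hexp (|τ| + D) (δ / 2) (half_pos hδ)
  set s := min s' 1 with hs
  have hs0 : 0 < s := lt_min hs' one_pos
  let χ : E → ℝ := fun c => max 0 (min 1 ((Ac c - β / 2) / (β / 4)))
  have hχ0 : ∀ c, 0 ≤ χ c := fun c => le_max_left _ _
  have hχ1 : ∀ c, χ c ≤ 1 := fun c => max_le zero_le_one (min_le_left _ _)
  have hχz : ∀ c, Ac c ≤ β / 2 → χ c = 0 := by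
    intro c hc
    apply max_eq_left
    refine (min_le_right _ _).trans ?_
    apply div_nonpos_of_nonpos_of_nonneg <;> linarith
  have hχo : ∀ c, 3 * β / 4 ≤ Ac c → χ c = 1 := by
    intro c hc
    have : 1 ≤ (Ac c - β / 2) / (β / 4) := by
      rw [le_div_iff₀ (by linarith)]; linarith
    simp only [χ]
    rw [min_eq_left this]; simp
  have hmx : ∀ c, 0 < max ‖V c‖ δ := fun c => lt_max_of_lt_right hδ
  let η : E → E := fun c => c - (s * χ c / max ‖V c‖ δ) • V c
  have hηc : Continuous η := by
    have hχc : Continuous χ := by fun_prop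
    apply continuous_id.sub
    apply Continuous.smul _ hV
    exact (continuous_const.mul hχc).div (hV.norm.max continuous_const) (fun c => (hmx c).ne')
  have hvn : ∀ c, ‖(s * χ c / max ‖V c‖ δ) • V c‖ ≤ s * χ c := by
    intro c
    rw [norm_smul, Real.norm_of_nonneg
      (div_nonneg (mul_nonneg hs0.le (hχ0 c)) (hmx c).le), div_mul_eq_mul_div]
    rw [div_le_iff₀ (hmx c)]
    exact mul_le_mul_of_nonneg_left (le_max_left _ _) (mul_nonneg hs0.le (hχ0 c))
  have hηd : ∀ c, ‖η c - c‖ ≤ s := by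
    intro c
    have : η c - c = -((s * χ c / max ‖V c‖ δ) • V c) := by simp [η]
    rw [this, norm_neg]
    exact (hvn c).trans (mul_le_of_le_one_right hs0.le (hχ1 c))
  have hηf : ∀ c, Ac c ≤ β / 2 → η c = c := by
    intro c hc; simp [η, hχz c hc]
  have hdec : ∀ c, ‖c‖ ≤ |τ| + D → Ac (η c) ≤ Ac c - s * χ c * (δ / 2) := by
    intro c hc
    by_cases h : Ac c ≤ β / 2
    · rw [hηf c h, hχz c h]; simp
    · push Not at h
      have hVδ := hno c h.le
      have hmxe : max ‖V c‖ δ = ‖V c‖ := max_eq_left hVδ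
      have hvp : 0 < ‖V c‖ := hδ.trans_le hVδ
      have hv := hvn c
      have h1 := hs'e c (-((s * χ c / max ‖V c‖ δ) • V c)) hc (by
        rw [norm_neg]
        exact hv.trans ((mul_le_of_le_one_right hs0.le (hχ1 c)).trans (min_le_left _ _)))
      rw [← sub_eq_add_neg] at h1
      change Ac (η c) ≤ _ at h1
      rw [norm_neg, inner_neg_right, inner_smul_right, real_inner_self_eq_norm_sq] at h1
      have e1 : s * χ c / max ‖V c‖ δ * ‖V c‖ ^ 2 = s * χ c * ‖V c‖ := by
        rw [hmxe]; field_simp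
      rw [e1] at h1
      have h2 : s * χ c * δ ≤ s * χ c * ‖V c‖ :=
        mul_le_mul_of_nonneg_left hVδ (mul_nonneg hs0.le (hχ0 c))
      nlinarith
  set k : ℕ := ⌈2 * |C0| / (δ * s)⌉₊ with hk
  have hk1 : 2 * |C0| / (δ * s) ≤ k := Nat.le_ceil _
  have hk2 : (k:ℝ) < 2 * |C0| / (δ * s) + 1 := Nat.ceil_lt_add_one (by positivity)
  have hks : (k:ℝ) * s ≤ D := by
    have : 2 * |C0| / (δ * s) * s = 2 * |C0| / δ := by field_simp
    have h1 : (k:ℝ) * s ≤ (2 * |C0| / (δ * s) + 1) * s := by gcongr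
    have h2 : s ≤ 1 := min_le_right _ _
    rw [add_mul, this] at h1
    linarith
  have hks2 : C0 ≤ k * s * (δ / 2) := by
    rw [div_le_iff₀ (by positivity)] at hk1
    have := le_abs_self C0
    nlinarith
  have hdisp : ∀ (j : ℕ) c, ‖η^[j] c - c‖ ≤ j * s := by
    intro j c
    induction j with
    | zero => simp
    | succ j ih =>
      rw [Function.iterate_succ_apply']
      have : η (η^[j] c) - c = (η (η^[j] c) - η^[j] c) + (η^[j] c - c) := by abel
      rw [this]
      refine (norm_add_le _ _).trans ?_
      have := hηd (η^[j] c)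
      push_cast
      linarith
  refine ⟨η^[k], k * s, hηc.iterate k, hdisp k, ?_, ?_⟩
  · intro c hc
    exact Function.iterate_fixed (hηf c (by linarith)) k
  · intro c hc hcC
    have hind : ∀ j : ℕ, j ≤ k → Ac (η^[j] c) ≤ max (3 * β / 4) (Ac c - j * s * (δ / 2)) := by
      intro j
      induction j with
      | zero => intro _; simp
      | succ j ih =>
        intro hj
        have ih := ih (by omega)
        rw [Function.iterate_succ_apply']
        have hb : ‖η^[j] c‖ ≤ |τ| + D := by
          have h1 := hdisp j c
          have h2 : (j:ℝ) * s ≤ k * s := by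
            have : (j:ℝ) ≤ k := by exact_mod_cast (by omega : j ≤ k)
            gcongr
          have h3 : ‖η^[j] c‖ ≤ ‖η^[j] c - c‖ + ‖c‖ := by
            simpa using norm_add_le (η^[j] c - c) c
          have := le_abs_self τ
          linarith
        have hd := hdec _ hb
        by_cases h : Ac (η^[j] c) ≤ 3 * β / 4
        · apply le_max_of_le_left
          have : 0 ≤ s * χ (η^[j] c) * (δ / 2) := by
            have := hχ0 (η^[j] c); positivity
          linarith
        · push Not at h
          rw [hχo _ h.le] at hd
          apply le_max_of_le_right
          rcases le_max_iff.1 ih with h' | h'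
          · linarith
          · push_cast; linarith
    refine lt_of_le_of_lt (hind k le_rfl) (max_lt (by linarith) ?_)
    linarith

theorem minmax {ι : Type*} [Fintype ι] [DecidableEq ι] (pos : ι → Prop) [DecidablePred pos]
    (i₁ : ι) (hi₁ : pos i₁)
    (Ac : EuclideanSpace ℝ ι → ℝ) (hA : Continuous Ac)
    (V : EuclideanSpace ℝ ι → EuclideanSpace ℝ ι) (hV : Continuous V)
    (hexp : ∀ ρ ε : ℝ, 0 < ε → ∃ s : ℝ, 0 < s ∧ ∀ c v : EuclideanSpace ℝ ι, ‖c‖ ≤ ρ → ‖v‖ ≤ s →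
      Ac (c + v) ≤ Ac c + ⟪V c, v⟫ + ε * ‖v‖)
    (c0 : EuclideanSpace ℝ ι) (α β τ C0 : ℝ) (hα : 0 < α) (hβ : 0 < β)
    (hΓ : ∀ c : EuclideanSpace ℝ ι, (∀ i, ¬ pos i → c i = c0 i) →
      (∑ i, if pos i then c i ^ 2 else 0) = α ^ 2 → β ≤ Ac c)
    (hS0 : ∀ c : EuclideanSpace ℝ ι, (∀ i, pos i → c i = 0) → Ac c ≤ 0)
    (hS1 : ∀ c : EuclideanSpace ℝ ι, (∀ i, pos i → i ≠ i₁ → c i = 0) → Ac c ≤ C0)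
    (hS2 : ∀ c : EuclideanSpace ℝ ι, (∀ i, pos i → i ≠ i₁ → c i = 0) → τ ≤ ‖c‖ → Ac c ≤ 0)
    (δ : ℝ) (hδ : 0 < δ) : ∃ c, ‖V c‖ < δ ∧ β / 2 ≤ Ac c := by
  by_contra hcon
  push Not at hcon
  obtain ⟨γ, M, hγc, hγM, hγ0, hγβ⟩ := deform Ac hA V hV hexp β τ C0 δ hβ hδ (by
    intro c hc
    by_contra h
    push Not at h
    have := hcon c h
    linarith)
  let w : EuclideanSpace ℝ ι → EuclideanSpace ℝ ι := fun v => WithLp.toLp 2 (fun i =>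
    if pos i then (if i = i₁ then max (v i₁) 0 else 0) else v i)
  let Pp : EuclideanSpace ℝ ι → EuclideanSpace ℝ ι := fun v => WithLp.toLp 2 (fun i =>
    if pos i then v i else 0)
  let F : EuclideanSpace ℝ ι → EuclideanSpace ℝ ι := fun v => WithLp.toLp 2 (fun i =>
    if pos i then (if i = i₁ then ‖Pp (γ (w v))‖ + min (v i₁) 0 - α else v i)
      else γ (w v) i - c0 i)
  have hwc : Continuous w := by
    refine (PiLp.continuous_toLp 2 _).comp (continuous_pi fun i => ?_)
    split_ifs <;> fun_prop
  have hPc : Continuous Pp := by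
    refine (PiLp.continuous_toLp 2 _).comp (continuous_pi fun i => ?_)
    split_ifs <;> fun_prop
  have hFc : Continuous F := by
    refine (PiLp.continuous_toLp 2 _).comp (continuous_pi fun i => ?_)
    split_ifs <;> fun_prop
  have hPn : ∀ v, ‖Pp v‖ ^ 2 = ∑ i, if pos i then v i ^ 2 else 0 := by
    intro v
    rw [EuclideanSpace.norm_sq_eq]
    refine Finset.sum_congr rfl fun i _ => ?_
    by_cases h : pos i <;> simp [Pp, h]
  have hPsub : ∀ u v, ‖Pp u - Pp v‖ ≤ ‖u - v‖ := by
    intro u v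
    rw [EuclideanSpace.norm_eq, EuclideanSpace.norm_eq]
    apply Real.sqrt_le_sqrt
    refine Finset.sum_le_sum fun i _ => ?_
    by_cases h : pos i <;> simp [Pp, h]
    positivity
  have hPw : ∀ v, ‖Pp (w v)‖ = max (v i₁) 0 := by
    intro v
    have h1 : ‖Pp (w v)‖ ^ 2 = (max (v i₁) 0) ^ 2 := by
      rw [hPn, Finset.sum_eq_single i₁]
      · simp [w, hi₁]
      · intro i _ hi
        by_cases h : pos i <;> simp [w, h, hi]
      · simp
    exact (sq_eq_sq₀ (norm_nonneg _) (le_max_right _ _)).1 h1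
  have hcoord : ∀ (v : EuclideanSpace ℝ ι) i, |v i| ≤ ‖v‖ := fun v i => by
    simpa using PiLp.norm_apply_le v i
  have hFb : ∀ v, ‖F v - v‖ ≤ Real.sqrt (Fintype.card ι) * (M + ‖c0‖ + α) := by
    intro v
    have hB : 0 ≤ M + ‖c0‖ + α := by
      have := (norm_nonneg _).trans (hγM 0); positivity
    have hM0 := (norm_nonneg _).trans (hγM 0)
    have hi : ∀ i, |(F v - v) i| ≤ M + ‖c0‖ + α := by
      intro i
      by_cases h : pos i
      · by_cases h' : i = i₁
        · subst h'
          have e : (F v - v) i = (‖Pp (γ (w v))‖ - ‖Pp (w v)‖) - α := by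
            rw [hPw]
            simp [F, h]
            have := max_add_min (v i) 0
            linarith
          rw [e]
          have h1 := abs_norm_sub_norm_le (Pp (γ (w v))) (Pp (w v))
          have h2 := (h1.trans (hPsub _ _)).trans (hγM _)
          have h3 := abs_sub (‖Pp (γ (w v))‖ - ‖Pp (w v)‖) α
          rw [abs_of_pos hα] at h3
          have := norm_nonneg c0
          linarith
        · simp [F, h, h']; exact hB
      · have e : (F v - v) i = (γ (w v) - w v) i - c0 i := by
          simp [F, h, w]; ring
        rw [e]
        have h1 := (hcoord (γ (w v) - w v) i).trans (hγM _)
        have h2 := hcoord c0 i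
        have h3 := abs_sub ((γ (w v) - w v) i) (c0 i)
        linarith
    rw [EuclideanSpace.norm_eq]
    rw [← Real.sqrt_sq hB, ← Real.sqrt_mul (by positivity)]
    apply Real.sqrt_le_sqrt
    calc ∑ i, ‖(F v - v) i‖ ^ 2 ≤ ∑ i : ι, (M + ‖c0‖ + α) ^ 2 := by
          refine Finset.sum_le_sum fun i _ => ?_
          have := hi i
          rw [← Real.norm_eq_abs] at this
          gcongr
      _ = _ := by simp
  obtain ⟨v, hv⟩ := zero_of_bounded F hFc _ hFb
  have hvi : ∀ i, F v i = 0 := fun i => by rw [hv]; rfl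
  have hw1 : ∀ i, pos i → i ≠ i₁ → w v i = 0 := by
    intro i h h'; simp [w, h, h']
  have h1 := hvi i₁
  simp only [F, hi₁, if_true] at h1
  have hge : 0 ≤ v i₁ := by
    by_contra hneg
    push Not at hneg
    have hw0 : ∀ i, pos i → w v i = 0 := by
      intro i h
      by_cases h' : i = i₁
      · simp [w, h, h', hneg.le, hi₁]
      · exact hw1 i h h'
    rw [hγ0 _ (hS0 _ hw0), hPw, max_eq_right hneg.le, min_eq_left hneg.le] at h1
    linarith
  rw [min_eq_right hge] at h1
  have hge2 : β ≤ Ac (γ (w v)) := by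
    apply hΓ
    · intro i hi
      have := hvi i
      simp only [F, hi, if_false] at this
      linarith
    · rw [← hPn]
      congr 1; linarith
  by_cases hτ : τ ≤ ‖w v‖
  · have h2 := hS2 _ hw1 hτ
    rw [hγ0 _ h2] at hge2
    linarith
  · push Not at hτ
    have := hγβ _ hτ.le (hS1 _ hw1)
    linarith

end

section

theorem clm_ext_basis {F : Type*} [NormedAddCommGroup F] [NormedSpace ℝ F] {b : ℕ × Bool → Z}
    (hb : IsHilbertBasis b) {f g : Z →L[ℝ] F} (h : ∀ i, f (b i) = g (b i)) : f = g := by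
  apply ContinuousLinearMap.ext_on (s := Set.range b)
  · intro x
    have : x ∈ (Submodule.span ℝ (Set.range b)).topologicalClosure := by rw [hb.2]; trivial
    exact this
  · rintro _ ⟨i, rfl⟩; exact h i

theorem J_sq {b : ℕ × Bool → Z} {J : Z →L[ℝ] Z} (hb : IsHilbertBasis b) (hJ : IsJ b J) (x : Z) :
    J (J x) = -x := by
  have : J.comp J = -ContinuousLinearMap.id ℝ Z := by
    apply clm_ext_basis hb
    rintro ⟨j, s⟩
    cases s <;> simp [(hJ j).1, (hJ j).2]
  simpa using congrArg (fun L : Z →L[ℝ] Z => L x) this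

theorem J_skew {b : ℕ × Bool → Z} {J : Z →L[ℝ] Z} (hb : IsHilbertBasis b) (hJ : IsJ b J)
    (x y : Z) : ⟪J x, y⟫ = -⟪x, J y⟫ := by
  have hon := fun i j => orthonormal_iff_ite.1 hb.1 i j
  have h1 : ∀ i : ℕ × Bool, ∀ y, ⟪J (b i), y⟫ = -⟪b i, J y⟫ := by
    intro i y
    have : innerSL ℝ (J (b i)) = -((innerSL ℝ (b i)).comp J) := by
      apply clm_ext_basis hb
      rintro ⟨j, s⟩
      obtain ⟨k, s'⟩ := i
      cases s <;> cases s' <;> simp [(hJ j).1, (hJ j).2, (hJ k).1, (hJ k).2, hon]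
    simpa using congrArg (fun L : Z →L[ℝ] ℝ => L y) this
  have h2 : (innerSL ℝ y).comp J = -(innerSL ℝ (J y)) := by
    apply clm_ext_basis hb
    intro i
    simp only [ContinuousLinearMap.comp_apply, innerSL_apply_apply, ContinuousLinearMap.neg_apply]
    rw [real_inner_comm, h1, real_inner_comm]
  have := congrArg (fun L : Z →L[ℝ] ℝ => L x) h2
  simp only [ContinuousLinearMap.comp_apply, innerSL_apply_apply, ContinuousLinearMap.neg_apply] at this
  rw [real_inner_comm, this, real_inner_comm]

theorem J_inner {b : ℕ × Bool → Z} {J : Z →L[ℝ] Z} (hb : IsHilbertBasis b) (hJ : IsJ b J)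
    (x y : Z) : ⟪J x, J y⟫ = ⟪x, y⟫ := by
  rw [J_skew hb hJ, J_sq hb hJ, inner_neg_right, neg_neg]

theorem J_norm {b : ℕ × Bool → Z} {J : Z →L[ℝ] Z} (hb : IsHilbertBasis b) (hJ : IsJ b J)
    (x : Z) : ‖J x‖ = ‖x‖ := by
  have := J_inner hb hJ x x
  rw [real_inner_self_eq_norm_sq, real_inner_self_eq_norm_sq] at this
  exact (sq_eq_sq₀ (norm_nonneg _) (norm_nonneg _)).1 this

theorem J_self {b : ℕ × Bool → Z} {J : Z →L[ℝ] Z} (hb : IsHilbertBasis b) (hJ : IsJ b J)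
    (x : Z) : ⟪J x, x⟫ = 0 := by
  have := J_skew hb hJ x x
  rw [real_inner_comm x (J x)] at this
  linarith [real_inner_comm x (J x)]

/-- projection onto the planes with index in `R`. -/
def PP (b : ℕ × Bool → Z) (R : Finset ℕ) : Z →L[ℝ] Z :=
  ∑ i ∈ R ×ˢ (Finset.univ : Finset Bool), (innerSL ℝ (b i)).smulRight (b i)

theorem PP_apply (b : ℕ × Bool → Z) (R : Finset ℕ) (z : Z) :
    PP b R z = ∑ i ∈ R ×ˢ (Finset.univ : Finset Bool), ⟪b i, z⟫ • b i := by
  simp [PP, ContinuousLinearMap.sum_apply]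

theorem PP_inner_left {b : ℕ × Bool → Z} (hb : IsHilbertBasis b) (R : Finset ℕ) (i : ℕ × Bool)
    (z : Z) : ⟪b i, PP b R z⟫ = if i.1 ∈ R then ⟪b i, z⟫ else 0 := by
  rw [PP_apply, inner_sum]
  simp only [inner_smul_right]
  simp only [orthonormal_iff_ite.1 hb.1]
  simp

theorem PP_selfadj {b : ℕ × Bool → Z} (R : Finset ℕ) (x y : Z) :
    ⟪PP b R x, y⟫ = ⟪x, PP b R y⟫ := by
  rw [PP_apply, PP_apply, inner_sum, sum_inner]
  refine Finset.sum_congr rfl fun i _ => ?_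
  rw [inner_smul_left, inner_smul_right, real_inner_comm x]
  simp; ring

theorem PP_idem {b : ℕ × Bool → Z} (hb : IsHilbertBasis b) (R : Finset ℕ) (x : Z) :
    PP b R (PP b R x) = PP b R x := by
  conv_lhs => rw [PP_apply]
  conv_rhs => rw [PP_apply]
  refine Finset.sum_congr rfl fun i hi => ?_
  rw [PP_inner_left hb, if_pos]
  simpa using (Finset.mem_product.1 hi).1

theorem PP_norm_sq {b : ℕ × Bool → Z} (hb : IsHilbertBasis b) (R : Finset ℕ) (x : Z) :
    ‖PP b R x‖ ^ 2 = ∑ i ∈ R ×ˢ (Finset.univ : Finset Bool), ⟪b i, x⟫ ^ 2 := by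
  rw [← real_inner_self_eq_norm_sq, PP_selfadj, PP_idem hb, PP_apply, inner_sum]
  refine Finset.sum_congr rfl fun i _ => ?_
  rw [inner_smul_right, real_inner_comm x, sq]

theorem PP_inner_self {b : ℕ × Bool → Z} (hb : IsHilbertBasis b) (R : Finset ℕ) (x : Z) :
    ⟪PP b R x, x⟫ = ‖PP b R x‖ ^ 2 := by
  rw [← real_inner_self_eq_norm_sq, PP_selfadj, PP_selfadj, PP_idem hb]

theorem PP_pyth {b : ℕ × Bool → Z} (hb : IsHilbertBasis b) (R : Finset ℕ) (x : Z) :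
    ‖x‖ ^ 2 = ‖PP b R x‖ ^ 2 + ‖x - PP b R x‖ ^ 2 := by
  rw [norm_sub_sq_real, real_inner_comm, PP_inner_self hb]; ring

theorem PP_norm_le {b : ℕ × Bool → Z} (hb : IsHilbertBasis b) (R : Finset ℕ) (x : Z) :
    ‖PP b R x‖ ≤ ‖x‖ := by
  have := PP_pyth hb R x
  exact abs_le_of_sq_le_sq' (by nlinarith [sq_nonneg ‖x - PP b R x‖]) (norm_nonneg _) |>.2

theorem QQ_norm_le {b : ℕ × Bool → Z} (hb : IsHilbertBasis b) (R : Finset ℕ) (x : Z) :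
    ‖x - PP b R x‖ ≤ ‖x‖ := by
  have := PP_pyth hb R x
  exact abs_le_of_sq_le_sq' (by nlinarith [sq_nonneg ‖PP b R x‖]) (norm_nonneg _) |>.2

theorem PP_J {b : ℕ × Bool → Z} {J : Z →L[ℝ] Z} (hb : IsHilbertBasis b) (hJ : IsJ b J)
    (R : Finset ℕ) (x : Z) : PP b R (J x) = J (PP b R x) := by
  rw [PP_apply, PP_apply, map_sum, Finset.sum_product, Finset.sum_product]
  refine Finset.sum_congr rfl fun j _ => ?_
  have h := fun i => J_skew hb hJ (b i) x
  simp only [Fintype.univ_bool, Finset.sum_insert, Finset.mem_singleton, Bool.true_eq_false,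
    not_false_iff, Finset.sum_singleton, map_smul]
  have h1 := h (j, true)
  have h2 := h (j, false)
  rw [(hJ j).1] at h1 ⊢
  rw [(hJ j).2] at h2 ⊢
  rw [inner_neg_left] at h1
  rw [← neg_eq_iff_eq_neg.2 h2, ← neg_injective h1]
  simp [add_comm]

theorem PP_range_tendsto {b : ℕ × Bool → Z} (hb : IsHilbertBasis b) (x : Z) :
    Filter.Tendsto (fun m => PP b (Finset.range m) x) Filter.atTop (nhds x) := by
  have hfin : ∀ y ∈ Submodule.span ℝ (Set.range b), ∃ m0, ∀ m ≥ m0,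
      PP b (Finset.range m) y = y := by
    intro y hy
    induction hy using Submodule.span_induction with
    | mem y hy =>
      obtain ⟨⟨j, s⟩, rfl⟩ := hy
      refine ⟨j + 1, fun m hm => ?_⟩
      rw [PP_apply, Finset.sum_eq_single (j, s)]
      · rw [orthonormal_iff_ite.1 hb.1]; simp
      · intro i _ hi
        rw [orthonormal_iff_ite.1 hb.1, if_neg hi]; simp
      · intro h; exfalso; apply h; simp; omega
    | zero => exact ⟨0, fun m _ => by simp⟩
    | add u v _ _ hu hv =>
      obtain ⟨m1, h1⟩ := hu
      obtain ⟨m2, h2⟩ := hv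
      exact ⟨max m1 m2, fun m hm => by
        rw [map_add, h1 m (le_trans (le_max_left _ _) hm), h2 m (le_trans (le_max_right _ _) hm)]⟩
    | smul c u _ hu =>
      obtain ⟨m1, h1⟩ := hu
      exact ⟨m1, fun m hm => by rw [map_smul, h1 m hm]⟩
  rw [Metric.tendsto_atTop]
  intro ε hε
  have hx : x ∈ closure (Submodule.span ℝ (Set.range b) : Set Z) := by
    have : x ∈ (Submodule.span ℝ (Set.range b)).topologicalClosure := by rw [hb.2]; trivial
    exact this
  obtain ⟨y, hy, hxy⟩ := Metric.mem_closure_iff.1 hx ε hε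
  obtain ⟨m0, h0⟩ := hfin y hy
  refine ⟨m0, fun m hm => ?_⟩
  rw [dist_comm, dist_eq_norm]
  have : x - PP b (Finset.range m) x = (x - y) - PP b (Finset.range m) (x - y) := by
    rw [map_sub, h0 m hm]; abel
  rw [this]
  refine (QQ_norm_le hb _ _).trans_lt ?_
  rwa [← dist_eq_norm]

theorem compact_tail {b : ℕ × Bool → Z} (hb : IsHilbertBasis b) {K : Set Z} (hK : IsCompact K)
    {ε : ℝ} (hε : 0 < ε) : ∃ m0, ∀ m ≥ m0, ∀ y ∈ K, ‖y - PP b (Finset.range m) y‖ ≤ ε := by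
  obtain ⟨t, htK, htf, hcov⟩ := hK.finite_cover_balls (half_pos hε)
  have : ∀ x ∈ t, ∀ᶠ m in Filter.atTop, ‖x - PP b (Finset.range m) x‖ < ε / 2 := by
    intro x _
    have h1 := (PP_range_tendsto hb x)
    have h2 := (Metric.tendsto_nhds.1 h1) (ε / 2) (half_pos hε)
    filter_upwards [h2] with m hm
    rwa [dist_comm, dist_eq_norm] at hm
  obtain ⟨m0, hm0⟩ := Filter.eventually_atTop.1 ((Filter.eventually_all_finite htf).2 this)
  refine ⟨m0, fun m hm y hy => ?_⟩
  obtain ⟨x, hx, hyx⟩ := Set.mem_iUnion₂.1 (hcov hy)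
  have e : y - PP b (Finset.range m) y = ((y - x) - PP b (Finset.range m) (y - x))
      + (x - PP b (Finset.range m) x) := by rw [map_sub]; abel
  rw [e]
  refine (norm_add_le _ _).trans ?_
  have h1 := QQ_norm_le hb (Finset.range m) (y - x)
  have h2 := hm0 m hm x hx
  rw [mem_ball, dist_eq_norm] at hyx
  linarith

theorem udiff {E F : Type*} [NormedAddCommGroup E] [NormedSpace ℝ E] [NormedAddCommGroup F]
    [NormedSpace ℝ F] (f : E → F) (f' : E → E →L[ℝ] F) (hf : ∀ x, HasFDerivAt f (f' x) x)
    (hf' : Continuous f') {K : Set E} (hK : IsCompact K) {ε : ℝ} (hε : 0 < ε) :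
    ∃ δ > 0, ∀ y ∈ K, ∀ w, ‖w‖ ≤ δ → ‖f (y + w) - f y - f' y w‖ ≤ ε * ‖w‖ := by
  have h1 := hK.uniformContinuousAt_of_continuousAt f' (fun a _ => hf'.continuousAt)
    (Metric.dist_mem_uniformity hε)
  obtain ⟨δ, hδ, h2⟩ := Metric.mem_uniformity_dist.1 h1
  refine ⟨δ / 2, half_pos hδ, fun y hy w hw => ?_⟩
  have hconv : Convex ℝ (ball y δ) := convex_ball y δ
  have := hconv.norm_image_sub_le_of_norm_hasFDerivWithin_le (𝕜 := ℝ) (f := fun x => f x - f' y x)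
    (f' := fun x => f' x - f' y) (C := ε) (x := y) (y := y + w)
    (fun x hx => ((hf x).sub (f' y).hasFDerivAt).hasFDerivWithinAt)
    (fun x hx => by
      have := h2 (a := y) (b := x) (by rw [dist_comm]; exact hx) hy
      simp only [Set.mem_setOf_eq] at this
      rw [dist_comm, dist_eq_norm] at this
      exact this.le) (mem_ball_self hδ) (by rw [mem_ball, dist_eq_norm]; simp; linarith)
  simp only [add_sub_cancel_left, map_add] at this
  convert this using 2
  abel

theorem symplectic_flow (J : Z →L[ℝ] Z) (hJn : ∀ x, ‖J x‖ = ‖x‖)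
    (X : Z → Z) (X' : Z → Z →L[ℝ] Z) (hX : ∀ y, HasFDerivAt X (X' y) y) (hX' : Continuous X')
    (hsym : ∀ y v w, ⟪J (X' y v), w⟫ + ⟪J v, X' y w⟫ = 0)
    (Φ : ℝ → Z → Z) (h0 : ∀ z, Φ 0 z = z) (hode : ∀ z t, HasDerivAt (fun τ => Φ τ z) (X (Φ t z)) t)
    (T : ℝ) (z : Z) (DΦ : Z →L[ℝ] Z) (hD : HasFDerivAt (Φ T) DΦ z) (L : ℝ)
    (hL : ∀ τ, |τ| ≤ |T| → ∀ u u', ‖u - z‖ ≤ 1 → ‖u' - z‖ ≤ 1 →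
      ‖Φ τ u - Φ τ u'‖ ≤ L * ‖u - u'‖) (v w : Z) :
    ⟪J (DΦ v), DΦ w⟫ = ⟪J v, w⟫ := by
  have hcont : Continuous (fun τ => Φ τ z) := continuous_iff_continuousAt.2
    fun t => (hode z t).continuousAt
  have hK : IsCompact ((fun τ => Φ τ z) '' Set.Icc (-|T|) |T|) := isCompact_Icc.image hcont
  set L' := max L 0 with hL'
  have hL'0 : 0 ≤ L' := le_max_right _ _
  have hlim : ∀ v, Filter.Tendsto (fun s : ℝ => s⁻¹ • (Φ T (z + s • v) - Φ T z))
      (nhdsWithin 0 {0}ᶜ) (nhds (DΦ v)) := by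
    intro v
    have := (hD.hasLineDerivAt v).tendsto_slope_zero
    simpa using this
  have hlim2 : Filter.Tendsto (fun s : ℝ => ⟪J (s⁻¹ • (Φ T (z + s • v) - Φ T z)),
      s⁻¹ • (Φ T (z + s • w) - Φ T z)⟫) (nhdsWithin 0 {0}ᶜ) (nhds ⟪J (DΦ v), DΦ w⟫) :=
    ((J.continuous.tendsto _).comp (hlim v)).inner (hlim w)
  refine tendsto_nhds_unique hlim2 ?_
  rw [Metric.tendsto_nhds]
  intro ε0 hε0
  set B := 2 * L' ^ 2 * ‖v‖ * ‖w‖ * |T| with hB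
  have hB0 : 0 ≤ B := by positivity
  obtain ⟨δ, hδ, hu⟩ := udiff X X' hX hX' hK (ε := ε0 / (B + 1)) (by positivity)
  set M := (L' + 1) * (‖v‖ + ‖w‖ + 1) with hM
  have hM0 : 0 < M := by positivity
  have hev : ∀ᶠ s : ℝ in nhdsWithin 0 {0}ᶜ, |s| < min δ 1 / M := by
    apply nhdsWithin_le_nhds
    have := Metric.ball_mem_nhds (0:ℝ) (show 0 < min δ 1 / M by positivity)
    filter_upwards [this] with s hs
    simpa using hs
  filter_upwards [hev, self_mem_nhdsWithin] with s hs hs0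
  have hs0 : s ≠ 0 := hs0
  rw [lt_div_iff₀ hM0] at hs
  have hsδ : |s| * M ≤ δ := hs.le.trans (min_le_left _ _)
  have hs1 : |s| * M ≤ 1 := hs.le.trans (min_le_right _ _)
  have hsub : ∀ u : Z, ‖u‖ ≤ ‖v‖ + ‖w‖ → ∀ τ, |τ| ≤ |T| →
      ‖Φ τ (z + s • u) - Φ τ z‖ ≤ L' * (|s| * ‖u‖) ∧ ‖Φ τ (z + s • u) - Φ τ z‖ ≤ δ := by
    intro u hu τ hτ
    have e1 : |s| * ‖u‖ ≤ |s| * M := by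
      apply mul_le_mul_of_nonneg_left _ (abs_nonneg _)
      rw [hM]; nlinarith [norm_nonneg v, norm_nonneg w]
    have h1 := hL τ hτ (z + s • u) z (by simp [norm_smul]; linarith) (by simp)
    have h2 : ‖Φ τ (z + s • u) - Φ τ z‖ ≤ L' * (|s| * ‖u‖) := by
      refine h1.trans ?_
      simp only [add_sub_cancel_left, norm_smul, Real.norm_eq_abs]
      gcongr
      exact le_max_left _ _
    refine ⟨h2, h2.trans ?_⟩
    refine le_trans ?_ hsδ
    have : L' * (|s| * ‖u‖) = |s| * (L' * ‖u‖) := by ring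
    rw [this]
    apply mul_le_mul_of_nonneg_left _ (abs_nonneg _)
    rw [hM]
    have := norm_nonneg v
    have := norm_nonneg w
    gcongr <;> linarith
  have hvv : ‖v‖ ≤ ‖v‖ + ‖w‖ := by linarith [norm_nonneg w]
  have hww : ‖w‖ ≤ ‖v‖ + ‖w‖ := by linarith [norm_nonneg v]
  let F : ℝ → ℝ := fun t => ⟪J (Φ t (z + s • v) - Φ t z), Φ t (z + s • w) - Φ t z⟫
  let F' : ℝ → ℝ := fun t => ⟪J (Φ t (z + s • v) - Φ t z), X (Φ t (z + s • w)) - X (Φ t z)⟫ +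
    ⟪J (X (Φ t (z + s • v)) - X (Φ t z)), Φ t (z + s • w) - Φ t z⟫
  have hF : ∀ t, HasDerivAt F (F' t) t := by
    intro t
    have h1 := ((hode (z + s • v) t).sub (hode z t))
    have h2 := ((hode (z + s • w) t).sub (hode z t))
    have h3 := J.hasFDerivAt.comp_hasDerivAt t h1
    exact h3.inner ℝ h2
  have hF' : ∀ t ∈ Set.Icc (-|T|) |T|, ‖F' t‖ ≤ ε0 / (B + 1) * (2 * L' ^ 2 * ‖v‖ * ‖w‖) * s ^ 2 := by
    intro t ht
    have hτ : |t| ≤ |T| := abs_le.2 ht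
    obtain ⟨p1, p2⟩ := hsub v hvv t hτ
    obtain ⟨q1, q2⟩ := hsub w hww t hτ
    set y := Φ t z with hy
    set p := Φ t (z + s • v) - y with hp
    set q := Φ t (z + s • w) - y with hq
    have hyK : y ∈ (fun τ => Φ τ z) '' Set.Icc (-|T|) |T| := ⟨t, ht, rfl⟩
    have e1 := hu y hyK p p2
    have e2 := hu y hyK q q2
    have ep : y + p = Φ t (z + s • v) := by rw [hp]; abel
    have eq' : y + q = Φ t (z + s • w) := by rw [hq]; abel
    rw [ep] at e1
    rw [eq'] at e2
    have eF : F' t = ⟪J p, X (Φ t (z + s • w)) - X y - X' y q⟫ +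
        ⟪J (X (Φ t (z + s • v)) - X y - X' y p), q⟫ := by
      have := hsym y p q
      simp only [F', ← hy, ← hp, ← hq]
      rw [inner_sub_right (J p) (X (Φ t (z + s • w)) - X y), map_sub J (X (Φ t (z + s • v)) - X y),
        inner_sub_left (J (X (Φ t (z + s • v)) - X y))]
      linarith
    rw [eF]
    refine (norm_add_le _ _).trans ?_
    have g1 := norm_inner_le_norm (𝕜 := ℝ) (J p) (X (Φ t (z + s • w)) - X y - X' y q)
    have g2 := norm_inner_le_norm (𝕜 := ℝ) (J (X (Φ t (z + s • v)) - X y - X' y p)) q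
    rw [hJn] at g1 g2
    have hε1 : 0 ≤ ε0 / (B + 1) := by positivity
    have k1 : ‖p‖ * ‖X (Φ t (z + s • w)) - X y - X' y q‖ ≤
        (L' * (|s| * ‖v‖)) * (ε0 / (B + 1) * (L' * (|s| * ‖w‖))) := by
      have := e2.trans (mul_le_mul_of_nonneg_left q1 hε1)
      gcongr
    have k2 : ‖X (Φ t (z + s • v)) - X y - X' y p‖ * ‖q‖ ≤
        (ε0 / (B + 1) * (L' * (|s| * ‖v‖))) * (L' * (|s| * ‖w‖)) := by
      have := e1.trans (mul_le_mul_of_nonneg_left p1 hε1)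
      gcongr
    have := sq_abs s
    calc _ ≤ _ := add_le_add (g1.trans k1) (g2.trans k2)
      _ = _ := by rw [← sq_abs s]; ring
  have hmv := (convex_Icc (-|T|) |T|).norm_image_sub_le_of_norm_hasDerivWithin_le (f := F) (f' := F')
    (fun x _ => (hF x).hasDerivWithinAt) hF' (x := 0) (y := T)
    (by simp) ⟨neg_abs_le T, le_abs_self T⟩
  have hF0 : F 0 = s ^ 2 * ⟪J v, w⟫ := by
    simp only [F, h0, add_sub_cancel_left, map_smul, inner_smul_left, inner_smul_right]
    simp; ring
  have hFT : ⟪J (s⁻¹ • (Φ T (z + s • v) - Φ T z)), s⁻¹ • (Φ T (z + s • w) - Φ T z)⟫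
      = (s ^ 2)⁻¹ * F T := by
    simp only [F, map_smul, inner_smul_left, inner_smul_right]
    simp; ring
  rw [hFT, Real.dist_eq]
  have hs2 : 0 < s ^ 2 := by positivity
  have e3 : (s ^ 2)⁻¹ * F T - ⟪J v, w⟫ = (s ^ 2)⁻¹ * (F T - F 0) := by
    rw [hF0]; field_simp
  rw [e3, abs_mul, abs_of_pos (inv_pos.2 hs2)]
  rw [Real.norm_eq_abs, sub_zero, Real.norm_eq_abs] at hmv
  have : (s ^ 2)⁻¹ * |F T - F 0| ≤ ε0 / (B + 1) * B := by
    rw [inv_mul_le_iff₀ hs2]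
    refine hmv.trans (le_of_eq ?_)
    rw [hB]; ring
  refine this.trans_lt ?_
  rw [div_mul_eq_mul_div, div_lt_iff₀ (by positivity)]
  nlinarith

end

section

/-- Fourier modes on loops. -/
def ee (b : ℕ × Bool → Z) (J : Z →L[ℝ] Z) (p : ℤ × (ℕ × Bool)) (t : ℝ) : Z :=
  Real.cos (2 * Real.pi * p.1 * t) • b p.2 + Real.sin (2 * Real.pi * p.1 * t) • J (b p.2)

/-- Trigonometric loop with coefficients `c`. -/
def xx (b : ℕ × Bool → Z) (J : Z →L[ℝ] Z) {S : Finset (ℤ × (ℕ × Bool))}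
    (c : EuclideanSpace ℝ S) (t : ℝ) : Z := ∑ i : S, c i • ee b J i t

/-- restriction of coefficients. -/
def rs {S : Finset (ℤ × (ℕ × Bool))} (P : ℤ × (ℕ × Bool) → Prop) [DecidablePred P]
    (c : EuclideanSpace ℝ S) : EuclideanSpace ℝ S :=
  WithLp.toLp 2 (fun i => if P i then c i else 0)

/-- Fourier coefficients. -/
def co (b : ℕ × Bool → Z) (J : Z →L[ℝ] Z) (S : Finset (ℤ × (ℕ × Bool))) (g : ℝ → Z) :
    EuclideanSpace ℝ S := WithLp.toLp 2 (fun i => ∫ t in (0:ℝ)..1, ⟪g t, ee b J i t⟫)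

/-- The multiplier `2πk`. -/
def LL {S : Finset (ℤ × (ℕ × Bool))} (c : EuclideanSpace ℝ S) : EuclideanSpace ℝ S :=
  WithLp.toLp 2 (fun i => 2 * Real.pi * ((i : ℤ × (ℕ × Bool)).1 : ℝ) * c i)

section loops
variable {b : ℕ × Bool → Z} {J : Z →L[ℝ] Z} {S : Finset (ℤ × (ℕ × Bool))}

theorem ee_cont (p : ℤ × (ℕ × Bool)) : Continuous (ee b J p) := by
  unfold ee; fun_prop

theorem ee_deriv (hb : IsHilbertBasis b) (hJ : IsJ b J) (p : ℤ × (ℕ × Bool)) (t : ℝ) :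
    HasDerivAt (ee b J p) ((2 * Real.pi * p.1) • J (ee b J p t)) t := by
  have h0 : HasDerivAt (fun t : ℝ => 2 * Real.pi * p.1 * t) (2 * Real.pi * p.1) t := by
    simpa using (hasDerivAt_id t).const_mul (2 * Real.pi * p.1)
  have h1 := (h0.cos.smul_const (b p.2)).add (h0.sin.smul_const (J (b p.2)))
  have h2 : HasDerivAt (ee b J p) _ t := h1
  refine h2.congr_deriv ?_
  simp only [ee, map_add, map_smul, J_sq hb hJ]
  module

theorem ee_periodic (p : ℤ × (ℕ × Bool)) (t : ℝ) : ee b J p (t + 1) = ee b J p t := by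
  have h : 2 * Real.pi * p.1 * (t + 1) = 2 * Real.pi * p.1 * t + p.1 * (2 * Real.pi) := by ring
  simp only [ee, h, Real.cos_add_int_mul_two_pi, Real.sin_add_int_mul_two_pi]

theorem int_cos (n : ℤ) : ∫ t in (0:ℝ)..1, Real.cos (2 * Real.pi * n * t) = if n = 0 then 1 else 0 := by
  split_ifs with h
  · simp [h]
  · have hn : (2 * Real.pi * n : ℝ) ≠ 0 := by
      have := Real.pi_pos.ne'
      have : (n:ℝ) ≠ 0 := by exact_mod_cast h
      positivity
    rw [intervalIntegral.integral_comp_mul_left (fun x => Real.cos x) hn, integral_cos]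
    have : 2 * Real.pi * (n:ℝ) * 1 = n * (2 * Real.pi) := by ring
    rw [this]
    have h2 : Real.sin (n * (2 * Real.pi)) = 0 := by
      simpa using Real.sin_add_int_mul_two_pi 0 n
    simp [h2]

theorem int_sin (n : ℤ) : ∫ t in (0:ℝ)..1, Real.sin (2 * Real.pi * n * t) = 0 := by
  by_cases h : n = 0
  · simp [h]
  · have hn : (2 * Real.pi * n : ℝ) ≠ 0 := by
      have := Real.pi_pos.ne'
      have : (n:ℝ) ≠ 0 := by exact_mod_cast h
      positivity
    rw [intervalIntegral.integral_comp_mul_left (fun x => Real.sin x) hn, integral_sin]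
    have : 2 * Real.pi * (n:ℝ) * 1 = n * (2 * Real.pi) := by ring
    rw [this]
    simp

theorem ee_inner (hb : IsHilbertBasis b) (hJ : IsJ b J) (p q : ℤ × (ℕ × Bool)) (t : ℝ) :
    ⟪ee b J p t, ee b J q t⟫ = Real.cos (2 * Real.pi * ((p.1 - q.1 : ℤ) : ℝ) * t) * ⟪b p.2, b q.2⟫
      - Real.sin (2 * Real.pi * ((p.1 - q.1 : ℤ) : ℝ) * t) * ⟪b p.2, J (b q.2)⟫ := by
  have e : 2 * Real.pi * ((p.1 - q.1 : ℤ) : ℝ) * t = 2 * Real.pi * p.1 * t - 2 * Real.pi * q.1 * t := by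
    push_cast; ring
  rw [e, Real.cos_sub, Real.sin_sub]
  simp only [ee, inner_add_left, inner_add_right, inner_smul_left, inner_smul_right]
  rw [J_inner hb hJ, J_skew hb hJ (b p.2) (b q.2)]
  simp
  ring

theorem ee_norm (hb : IsHilbertBasis b) (hJ : IsJ b J) (p : ℤ × (ℕ × Bool)) (t : ℝ) :
    ‖ee b J p t‖ = 1 := by
  have := ee_inner hb hJ p p t
  rw [real_inner_self_eq_norm_sq] at this
  simp only [sub_self, Int.cast_zero, mul_zero, zero_mul, Real.cos_zero, Real.sin_zero, sub_zero,
    one_mul, real_inner_self_eq_norm_sq, hb.1.1] at this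
  exact (sq_eq_sq₀ (norm_nonneg _) zero_le_one).1 (by simpa using this)

theorem ee_orth (hb : IsHilbertBasis b) (hJ : IsJ b J) (p q : ℤ × (ℕ × Bool)) :
    ∫ t in (0:ℝ)..1, ⟪ee b J p t, ee b J q t⟫ = if p = q then 1 else 0 := by
  simp only [ee_inner hb hJ]
  rw [intervalIntegral.integral_sub, intervalIntegral.integral_mul_const,
    intervalIntegral.integral_mul_const, int_cos, int_sin, orthonormal_iff_ite.1 hb.1]
  · obtain ⟨k, i⟩ := p
    obtain ⟨l, j⟩ := q
    simp only [Prod.mk.injEq, sub_eq_zero]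
    split_ifs <;> simp_all
  · apply Continuous.intervalIntegrable; fun_prop
  · apply Continuous.intervalIntegrable; fun_prop

theorem xx_cont (c : EuclideanSpace ℝ S) : Continuous (xx b J c) := by
  unfold xx
  exact continuous_finsetSum _ fun i _ => (ee_cont _).const_smul _

theorem xx_cont2 : Continuous (fun p : EuclideanSpace ℝ S × ℝ => xx b J p.1 p.2) := by
  unfold xx
  refine continuous_finsetSum _ fun i _ => Continuous.smul ?_ ((ee_cont _).comp continuous_snd)
  fun_prop

theorem xx_add (c d : EuclideanSpace ℝ S) (t : ℝ) : xx b J (c + d) t = xx b J c t + xx b J d t := by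
  simp [xx, add_smul, Finset.sum_add_distrib]

theorem xx_sub (c d : EuclideanSpace ℝ S) (t : ℝ) : xx b J (c - d) t = xx b J c t - xx b J d t := by
  simp [xx, sub_smul, Finset.sum_sub_distrib]

theorem xx_periodic (c : EuclideanSpace ℝ S) (t : ℝ) : xx b J c (t + 1) = xx b J c t := by
  simp [xx, ee_periodic]

theorem xx_deriv (hb : IsHilbertBasis b) (hJ : IsJ b J) (c : EuclideanSpace ℝ S) (t : ℝ) :
    HasDerivAt (xx b J c) (J (xx b J (LL c) t)) t := by
  have : HasDerivAt (xx b J c) (∑ i : S, c i • ((2 * Real.pi * i.1.1) • J (ee b J i t))) t := by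
    unfold xx
    exact HasDerivAt.fun_sum fun i _ => (ee_deriv hb hJ _ t).const_smul _
  convert this using 1
  simp only [xx, map_sum, map_smul, LL]
  refine Finset.sum_congr rfl fun i _ => ?_
  rw [smul_smul, mul_comm]

theorem co_inner (g : ℝ → Z) (hg : Continuous g) (d : EuclideanSpace ℝ S) :
    ⟪co b J S g, d⟫ = ∫ t in (0:ℝ)..1, ⟪g t, xx b J d t⟫ := by
  simp only [xx, inner_sum, inner_smul_right]
  rw [intervalIntegral.integral_finsetSum]
  · rw [PiLp.inner_apply]
    refine Finset.sum_congr rfl fun i _ => ?_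
    rw [intervalIntegral.integral_const_mul]
    simp [co]
  · intro i _
    apply Continuous.intervalIntegrable
    exact continuous_const.mul (hg.inner (ee_cont _))

theorem co_xx (hb : IsHilbertBasis b) (hJ : IsJ b J) (c : EuclideanSpace ℝ S) :
    co b J S (xx b J c) = c := by
  ext i
  simp only [co]
  have : ∀ t, ⟪xx b J c t, ee b J i t⟫ = ∑ k : S, c k * ⟪ee b J k t, ee b J i t⟫ := by
    intro t; simp [xx, sum_inner, inner_smul_left]
  simp only [this]
  rw [intervalIntegral.integral_finsetSum]
  · simp only [intervalIntegral.integral_const_mul, ee_orth hb hJ]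
    rw [Finset.sum_eq_single i]
    · simp
    · intro k _ hk
      rw [if_neg (fun h => hk (Subtype.ext h))]; simp
    · simp
  · intro k _
    apply Continuous.intervalIntegrable
    exact continuous_const.mul ((ee_cont _).inner (ee_cont _))

theorem xx_inner_int (hb : IsHilbertBasis b) (hJ : IsJ b J) (c d : EuclideanSpace ℝ S) :
    ∫ t in (0:ℝ)..1, ⟪xx b J c t, xx b J d t⟫ = ⟪c, d⟫ := by
  rw [← co_inner _ (xx_cont c), co_xx hb hJ]

theorem xx_sq_int (hb : IsHilbertBasis b) (hJ : IsJ b J) (c : EuclideanSpace ℝ S) :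
    ∫ t in (0:ℝ)..1, ‖xx b J c t‖ ^ 2 = ‖c‖ ^ 2 := by
  rw [← real_inner_self_eq_norm_sq, ← xx_inner_int hb hJ]
  simp only [real_inner_self_eq_norm_sq]

theorem co_norm (hb : IsHilbertBasis b) (hJ : IsJ b J) (g : ℝ → Z) (hg : Continuous g) :
    ‖co b J S g‖ ^ 2 ≤ ∫ t in (0:ℝ)..1, ‖g t‖ ^ 2 := by
  have h1 := co_inner (b := b) (J := J) g hg (co b J S g)
  rw [real_inner_self_eq_norm_sq] at h1
  have hc := xx_cont (b := b) (J := J) (co b J S g)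
  have h2 : ∫ t in (0:ℝ)..1, ⟪g t, xx b J (co b J S g) t⟫ ≤
      ∫ t in (0:ℝ)..1, (‖g t‖ ^ 2 / 2 + ‖xx b J (co b J S g) t‖ ^ 2 / 2) := by
    apply intervalIntegral.integral_mono_on zero_le_one
    · exact (hg.inner hc).intervalIntegrable _ _
    · apply Continuous.intervalIntegrable; fun_prop
    · intro t _
      have := real_inner_le_norm (g t) (xx b J (co b J S g) t)
      nlinarith [sq_nonneg (‖g t‖ - ‖xx b J (co b J S g) t‖)]
  rw [intervalIntegral.integral_add, intervalIntegral.integral_div, intervalIntegral.integral_div,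
    xx_sq_int hb hJ] at h2
  · linarith
  · apply Continuous.intervalIntegrable; fun_prop
  · apply Continuous.intervalIntegrable; fun_prop

theorem co_norm_le (hb : IsHilbertBasis b) (hJ : IsJ b J) (g : ℝ → Z) (hg : Continuous g) (M : ℝ)
    (hM : ∀ t, ‖g t‖ ≤ M) : ‖co b J S g‖ ≤ M := by
  have hM0 : 0 ≤ M := (norm_nonneg _).trans (hM 0)
  have h1 := co_norm (S := S) hb hJ g hg
  have h2 : ∫ t in (0:ℝ)..1, ‖g t‖ ^ 2 ≤ ∫ t in (0:ℝ)..1, M ^ 2 := by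
    apply intervalIntegral.integral_mono_on zero_le_one
    · apply Continuous.intervalIntegrable; fun_prop
    · apply Continuous.intervalIntegrable; fun_prop
    · intro t _
      have := hM t
      gcongr
  simp at h2
  exact abs_le_of_sq_le_sq' (h1.trans h2) hM0 |>.2

theorem co_add (g h : ℝ → Z) (hg : Continuous g) (hh : Continuous h) :
    co b J S (fun t => g t + h t) = co b J S g + co b J S h := by
  ext i
  simp only [co, PiLp.add_apply, inner_add_left]
  rw [intervalIntegral.integral_add]
  · exact (hg.inner (ee_cont _)).intervalIntegrable _ _
  · exact (hh.inner (ee_cont _)).intervalIntegrable _ _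

theorem PP_ee (hb : IsHilbertBasis b) (hJ : IsJ b J) (R : Finset ℕ) (p : ℤ × (ℕ × Bool)) (t : ℝ) :
    PP b R (ee b J p t) = if p.2.1 ∈ R then ee b J p t else 0 := by
  have h1 : PP b R (b p.2) = if p.2.1 ∈ R then b p.2 else 0 := by
    rw [PP_apply]
    simp only [orthonormal_iff_ite.1 hb.1, ite_smul, one_smul, zero_smul]
    simp
  simp only [ee, map_add, map_smul, PP_J hb hJ, h1]
  split_ifs <;> simp

theorem PP_xx (hb : IsHilbertBasis b) (hJ : IsJ b J) (R : Finset ℕ) (c : EuclideanSpace ℝ S) (t : ℝ) :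
    PP b R (xx b J c t) = xx b J (rs (fun p => p.2.1 ∈ R) c) t := by
  simp only [xx, map_sum, map_smul, PP_ee hb hJ, rs]
  refine Finset.sum_congr rfl fun i _ => ?_
  split_ifs <;> simp

theorem norm_int_le_half (c : EuclideanSpace ℝ S) (hb : IsHilbertBasis b) (hJ : IsJ b J) :
    ∫ t in (0:ℝ)..1, ‖xx b J c t‖ ≤ ‖c‖ := by
  have hc := xx_cont (b := b) (J := J) c
  by_contra h
  push Not at h
  have hm : 0 < ∫ t in (0:ℝ)..1, ‖xx b J c t‖ := (norm_nonneg _).trans_lt h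
  set m := ∫ t in (0:ℝ)..1, ‖xx b J c t‖ with hmd
  have h2 : ∫ t in (0:ℝ)..1, (2 * m * ‖xx b J c t‖ - m ^ 2) ≤ ∫ t in (0:ℝ)..1, ‖xx b J c t‖ ^ 2 := by
    apply intervalIntegral.integral_mono_on zero_le_one
    · apply Continuous.intervalIntegrable; fun_prop
    · apply Continuous.intervalIntegrable; fun_prop
    · intro t _
      nlinarith [sq_nonneg (‖xx b J c t‖ - m)]
  rw [intervalIntegral.integral_sub, intervalIntegral.integral_const_mul, xx_sq_int hb hJ, ← hmd] at h2
  · simp at h2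
    nlinarith [norm_nonneg c]
  · apply Continuous.intervalIntegrable; fun_prop
  · apply Continuous.intervalIntegrable; fun_prop

theorem xx_osc (hb : IsHilbertBasis b) (hJ : IsJ b J) (c : EuclideanSpace ℝ S) (l : ℝ) (hl : 0 < l)
    (s t : ℝ) (hst : s ≤ t) (hts : t ≤ s + 1) :
    ‖xx b J c t - xx b J c s‖ ≤ l / 2 * (t - s) + ‖LL c‖ ^ 2 / (2 * l) := by
  have hc := xx_cont (b := b) (J := J) (LL c)
  have h1 : ∫ τ in s..t, J (xx b J (LL c) τ) = xx b J c t - xx b J c s := by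
    apply intervalIntegral.integral_eq_sub_of_hasDerivAt (fun τ _ => xx_deriv hb hJ c τ)
    exact (J.continuous.comp hc).intervalIntegrable _ _
  rw [← h1]
  refine (intervalIntegral.norm_integral_le_integral_norm hst).trans ?_
  have h2 : ∫ τ in s..t, ‖J (xx b J (LL c) τ)‖ ≤ ∫ τ in s..t, (l / 2 + ‖xx b J (LL c) τ‖ ^ 2 / (2 * l)) := by
    apply intervalIntegral.integral_mono_on hst
    · apply Continuous.intervalIntegrable; fun_prop
    · apply Continuous.intervalIntegrable; fun_prop
    · intro τ _
      rw [J_norm hb hJ]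
      rw [← sub_nonneg]
      have : l / 2 + ‖xx b J (LL c) τ‖ ^ 2 / (2 * l) - ‖xx b J (LL c) τ‖ =
        (l - ‖xx b J (LL c) τ‖) ^ 2 / (2 * l) := by field_simp; ring
      rw [this]; positivity
  refine h2.trans ?_
  rw [intervalIntegral.integral_add, intervalIntegral.integral_div (2 * l)]
  · have h3 : ∫ τ in s..t, ‖xx b J (LL c) τ‖ ^ 2 ≤ ∫ τ in s..(s+1), ‖xx b J (LL c) τ‖ ^ 2 := by
      apply intervalIntegral.integral_mono_interval le_rfl hst hts
      · exact Filter.Eventually.of_forall fun τ => by positivity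
      · apply Continuous.intervalIntegrable; fun_prop
    have h4 : ∫ τ in s..(s+1), ‖xx b J (LL c) τ‖ ^ 2 = ‖LL c‖ ^ 2 := by
      rw [← xx_sq_int hb hJ]
      have hp : Function.Periodic (fun τ => ‖xx b J (LL c) τ‖ ^ 2) 1 := by
        intro τ; simp [xx_periodic]
      have := hp.intervalIntegral_add_eq s 0
      simpa using this
    rw [h4] at h3
    have : ∫ τ in s..t, l / 2 = l / 2 * (t - s) := by simp; ring
    rw [this]
    gcongr
  · apply Continuous.intervalIntegrable; fun_prop
  · apply Continuous.intervalIntegrable; fun_prop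

theorem xx_sup (hb : IsHilbertBasis b) (hJ : IsJ b J) (c : EuclideanSpace ℝ S) (t : ℝ) :
    ‖xx b J c t‖ ≤ ‖c‖ + ‖LL c‖ := by
  have hc := xx_cont (b := b) (J := J) c
  have h0 : ∀ s t, s ≤ t → t ≤ s + 1 → ‖xx b J c t - xx b J c s‖ ≤ ‖LL c‖ := by
    intro s t hst hts
    apply le_of_forall_pos_le_add
    intro ε hε
    have h1 := xx_osc hb hJ c (‖LL c‖ + ε) (by positivity) s t hst hts
    refine h1.trans ?_
    have h2 : ‖LL c‖ ^ 2 / (2 * (‖LL c‖ + ε)) ≤ ‖LL c‖ / 2 := by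
      rw [div_le_div_iff₀ (by positivity) (by norm_num)]
      nlinarith [norm_nonneg (LL c)]
    nlinarith [norm_nonneg (LL c)]
  have h3 : ∀ s ∈ Set.Icc (t - 1) t, ‖xx b J c t‖ ≤ ‖LL c‖ + ‖xx b J c s‖ := by
    intro s hs
    have := h0 s t hs.2 (by linarith [hs.1])
    have := norm_sub_norm_le (xx b J c t) (xx b J c s)
    linarith
  have h4 : ∫ s in (t-1)..t, ‖xx b J c t‖ ≤ ∫ s in (t-1)..t, (‖LL c‖ + ‖xx b J c s‖) := by
    apply intervalIntegral.integral_mono_on (by linarith)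
    · apply Continuous.intervalIntegrable; fun_prop
    · apply Continuous.intervalIntegrable; fun_prop
    · exact h3
  rw [intervalIntegral.integral_add] at h4
  · have hp : Function.Periodic (fun τ => ‖xx b J c τ‖) 1 := by
      intro τ; simp [xx_periodic]
    have h5 := hp.intervalIntegral_add_eq (t - 1) 0
    rw [sub_add_cancel, zero_add] at h5
    rw [h5] at h4
    have := norm_int_le_half c hb hJ
    simp at h4
    linarith
  · apply Continuous.intervalIntegrable; fun_prop
  · apply Continuous.intervalIntegrable; fun_prop

theorem rs_apply (P : ℤ × (ℕ × Bool) → Prop) [DecidablePred P] (c : EuclideanSpace ℝ S) (i : S) :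
    rs P c i = if P i then c i else 0 := rfl

theorem LL_apply (c : EuclideanSpace ℝ S) (i : S) :
    LL c i = 2 * Real.pi * (i.1.1 : ℝ) * c i := rfl

theorem rs_norm_le (P : ℤ × (ℕ × Bool) → Prop) [DecidablePred P] (c : EuclideanSpace ℝ S) :
    ‖rs P c‖ ≤ ‖c‖ := by
  rw [EuclideanSpace.norm_eq, EuclideanSpace.norm_eq]
  apply Real.sqrt_le_sqrt
  refine Finset.sum_le_sum fun i _ => ?_
  rw [rs_apply]
  split_ifs <;> simp
  positivity

theorem LL_rs (P : ℤ × (ℕ × Bool) → Prop) [DecidablePred P] (c : EuclideanSpace ℝ S) :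
    LL (rs P c) = rs P (LL c) := by
  ext i
  simp only [rs_apply, LL_apply]
  split_ifs <;> simp

theorem nsq (c : EuclideanSpace ℝ S) : ‖c‖ ^ 2 = ∑ i : S, c i ^ 2 := by
  rw [EuclideanSpace.norm_sq_eq]; simp

theorem co_PP (hb : IsHilbertBasis b) (hJ : IsJ b J) (R : Finset ℕ) (g : ℝ → Z) :
    co b J S (fun t => PP b R (g t)) = rs (fun p => p.2.1 ∈ R) (co b J S g) := by
  ext i
  rw [rs_apply]
  simp only [co, PP_selfadj, PP_ee hb hJ]
  split_ifs <;> simp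

end loops

end

section

/-- Hypotheses on the Hamiltonian used in the existence theorem for periodic orbits. -/
structure HamOK (b : ℕ × Bool → Z) (j₀ : ℕ) (H : Z → ℝ) (G : Z → Z) (al : Z → ℝ) (y0 : Z)
    (a ν ρ C C0 C1 C2 η : ℝ) (ε : ℕ → ℝ) : Prop where
  grad : ∀ y, HasGradientAt H (G y) y
  Gc : Continuous G
  nonneg : ∀ y, 0 ≤ H y
  hρ : 0 < ρ
  zero : ∀ y, ‖y - y0‖ < ρ → H y = 0
  hC : 0 ≤ C
  quad : ∀ y, H y ≤ C * ‖y - y0‖ ^ 2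
  ha1 : Real.pi < a
  ha2 : a < 2 * Real.pi
  hν1 : 0 < ν
  hν2 : a * ν < Real.pi
  low : ∀ y, a * (‖PP b {j₀} y‖ ^ 2 + ν * ‖y - PP b {j₀} y‖ ^ 2) - C0 ≤ H y
  asym : ∀ y, ‖G y - (2 * a) • (PP b {j₀} y + ν • (y - PP b {j₀} y))‖ ≤ C1
  alc : Continuous al
  al0 : ∀ y, 0 ≤ al y
  al1 : ∀ y, al y ≤ 2 * Real.pi - η
  hη : 0 < η
  tail : ∀ m, j₀ < m → ∀ y, ‖(G y - PP b (Finset.range m) (G y))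
    - al y • (y - PP b (Finset.range m) y)‖ ≤ ε m
  hC2 : 0 ≤ C2
  Gal : ∀ y, ‖G y‖ ≤ C2 * al y * (1 + ‖y‖)

/-- Action functional on trigonometric loops. -/
def AA (b : ℕ × Bool → Z) (J : Z →L[ℝ] Z) (H : Z → ℝ) {S : Finset (ℤ × (ℕ × Bool))}
    (c : EuclideanSpace ℝ S) : ℝ := 1 / 2 * ⟪LL c, c⟫ - ∫ t in (0:ℝ)..1, H (xx b J c t)

/-- Gradient of the action. -/
def VV (b : ℕ × Bool → Z) (J : Z →L[ℝ] Z) (G : Z → Z) {S : Finset (ℤ × (ℕ × Bool))}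
    (c : EuclideanSpace ℝ S) : EuclideanSpace ℝ S := LL c - co b J S (fun t => G (xx b J c t))

section gal
variable {b : ℕ × Bool → Z} {J : Z →L[ℝ] Z} {S : Finset (ℤ × (ℕ × Bool))}

theorem LL_cont : Continuous (LL : EuclideanSpace ℝ S → EuclideanSpace ℝ S) := by
  refine (PiLp.continuous_toLp 2 _).comp (continuous_pi fun i => ?_)
  fun_prop

theorem LL_add (c d : EuclideanSpace ℝ S) : LL (c + d) = LL c + LL d := by
  ext i; simp [LL_apply]; ring

theorem LL_inner (c d : EuclideanSpace ℝ S) :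
    ⟪LL c, d⟫ = ∑ i : S, 2 * Real.pi * (i.1.1 : ℝ) * (c i * d i) := by
  rw [PiLp.inner_apply]
  refine Finset.sum_congr rfl fun i _ => ?_
  rw [LL_apply]; simp; ring

theorem LL_symm (c d : EuclideanSpace ℝ S) : ⟪LL c, d⟫ = ⟪LL d, c⟫ := by
  rw [LL_inner, LL_inner]
  refine Finset.sum_congr rfl fun i _ => ?_
  ring

theorem norm_le_coord (u v : EuclideanSpace ℝ S) (K : ℝ) (hK : 0 ≤ K)
    (h : ∀ i, |u i| ≤ K * |v i|) : ‖u‖ ≤ K * ‖v‖ := by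
  apply abs_le_of_sq_le_sq' _ (by positivity) |>.2
  rw [mul_pow, nsq, nsq, Finset.mul_sum]
  refine Finset.sum_le_sum fun i _ => ?_
  rw [← sq_abs (u i), ← sq_abs (v i), ← mul_pow]
  have := h i
  gcongr

theorem xx_crude (hb : IsHilbertBasis b) (hJ : IsJ b J) (c : EuclideanSpace ℝ S) (t : ℝ) :
    ‖xx b J c t‖ ≤ S.card * ‖c‖ := by
  unfold xx
  refine (norm_sum_le _ _).trans ?_
  calc ∑ i : S, ‖c i • ee b J i t‖ ≤ ∑ i : S, ‖c‖ := by
        refine Finset.sum_le_sum fun i _ => ?_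
        rw [norm_smul, ee_norm hb hJ, mul_one]
        exact PiLp.norm_apply_le c i
    _ = _ := by simp

theorem AA_cont (H : Z → ℝ) (hH : Continuous H) :
    Continuous (AA b J H : EuclideanSpace ℝ S → ℝ) := by
  unfold AA
  refine Continuous.sub ?_ ?_
  · exact continuous_const.mul (LL_cont.inner continuous_id)
  · exact intervalIntegral.continuous_parametric_intervalIntegral_of_continuous'
      (f := fun (c : EuclideanSpace ℝ S) t => H (xx b J c t)) (hH.comp xx_cont2) 0 1

theorem VV_cont (G : Z → Z) (hG : Continuous G) :
    Continuous (VV b J G : EuclideanSpace ℝ S → EuclideanSpace ℝ S) := by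
  unfold VV
  refine LL_cont.sub ?_
  refine (PiLp.continuous_toLp 2 _).comp (continuous_pi fun i => ?_)
  exact intervalIntegral.continuous_parametric_intervalIntegral_of_continuous'
      (f := fun (c : EuclideanSpace ℝ S) t => ⟪G (xx b J c t), ee b J i t⟫) ((hG.comp xx_cont2).inner ((ee_cont _).comp continuous_snd)) 0 1

theorem AA_exp (hb : IsHilbertBasis b) (hJ : IsJ b J) (H : Z → ℝ) (G : Z → Z)
    (hH : ∀ y, HasGradientAt H (G y) y) (hG : Continuous G) (ρ ε : ℝ) (hε : 0 < ε) :
    ∃ s : ℝ, 0 < s ∧ ∀ c v : EuclideanSpace ℝ S, ‖c‖ ≤ ρ → ‖v‖ ≤ s →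
      AA b J H (c + v) ≤ AA b J H c + ⟪VV b J G c, v⟫ + ε * ‖v‖ := by
  have hHc : Continuous H := continuous_iff_continuousAt.2 fun y => (hH y).continuousAt
  have hK : IsCompact ((fun p : EuclideanSpace ℝ S × ℝ => xx b J p.1 p.2) ''
      (closedBall 0 ρ ×ˢ Set.Icc 0 1)) :=
    ((isCompact_closedBall _ _).prod isCompact_Icc).image xx_cont2
  obtain ⟨δ, hδ, hu⟩ := udiff H (fun y => InnerProductSpace.toDual ℝ Z (G y))
    (fun y => (hH y).hasFDerivAt) ((InnerProductSpace.toDual ℝ Z).continuous.comp hG) hK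
    (half_pos hε)
  obtain ⟨N, hN0, hN⟩ : ∃ N : ℝ, 0 < N ∧ ∀ v : EuclideanSpace ℝ S, 1 / 2 * ⟪LL v, v⟫ ≤ N * ‖v‖ ^ 2 := by
    refine ⟨∑ i : S, Real.pi * |(i.1.1 : ℝ)| + 1, by positivity, fun v => ?_⟩
    rw [LL_inner, Finset.mul_sum, nsq, add_mul]
    have : ∑ i : S, 1 / 2 * (2 * Real.pi * (i.1.1 : ℝ) * (v i * v i)) ≤
      (∑ i : S, Real.pi * |(i.1.1 : ℝ)|) * ∑ i : S, v i ^ 2 := by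
      rw [Finset.sum_mul]
      refine Finset.sum_le_sum fun i _ => ?_
      have h1 : v i ^ 2 ≤ ∑ i : S, v i ^ 2 :=
        Finset.single_le_sum (f := fun i => v i ^ 2) (fun i _ => sq_nonneg _) (Finset.mem_univ i)
      calc 1 / 2 * (2 * Real.pi * (i.1.1 : ℝ) * (v i * v i)) = Real.pi * (i.1.1 : ℝ) * v i ^ 2 := by ring
        _ ≤ Real.pi * |(i.1.1 : ℝ)| * v i ^ 2 := by
          have := le_abs_self (i.1.1 : ℝ)
          have := Real.pi_pos
          gcongr
        _ ≤ _ := by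
          have := Real.pi_pos
          gcongr
    have h0 : 0 ≤ ∑ i : S, v i ^ 2 := Finset.sum_nonneg fun i _ => sq_nonneg _
    linarith
  refine ⟨min (δ / (S.card + 1)) (ε / (2 * N)), by positivity, fun c v hc hv => ?_⟩
  have hv1 : (S.card + 1) * ‖v‖ ≤ δ := by
    have := hv.trans (min_le_left _ _)
    rw [le_div_iff₀ (by positivity)] at this
    linarith
  have hv2 : N * ‖v‖ ≤ ε / 2 := by
    have := hv.trans (min_le_right _ _)
    rw [le_div_iff₀ (by positivity)] at this
    linarith
  have key : ∀ t ∈ Set.Icc (0:ℝ) 1, H (xx b J c t) + ⟪G (xx b J c t), xx b J v t⟫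
      - ε / 2 * ‖xx b J v t‖ ≤ H (xx b J (c + v) t) := by
    intro t ht
    have h1 := hu (xx b J c t) ⟨(c, t), ⟨by simpa using hc, ht⟩, rfl⟩ (xx b J v t) (by
      have := xx_crude hb hJ v t
      linarith [norm_nonneg v])
    rw [← xx_add] at h1
    have := (abs_le.1 h1).1
    rw [InnerProductSpace.toDual_apply_apply] at this
    linarith
  have cc := xx_cont (b := b) (J := J) c
  have cv := xx_cont (b := b) (J := J) v
  have ccv := xx_cont (b := b) (J := J) (c + v)
  have i1 : IntervalIntegrable (fun t => H (xx b J c t)) MeasureTheory.volume 0 1 :=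
    (hHc.comp cc).intervalIntegrable _ _
  have i2 : IntervalIntegrable (fun t => ⟪G (xx b J c t), xx b J v t⟫) MeasureTheory.volume 0 1 :=
    ((hG.comp cc).inner cv).intervalIntegrable _ _
  have i3 : IntervalIntegrable (fun t => ε / 2 * ‖xx b J v t‖) MeasureTheory.volume 0 1 := by
    apply Continuous.intervalIntegrable; fun_prop
  have hint := intervalIntegral.integral_mono_on zero_le_one ((i1.add i2).sub i3)
    ((hHc.comp ccv).intervalIntegrable _ _) key
  rw [intervalIntegral.integral_sub (i1.add i2) i3, intervalIntegral.integral_add i1 i2,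
    intervalIntegral.integral_const_mul] at hint
  have h4 := norm_int_le_half v hb hJ
  have h5 := co_inner (b := b) (J := J) (fun t => G (xx b J c t)) (hG.comp cc) v
  have h6 := hN v
  have h7 : N * ‖v‖ ^ 2 ≤ ε / 2 * ‖v‖ := by nlinarith [norm_nonneg v]
  have h8 : ε / 2 * ∫ t in (0:ℝ)..1, ‖xx b J v t‖ ≤ ε / 2 * ‖v‖ := by gcongr
  have e1 : ⟪LL (c + v), c + v⟫ = ⟪LL c, c⟫ + 2 * ⟪LL c, v⟫ + ⟪LL v, v⟫ := by
    rw [LL_add, inner_add_left, inner_add_right, inner_add_right, LL_symm v c]; ring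
  unfold AA VV
  rw [e1, inner_sub_left, h5]
  simp only [Function.comp] at hint
  linarith

/-- The Galerkin index set. -/
def SN (N : ℕ) : Finset (ℤ × (ℕ × Bool)) :=
  Finset.Icc (-(N:ℤ)) N ×ˢ (Finset.range N ×ˢ (Finset.univ : Finset Bool))

/-- coefficients of a constant loop. -/
def cst (b : ℕ × Bool → Z) (S : Finset (ℤ × (ℕ × Bool))) (y : Z) : EuclideanSpace ℝ S :=
  WithLp.toLp 2 (fun i => if i.1.1 = 0 then ⟪b i.1.2, y⟫ else 0)

theorem xx_cst (N : ℕ) (y : Z) (t : ℝ) :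
    xx b J (cst b (SN N) y) t = PP b (Finset.range N) y := by
  rw [PP_apply]
  unfold xx cst
  simp only
  rw [Finset.sum_coe_sort (SN N) (fun i => (if i.1 = 0 then ⟪b i.2, y⟫ else 0) • ee b J i t)]
  unfold SN
  rw [Finset.sum_product, Finset.sum_eq_single 0]
  · refine Finset.sum_congr rfl fun i _ => ?_
    simp [ee]
  · intro k _ hk
    refine Finset.sum_eq_zero fun i _ => ?_
    simp [hk]
  · intro h
    exfalso; apply h; simp

set_option maxHeartbeats 2000000 in
theorem galerkin_crit (hb : IsHilbertBasis b) (hJ : IsJ b J) {j₀ : ℕ} {H : Z → ℝ} {G : Z → Z}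
    {al : Z → ℝ} {y0 : Z} {a ν ρ C C0 C1 C2 η : ℝ} {ε : ℕ → ℝ}
    (hH : HamOK b j₀ H G al y0 a ν ρ C C0 C1 C2 η ε) :
    ∃ β > 0, ∃ N0 : ℕ, ∀ N ≥ N0, ∀ δ > 0, ∃ c : EuclideanSpace ℝ (SN N),
      ‖VV b J G c‖ < δ ∧ β / 2 ≤ AA b J H c := by
  have hπ := Real.pi_pos
  obtain ⟨K, hK⟩ := exists_nat_ge (4 * C / Real.pi)
  rw [div_le_iff₀ hπ] at hK
  set α : ℝ := ρ / (4 * (1 + 2 * Real.pi * K)) with hα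
  have hρ := hH.hρ
  have hα0 : 0 < α := by rw [hα]; positivity
  have hα1 : (1 + 2 * Real.pi * K) * α = ρ / 4 := by rw [hα]; field_simp
  have hHc : Continuous H := continuous_iff_continuousAt.2 fun y => (hH.grad y).continuousAt
  have hGc := hH.Gc
  obtain ⟨N1, hN1⟩ := (Metric.tendsto_atTop.1 (PP_range_tendsto hb y0)) (ρ / 4) (by positivity)
  refine ⟨Real.pi * α ^ 2, by positivity, max N1 (j₀ + 1), fun N hN δ hδ => ?_⟩
  have hNy : ‖PP b (Finset.range N) y0 - y0‖ < ρ / 4 := by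
    rw [← dist_eq_norm]; exact hN1 N ((le_max_left _ _).trans hN)
  have hNj : j₀ + 1 ≤ N := (le_max_right _ _).trans hN
  have hmem : ((1, (j₀, true)) : ℤ × (ℕ × Bool)) ∈ SN N := by
    simp [SN]; omega
  have ha := hH.ha1
  have hν := hH.hν1
  have hν1 : ν ≤ 1 := by
    by_contra h
    push Not at h
    have := hH.hν2
    nlinarith
  set μ := min (a - Real.pi) (a * ν) with hμ
  have hμ0 : 0 < μ := lt_min (by linarith) (mul_pos (by linarith) hν)
  have hsec : ∀ c : EuclideanSpace ℝ (SN N),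
      (∀ i : SN N, 1 ≤ i.1.1 → i ≠ ⟨_, hmem⟩ → c i = 0) → AA b J H c ≤ -μ * ‖c‖ ^ 2 + |C0| := by
    intro c hc
    have cc := xx_cont (b := b) (J := J) c
    set c1 := rs (fun p => p.2.1 ∈ ({j₀} : Finset ℕ)) c with hc1
    have e1 : ∀ t, PP b {j₀} (xx b J c t) = xx b J c1 t := fun t => PP_xx hb hJ _ c t
    have cc1 := xx_cont (b := b) (J := J) c1
    have cc2 := xx_cont (b := b) (J := J) (c - c1)
    have h1 : ∫ t in (0:ℝ)..1, (a * (‖xx b J c1 t‖ ^ 2 + ν * ‖xx b J (c - c1) t‖ ^ 2) - C0) ≤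
        ∫ t in (0:ℝ)..1, H (xx b J c t) := by
      apply intervalIntegral.integral_mono_on zero_le_one
      · apply Continuous.intervalIntegrable; fun_prop
      · exact (hHc.comp cc).intervalIntegrable _ _
      · intro t _
        have := hH.low (xx b J c t)
        rw [e1, ← xx_sub] at this
        exact this
    rw [intervalIntegral.integral_sub, intervalIntegral.integral_const_mul,
      intervalIntegral.integral_add, intervalIntegral.integral_const_mul,
      xx_sq_int hb hJ, xx_sq_int hb hJ] at h1
    rotate_left
    · apply Continuous.intervalIntegrable; fun_prop
    · apply Continuous.intervalIntegrable; fun_prop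
    · apply Continuous.intervalIntegrable; fun_prop
    · apply Continuous.intervalIntegrable; fun_prop
    have h2 : 1 / 2 * ⟪LL c, c⟫ - a * (‖c1‖ ^ 2 + ν * ‖c - c1‖ ^ 2) ≤ -μ * ‖c‖ ^ 2 := by
      rw [LL_inner, nsq, nsq, nsq, Finset.mul_sum, Finset.mul_sum, Finset.mul_sum, 
        ← Finset.sum_add_distrib, Finset.mul_sum, ← Finset.sum_sub_distrib]
      refine Finset.sum_le_sum fun i _ => ?_
      have hm1 : μ ≤ a - Real.pi := min_le_left _ _
      have hm2 : μ ≤ a * ν := min_le_right _ _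
      by_cases hi : 1 ≤ i.1.1
      · by_cases hi1 : i = ⟨_, hmem⟩
        · rw [hi1]
          simp only [hc1, PiLp.sub_apply, rs_apply]
          simp
          nlinarith [sq_nonneg (c ⟨_, hmem⟩)]
        · have := hc i hi hi1
          simp [hc1, rs_apply, this]
      · have hi' : (i.1.1 : ℝ) ≤ 0 := by
          have : i.1.1 ≤ 0 := by omega
          exact_mod_cast this
        have hq : Real.pi * (i.1.1 : ℝ) * c i ^ 2 ≤ 0 := by
          have : 0 ≤ Real.pi * c i ^ 2 := by positivity
          nlinarith
        have hsq := sq_nonneg (c i)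
        have hmq : μ * c i ^ 2 ≤ a * ν * c i ^ 2 := by gcongr
        have haν : a * ν * c i ^ 2 ≤ a * c i ^ 2 := by
          have : 0 ≤ a * c i ^ 2 := mul_nonneg (by linarith) hsq
          nlinarith
        simp only [hc1, PiLp.sub_apply, rs_apply]
        split_ifs
        · simp; nlinarith
        · simp; nlinarith
    have := le_abs_self C0
    unfold AA
    simp at h1
    linarith
  refine minmax (fun i : SN N => 1 ≤ i.1.1) ⟨_, hmem⟩ (by simp) (AA b J H) (AA_cont H hHc)
    (VV b J G) (VV_cont G hGc) (fun ρ ε hε => AA_exp hb hJ H G hH.grad hGc ρ ε hε)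
    (cst b (SN N) y0) α (Real.pi * α ^ 2) (Real.sqrt (|C0| / μ)) |C0| hα0 (by positivity)
    ?_ ?_ ?_ ?_ δ hδ
  · intro c hc hsum
    set u := rs (fun p => 1 ≤ p.1 ∧ p.1 ≤ (K:ℤ)) c with hu
    set v := rs (fun p => 1 ≤ p.1 ∧ ¬ p.1 ≤ (K:ℤ)) c with hv
    have ec : c = cst b (SN N) y0 + u + v := by
      ext i
      simp only [PiLp.add_apply, hu, hv, rs_apply]
      by_cases h1 : 1 ≤ i.1.1
      · have h0 : i.1.1 ≠ 0 := by omega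
        by_cases h2 : i.1.1 ≤ K <;> simp [h1, h2, cst, h0]
      · simp [h1, hc i h1]
    have hα2 : ‖u‖ ^ 2 + ‖v‖ ^ 2 = α ^ 2 := by
      rw [← hsum, nsq, nsq, ← Finset.sum_add_distrib]
      refine Finset.sum_congr rfl fun i _ => ?_
      simp only [hu, hv, rs_apply]
      by_cases h1 : 1 ≤ i.1.1 <;> by_cases h2 : i.1.1 ≤ K <;> simp [h1, h2]
    have hL : Real.pi * ‖u‖ ^ 2 + Real.pi * (K + 1) * ‖v‖ ^ 2 ≤ 1 / 2 * ⟪LL c, c⟫ := by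
      rw [LL_inner, nsq, nsq, Finset.mul_sum, Finset.mul_sum, Finset.mul_sum, 
        ← Finset.sum_add_distrib]
      refine Finset.sum_le_sum fun i _ => ?_
      simp only [hu, hv, rs_apply]
      have hsq := sq_nonneg (c i)
      by_cases h1 : 1 ≤ i.1.1
      · have h1' : (1:ℝ) ≤ i.1.1 := by exact_mod_cast h1
        by_cases h2 : i.1.1 ≤ K
        · simp [h1, h2]
          have : Real.pi * c i ^ 2 * 1 ≤ Real.pi * c i ^ 2 * i.1.1 := by gcongr
          linarith
        · have h2' : (K:ℝ) + 1 ≤ i.1.1 := by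
            have : (K:ℤ) + 1 ≤ i.1.1 := by omega
            exact_mod_cast this
          simp [h1, h2]
          have : Real.pi * c i ^ 2 * (K + 1) ≤ Real.pi * c i ^ 2 * i.1.1 := by gcongr
          linarith
      · simp [h1]
        rcases (by omega : i.1.1 = 0 ∨ i.1.1 < 0) with h3 | h3
        · simp [h3]
        · have : c i = 0 := by rw [hc i h1]; simp [cst, h3.ne]
          simp [this]
    have hun : ‖u‖ ≤ α := by
      apply abs_le_of_sq_le_sq' _ hα0.le |>.2
      nlinarith [sq_nonneg ‖v‖]
    have hLu : ‖LL u‖ ≤ 2 * Real.pi * K * ‖u‖ := by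
      apply norm_le_coord _ _ _ (by positivity)
      intro i
      rw [LL_apply, hu, rs_apply]
      split_ifs with h1
      · rw [abs_mul, abs_mul, abs_of_pos (by positivity : 0 < 2 * Real.pi)]
        have h3 : |(i.1.1 : ℝ)| ≤ K := by
          rw [abs_of_nonneg (by exact_mod_cast (by omega : 0 ≤ i.1.1))]
          exact_mod_cast h1.2
        gcongr
      · simp
    have hus : ∀ t, ‖xx b J u t‖ ≤ ρ / 4 := by
      intro t
      have := xx_sup hb hJ u t
      rw [← hα1]
      have : 2 * Real.pi * K * ‖u‖ ≤ 2 * Real.pi * K * α := by gcongr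
      linarith
    have cc := xx_cont (b := b) (J := J) c
    have cv := xx_cont (b := b) (J := J) v
    have hHx : ∀ t, H (xx b J c t) ≤ 4 * C * ‖xx b J v t‖ ^ 2 := by
      intro t
      have e2 : xx b J c t - y0 = (PP b (Finset.range N) y0 - y0) + xx b J u t + xx b J v t := by
        conv_lhs => rw [ec]
        rw [xx_add, xx_add, xx_cst]; abel
      have h3 : ‖xx b J c t - y0‖ ≤ ρ / 4 + ρ / 4 + ‖xx b J v t‖ := by
        rw [e2]
        refine (norm_add_le _ _).trans (add_le_add ((norm_add_le _ _).trans
          (add_le_add hNy.le (hus t))) le_rfl)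
      by_cases h4 : ‖xx b J v t‖ < ρ / 2
      · rw [hH.zero _ (by linarith)]
        have := hH.hC; positivity
      · push Not at h4
        refine (hH.quad _).trans ?_
        have := hH.hC
        have h5 : ‖xx b J c t - y0‖ ^ 2 ≤ (2 * ‖xx b J v t‖) ^ 2 := by
          gcongr; linarith
        nlinarith
    have hint : ∫ t in (0:ℝ)..1, H (xx b J c t) ≤ ∫ t in (0:ℝ)..1, 4 * C * ‖xx b J v t‖ ^ 2 := by
      apply intervalIntegral.integral_mono_on zero_le_one
      · exact (hHc.comp cc).intervalIntegrable _ _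
      · apply Continuous.intervalIntegrable; fun_prop
      · intro t _; exact hHx t
    rw [intervalIntegral.integral_const_mul, xx_sq_int hb hJ] at hint
    unfold AA
    nlinarith [sq_nonneg ‖v‖]
  · intro c hc
    have h1 : ⟪LL c, c⟫ ≤ 0 := by
      rw [LL_inner]
      refine Finset.sum_nonpos fun i _ => ?_
      by_cases h1 : 1 ≤ i.1.1
      · simp [hc i h1]
      · have h1' : (i.1.1 : ℝ) ≤ 0 := by exact_mod_cast (by omega : i.1.1 ≤ 0)
        have : 0 ≤ 2 * Real.pi * (c i * c i) := mul_nonneg (by positivity) (mul_self_nonneg _)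
        nlinarith
    have h2 : 0 ≤ ∫ t in (0:ℝ)..1, H (xx b J c t) :=
      intervalIntegral.integral_nonneg zero_le_one fun t _ => hH.nonneg _
    unfold AA
    linarith
  · intro c hc
    have := hsec c hc
    nlinarith [sq_nonneg ‖c‖]
  · intro c hc hτ
    have h1 := hsec c hc
    have h2 : |C0| / μ ≤ ‖c‖ ^ 2 := by
      rw [← Real.sq_sqrt (by positivity : 0 ≤ |C0| / μ)]
      gcongr
    rw [div_le_iff₀ hμ0] at h2
    linarith

end gal

end

section

theorem nonres (x : ℝ) (n : ℤ) (h1 : 2 * Real.pi * n < x) (h2 : x < 2 * Real.pi * (n + 1)) :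
    ∃ e > 0, ∀ k : ℤ, e ≤ |2 * Real.pi * k - x| := by
  have hπ := Real.pi_pos
  refine ⟨min (x - 2 * Real.pi * n) (2 * Real.pi * (n + 1) - x),
    lt_min (by linarith) (by linarith), fun k => ?_⟩
  rcases le_or_gt k n with h | h
  · refine (min_le_left _ _).trans ?_
    have : (k:ℝ) ≤ n := by exact_mod_cast h
    rw [abs_of_nonpos]
    · nlinarith
    · nlinarith
  · refine (min_le_right _ _).trans ?_
    have : (n:ℝ) + 1 ≤ k := by exact_mod_cast h
    refine le_trans ?_ (le_abs_self _)
    nlinarith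

section gal
variable {b : ℕ × Bool → Z} {J : Z →L[ℝ] Z}

theorem xx_smul {S : Finset (ℤ × (ℕ × Bool))} (r : ℝ) (c : EuclideanSpace ℝ S) (t : ℝ) :
    xx b J (r • c) t = r • xx b J c t := by
  simp [xx, Finset.smul_sum, mul_smul]

theorem apriori1 (hb : IsHilbertBasis b) (hJ : IsJ b J) {j₀ : ℕ} {H : Z → ℝ} {G : Z → Z}
    {al : Z → ℝ} {y0 : Z} {a ν ρ C C0 C1 C2 η : ℝ} {ε : ℕ → ℝ}
    (hH : HamOK b j₀ H G al y0 a ν ρ C C0 C1 C2 η ε) :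
    ∃ M > 0, ∀ (S : Finset (ℤ × (ℕ × Bool))) (c : EuclideanSpace ℝ S), ‖VV b J G c‖ ≤ 1 →
      ‖c‖ ≤ M ∧ ‖LL c‖ ≤ M := by
  have hπ := Real.pi_pos
  have ha := hH.ha1
  have hν := hH.hν1
  have haν : 0 < a * ν := mul_pos (by linarith) hν
  obtain ⟨e1, he1, hk1⟩ := nonres (2 * a) 1 (by push_cast; linarith) (by push_cast; linarith [hH.ha2])
  obtain ⟨e2, he2, hk2⟩ := nonres (2 * a * ν) 0 (by push_cast; linarith)
    (by push_cast; linarith [hH.hν2])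
  set e0 := min e1 e2 with he0
  have he0p : 0 < e0 := lt_min he1 he2
  have hC1 : 0 ≤ C1 := (norm_nonneg _).trans (hH.asym 0)
  set M1 := (1 + C1) / e0 with hM1
  have hM1p : 0 < M1 := by positivity
  refine ⟨M1 + (1 + C1) + 2 * a * (1 + ν) * M1, by
    have : 0 < a := by linarith
    positivity, fun S c hc => ?_⟩
  have cc := xx_cont (b := b) (J := J) c
  have hGc := hH.Gc
  set c1 := rs (fun p => p.2.1 ∈ ({j₀} : Finset ℕ)) c with hc1
  set dd := (2 * a) • (c1 + ν • (c - c1)) with hdd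
  have ex : ∀ t, (2 * a) • (PP b {j₀} (xx b J c t) + ν • (xx b J c t - PP b {j₀} (xx b J c t)))
      = xx b J dd t := by
    intro t
    rw [PP_xx hb hJ, hdd, xx_smul, xx_add, xx_smul, xx_sub]
  have hcd := xx_cont (b := b) (J := J) dd
  have hgc : Continuous (fun t => G (xx b J c t)) := hGc.comp cc
  have e3 : co b J S (fun t => G (xx b J c t)) =
      co b J S (fun t => G (xx b J c t) - xx b J dd t) + dd := by
    have := co_add (b := b) (J := J) (S := S) (fun t => G (xx b J c t) - xx b J dd t) (xx b J dd)
      (hgc.sub hcd) hcd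
    rw [co_xx hb hJ] at this
    rw [← this]
    congr 1
    ext t; simp
  have e4 : ‖co b J S (fun t => G (xx b J c t) - xx b J dd t)‖ ≤ C1 := by
    apply co_norm_le hb hJ _ (hgc.sub hcd)
    intro t
    show ‖G (xx b J c t) - xx b J dd t‖ ≤ C1
    rw [← ex]
    exact hH.asym _
  have e5 : LL c - dd = VV b J G c + co b J S (fun t => G (xx b J c t) - xx b J dd t) := by
    unfold VV; rw [e3]; abel
  have e6 : ‖LL c - dd‖ ≤ 1 + C1 := by
    rw [e5]; exact (norm_add_le _ _).trans (add_le_add hc e4)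
  have e7 : ‖c‖ ≤ e0⁻¹ * ‖LL c - dd‖ := by
    apply norm_le_coord _ _ _ (by positivity)
    intro i
    rw [inv_mul_eq_div, le_div_iff₀ he0p, mul_comm]
    simp only [PiLp.sub_apply, LL_apply, hdd, PiLp.smul_apply, PiLp.add_apply, hc1, rs_apply,
      smul_eq_mul]
    split_ifs with h
    · have e : 2 * Real.pi * (i.1.1 : ℝ) * c i - 2 * a * (c i + ν * (c i - c i)) =
        (2 * Real.pi * (i.1.1 : ℝ) - 2 * a) * c i := by ring
      rw [e, abs_mul]
      have := hk1 i.1.1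
      gcongr
      exact (min_le_left _ _).trans this
    · have e : 2 * Real.pi * (i.1.1 : ℝ) * c i - 2 * a * (0 + ν * (c i - 0)) =
        (2 * Real.pi * (i.1.1 : ℝ) - 2 * a * ν) * c i := by ring
      rw [e, abs_mul]
      have := hk2 i.1.1
      gcongr
      exact (min_le_right _ _).trans this
  have e8 : ‖c‖ ≤ M1 := by
    refine e7.trans ?_
    rw [hM1, inv_mul_eq_div]
    gcongr
  have e9 : ‖c - c1‖ ≤ ‖c‖ := by
    have := norm_le_coord (c - c1) c 1 zero_le_one (fun i => by
      simp only [PiLp.sub_apply, hc1, rs_apply]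
      split_ifs <;> simp)
    simpa using this
  have e10 : ‖dd‖ ≤ 2 * a * (1 + ν) * M1 := by
    rw [hdd, norm_smul, Real.norm_of_nonneg (by linarith)]
    have h1 := rs_norm_le (fun p => p.2.1 ∈ ({j₀} : Finset ℕ)) c
    have h2 : ‖c1 + ν • (c - c1)‖ ≤ (1 + ν) * M1 := by
      refine (norm_add_le _ _).trans ?_
      rw [norm_smul, Real.norm_of_nonneg hν.le]
      have : ν * ‖c - c1‖ ≤ ν * M1 := by gcongr; linarith
      linarith
    have : 0 < 2 * a := by linarith
    calc _ ≤ 2 * a * ((1 + ν) * M1) := by gcongr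
      _ = _ := by ring
  have e11 : ‖LL c‖ ≤ ‖LL c - dd‖ + ‖dd‖ := by
    simpa using norm_add_le (LL c - dd) dd
  have : 0 ≤ 2 * a * (1 + ν) * M1 := (norm_nonneg _).trans e10
  exact ⟨by linarith, by linarith⟩

set_option maxHeartbeats 2000000 in
theorem apriori2 (hb : IsHilbertBasis b) (hJ : IsJ b J) {j₀ : ℕ} {H : Z → ℝ} {G : Z → Z}
    {al : Z → ℝ} {y0 : Z} {a ν ρ C C0 C1 C2 η : ℝ} {ε : ℕ → ℝ}
    (hH : HamOK b j₀ H G al y0 a ν ρ C C0 C1 C2 η ε) (β : ℝ) (hβ : 0 < β) :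
    ∃ B > 0, ∃ δ0 > 0, ∀ (S : Finset (ℤ × (ℕ × Bool))) (c : EuclideanSpace ℝ S) (δ : ℝ),
      ‖VV b J G c‖ ≤ δ → δ ≤ δ0 → β / 2 ≤ AA b J H c → ∀ m, j₀ < m → ∀ t,
      ‖xx b J c t - PP b (Finset.range m) (xx b J c t)‖ ≤ B * (δ + ε m) := by
  have hπ := Real.pi_pos
  have hη := hH.hη
  obtain ⟨M, hM, hap⟩ := apriori1 hb hJ hH
  set K1 := C2 * (1 + 2 * M) * (2 * M) + 1 with hK1
  have hC2 := hH.hC2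
  have hK1p : 0 < K1 := by positivity
  set η' := β / 2 / K1 with hη'
  have hη'p : 0 < η' := by positivity
  set κ := min η (min (η' / 4) Real.pi) with hκ
  have hκp : 0 < κ := lt_min hη (lt_min (by positivity) hπ)
  have hκ1 : κ ≤ η := min_le_left _ _
  have hκ2 : κ ≤ η' / 4 := (min_le_right _ _).trans (min_le_left _ _)
  have hκ3 : κ ≤ Real.pi := (min_le_right _ _).trans (min_le_right _ _)
  refine ⟨1 / κ + (1 + 2 * Real.pi / κ), by positivity, min 1 (β / (2 * M)), by positivity, ?_⟩
  intro S c δ hV hδ hA m hm t₁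
  have hδ1 : δ ≤ 1 := hδ.trans (min_le_left _ _)
  have hδ2 : δ * M ≤ β / 2 := by
    have := hδ.trans (min_le_right _ _)
    rw [le_div_iff₀ (by positivity)] at this
    linarith
  have hδ0 : 0 ≤ δ := (norm_nonneg _).trans hV
  have hε0 : 0 ≤ ε m := (norm_nonneg _).trans (hH.tail m hm 0)
  obtain ⟨hcM, hLM⟩ := hap S c (hV.trans hδ1)
  have cc := xx_cont (b := b) (J := J) c
  have hGc := hH.Gc
  have halc := hH.alc
  have hgc : Continuous (fun t => G (xx b J c t)) := hGc.comp cc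
  have hac : Continuous (fun t => al (xx b J c t)) := halc.comp cc
  have hsup : ∀ t, ‖xx b J c t‖ ≤ 2 * M := fun t => by
    have := xx_sup hb hJ c t; linarith
  have hla : η' ≤ ∫ t in (0:ℝ)..1, al (xx b J c t) := by
    have h1 : 0 ≤ ∫ t in (0:ℝ)..1, H (xx b J c t) :=
      intervalIntegral.integral_nonneg zero_le_one fun t _ => hH.nonneg _
    have h2 : β ≤ ⟪LL c, c⟫ := by unfold AA at hA; linarith
    have h3 : ⟪LL c, c⟫ = ⟪VV b J G c, c⟫ + ∫ t in (0:ℝ)..1, ⟪G (xx b J c t), xx b J c t⟫ := by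
      rw [← co_inner _ hgc]; unfold VV; rw [inner_sub_left]; ring
    have h4 : ⟪VV b J G c, c⟫ ≤ β / 2 := by
      refine (real_inner_le_norm _ _).trans (le_trans ?_ hδ2)
      gcongr
    have h5 : ∫ t in (0:ℝ)..1, ⟪G (xx b J c t), xx b J c t⟫ ≤ ∫ t in (0:ℝ)..1, K1 * al (xx b J c t) := by
      apply intervalIntegral.integral_mono_on zero_le_one
      · exact (hgc.inner cc).intervalIntegrable _ _
      · exact (continuous_const.mul hac).intervalIntegrable _ _
      · intro t _
        refine (real_inner_le_norm _ _).trans ?_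
        have g1 := hH.Gal (xx b J c t)
        have g2 := hsup t
        have g3 := hH.al0 (xx b J c t)
        calc ‖G (xx b J c t)‖ * ‖xx b J c t‖ ≤ (C2 * al (xx b J c t) * (1 + 2 * M)) * (2 * M) := by
              have : C2 * al (xx b J c t) * (1 + ‖xx b J c t‖) ≤ C2 * al (xx b J c t) * (1 + 2 * M) := by
                gcongr
              have := g1.trans this
              gcongr
          _ ≤ K1 * al (xx b J c t) := by rw [hK1]; nlinarith
    rw [intervalIntegral.integral_const_mul] at h5
    rw [hη', div_le_iff₀ hK1p]
    linarith
  set w := rs (fun p => p.2.1 ∉ Finset.range m) c with hw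
  set wp := rs (fun p => p.2.1 ∉ Finset.range m ∧ 1 ≤ p.1) c with hwp
  set w0 := rs (fun p => p.2.1 ∉ Finset.range m ∧ p.1 = 0) c with hw0
  set wn := rs (fun p => p.2.1 ∉ Finset.range m ∧ p.1 < 0) c with hwn
  set d := wp - (w0 + wn) with hd
  have hcases : ∀ k : ℤ, (1 ≤ k ∧ ¬ k = 0 ∧ ¬ k < 0) ∨ (¬ 1 ≤ k ∧ k = 0 ∧ ¬ k < 0) ∨
      (¬ 1 ≤ k ∧ ¬ k = 0 ∧ k < 0) := by intro k; omega
  have ew : w = wp + (w0 + wn) := by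
    ext i
    simp only [hw, hwp, hw0, hwn, PiLp.add_apply, rs_apply]
    by_cases h : i.1.2.1 ∉ Finset.range m
    · rcases hcases i.1.1 with ⟨h1, h2, h3⟩ | ⟨h1, h2, h3⟩ | ⟨h1, h2, h3⟩ <;>
      simp only [h, h1, h2, h3] <;> simp
    · simp only [h]; simp
  have hnd : ‖d‖ ^ 2 = ‖wp‖ ^ 2 + ‖w0‖ ^ 2 + ‖wn‖ ^ 2 := by
    simp only [nsq, ← Finset.sum_add_distrib]
    refine Finset.sum_congr rfl fun i _ => ?_
    simp only [hd, hwp, hw0, hwn, PiLp.add_apply, PiLp.sub_apply, rs_apply]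
    by_cases h : i.1.2.1 ∉ Finset.range m
    · rcases hcases i.1.1 with ⟨h1, h2, h3⟩ | ⟨h1, h2, h3⟩ | ⟨h1, h2, h3⟩ <;>
      simp only [h, h1, h2, h3] <;> simp
    · simp only [h]; simp
  have hnw : ‖w‖ ^ 2 = ‖d‖ ^ 2 := by
    simp only [nsq]
    refine Finset.sum_congr rfl fun i _ => ?_
    simp only [hd, hw, hwp, hw0, hwn, PiLp.add_apply, PiLp.sub_apply, rs_apply]
    by_cases h : i.1.2.1 ∉ Finset.range m
    · rcases hcases i.1.1 with ⟨h1, h2, h3⟩ | ⟨h1, h2, h3⟩ | ⟨h1, h2, h3⟩ <;>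
      simp only [h, h1, h2, h3] <;> simp
    · simp only [h]; simp
  have hnw' : ‖w‖ = ‖d‖ := (sq_eq_sq₀ (norm_nonneg _) (norm_nonneg _)).1 hnw
  have hL : 2 * Real.pi * (‖wp‖ ^ 2 + ‖wn‖ ^ 2) ≤ ⟪LL c, d⟫ := by
    rw [LL_inner]
    simp only [nsq, ← Finset.sum_add_distrib, Finset.mul_sum]
    refine Finset.sum_le_sum fun i _ => ?_
    simp only [hd, hwp, hw0, hwn, PiLp.add_apply, PiLp.sub_apply, rs_apply]
    have hsq : 0 ≤ 2 * Real.pi * c i ^ 2 := by positivity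
    by_cases h : i.1.2.1 ∉ Finset.range m
    · rcases hcases i.1.1 with ⟨h1, h2, h3⟩ | ⟨h1, h2, h3⟩ | ⟨h1, h2, h3⟩ <;>
      simp only [h, h1, h2, h3] <;> simp
      · have : (1:ℝ) ≤ i.1.1 := by exact_mod_cast h1
        nlinarith
      · have : (i.1.1:ℝ) ≤ -1 := by exact_mod_cast (by omega : i.1.1 ≤ -1)
        nlinarith
    · simp only [h]; simp
  have exw : ∀ t, xx b J c t - PP b (Finset.range m) (xx b J c t) = xx b J w t := by
    intro t
    rw [PP_xx hb hJ, ← xx_sub]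
    congr 1
    ext i
    simp only [hw, PiLp.sub_apply, rs_apply]
    by_cases h : i.1.2.1 ∈ Finset.range m
    · simp only [h]; simp
    · simp only [h]; simp
  have hPd : ∀ t, PP b (Finset.range m) (xx b J d t) = 0 := by
    intro t
    rw [PP_xx hb hJ]
    have : rs (fun p => p.2.1 ∈ Finset.range m) d = 0 := by
      ext i
      simp only [hd, hwp, hw0, hwn, PiLp.add_apply, PiLp.sub_apply, rs_apply, PiLp.zero_apply]
      by_cases h : i.1.2.1 ∈ Finset.range m
      · simp only [h]; simp
      · simp only [h]; simp
    rw [this]; simp [xx]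
  have hx0 : ∀ t, ‖xx b J w0 t‖ ^ 2 = ‖w0‖ ^ 2 := by
    have hcst : ∀ t, xx b J w0 t = xx b J w0 0 := by
      intro t
      unfold xx
      refine Finset.sum_congr rfl fun i _ => ?_
      simp only [hw0, rs_apply]
      split_ifs with h
      · simp [ee, h.2]
      · simp
    intro t
    rw [← xx_sq_int hb hJ w0, hcst t]
    simp only [hcst]
    simp
  have cwp := xx_cont (b := b) (J := J) wp
  have cwn := xx_cont (b := b) (J := J) wn
  have cw0 := xx_cont (b := b) (J := J) w0
  have cw := xx_cont (b := b) (J := J) w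
  have cd := xx_cont (b := b) (J := J) d
  have hpt : ∀ t, ⟪G (xx b J c t), xx b J d t⟫ ≤ (2 * Real.pi - η) * ‖xx b J wp t‖ ^ 2
      - ‖w0‖ ^ 2 / 4 * al (xx b J c t) + Real.pi * ‖xx b J wn t‖ ^ 2 + ε m * ‖xx b J d t‖ := by
    intro t
    set y := xx b J c t with hy
    have h1 := hH.tail m hm y
    rw [hy, exw, ← hy] at h1
    have h2 : ⟪G y, xx b J d t⟫ = ⟪(G y - PP b (Finset.range m) (G y)) - al y • xx b J w t, xx b J d t⟫
        + al y * ⟪xx b J w t, xx b J d t⟫ := by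
      rw [inner_sub_left, inner_sub_left, PP_selfadj, hPd, inner_zero_right, inner_smul_left]
      simp
    have h3 : ⟪(G y - PP b (Finset.range m) (G y)) - al y • xx b J w t, xx b J d t⟫ ≤
        ε m * ‖xx b J d t‖ := by
      refine (real_inner_le_norm _ _).trans ?_
      gcongr
    have h4 : ⟪xx b J w t, xx b J d t⟫ = ‖xx b J wp t‖ ^ 2 - ‖xx b J w0 t + xx b J wn t‖ ^ 2 := by
      rw [ew, hd, xx_add, xx_sub, xx_add, inner_add_left, inner_sub_right, inner_sub_right,
        real_inner_self_eq_norm_sq, real_inner_self_eq_norm_sq,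
        real_inner_comm (xx b J wp t)]
      ring
    have h5 : ‖w0‖ ^ 2 / 2 - ‖xx b J wn t‖ ^ 2 ≤ ‖xx b J w0 t + xx b J wn t‖ ^ 2 := by
      rw [← hx0 t]
      have p := parallelogram_law_with_norm ℝ (xx b J w0 t + xx b J wn t) (xx b J wn t)
      rw [add_sub_cancel_right] at p
      nlinarith [mul_self_nonneg ‖xx b J w0 t + xx b J wn t + xx b J wn t‖]
    have a0 := hH.al0 y
    have a1 := hH.al1 y
    have n1 := sq_nonneg ‖xx b J wp t‖
    have n2 := sq_nonneg ‖xx b J w0 t + xx b J wn t‖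
    have n3 := sq_nonneg ‖xx b J wn t‖
    have k1 : al y * ‖xx b J wp t‖ ^ 2 ≤ (2 * Real.pi - η) * ‖xx b J wp t‖ ^ 2 := by gcongr
    have k2 : al y / 2 * (‖w0‖ ^ 2 / 2 - ‖xx b J wn t‖ ^ 2) ≤
        al y / 2 * ‖xx b J w0 t + xx b J wn t‖ ^ 2 := by gcongr
    have k3 : al y / 2 * ‖xx b J wn t‖ ^ 2 ≤ Real.pi * ‖xx b J wn t‖ ^ 2 := by
      gcongr; linarith
    have k4 : 0 ≤ al y / 2 * ‖xx b J w0 t + xx b J wn t‖ ^ 2 := by positivity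
    rw [h2, h4]
    linarith
  have hint : ∫ t in (0:ℝ)..1, ⟪G (xx b J c t), xx b J d t⟫ ≤ (2 * Real.pi - η) * ‖wp‖ ^ 2
      - ‖w0‖ ^ 2 / 4 * η' + Real.pi * ‖wn‖ ^ 2 + ε m * ‖d‖ := by
    have h1 := intervalIntegral.integral_mono_on zero_le_one
      ((hgc.inner cd).intervalIntegrable (μ := MeasureTheory.volume) 0 1)
      (Continuous.intervalIntegrable (by fun_prop) 0 1) (fun t _ => hpt t)
    rw [intervalIntegral.integral_add, intervalIntegral.integral_add, intervalIntegral.integral_sub,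
      intervalIntegral.integral_const_mul, intervalIntegral.integral_const_mul,
      intervalIntegral.integral_const_mul, intervalIntegral.integral_const_mul,
      xx_sq_int hb hJ, xx_sq_int hb hJ] at h1
    rotate_left
    all_goals try (apply Continuous.intervalIntegrable; fun_prop)
    have h2 := norm_int_le_half d hb hJ
    have h3 : ε m * ∫ t in (0:ℝ)..1, ‖xx b J d t‖ ≤ ε m * ‖d‖ := by gcongr
    have h4 : ‖w0‖ ^ 2 / 4 * η' ≤ ‖w0‖ ^ 2 / 4 * ∫ t in (0:ℝ)..1, al (xx b J c t) := by gcongr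
    linarith
  have hfin : κ * ‖d‖ ^ 2 ≤ (δ + ε m) * ‖d‖ := by
    have h1 : ⟪VV b J G c, d⟫ = ⟪LL c, d⟫ - ∫ t in (0:ℝ)..1, ⟪G (xx b J c t), xx b J d t⟫ := by
      rw [← co_inner _ hgc]; unfold VV; rw [inner_sub_left]
    have h2 : ⟪VV b J G c, d⟫ ≤ δ * ‖d‖ := by
      refine (real_inner_le_norm _ _).trans ?_
      gcongr
    rw [hnd]
    have n1 := sq_nonneg ‖wp‖
    have n2 := sq_nonneg ‖w0‖
    have n3 := sq_nonneg ‖wn‖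
    have k1 : κ * ‖wp‖ ^ 2 ≤ η * ‖wp‖ ^ 2 := by gcongr
    have k2 : κ * ‖w0‖ ^ 2 ≤ η' / 4 * ‖w0‖ ^ 2 := by gcongr
    have k3 : κ * ‖wn‖ ^ 2 ≤ Real.pi * ‖wn‖ ^ 2 := by gcongr
    linarith
  have hwb : ‖w‖ ≤ (δ + ε m) / κ := by
    rw [hnw', le_div_iff₀ hκp]
    rcases (norm_nonneg d).eq_or_lt with h | h
    · rw [← h]; linarith
    · nlinarith
  have hLw : ‖LL w‖ ≤ δ + ε m + 2 * Real.pi * ‖w‖ := by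
    rw [hw, LL_rs]
    have hrs : ∀ u : EuclideanSpace ℝ S, rs (fun p => p.2.1 ∉ Finset.range m) u =
        u - rs (fun p => p.2.1 ∈ Finset.range m) u := by
      intro u
      ext i
      simp only [PiLp.sub_apply, rs_apply]
      by_cases h : i.1.2.1 ∈ Finset.range m
      · simp only [h]; simp
      · simp only [h]; simp
    have e1 : LL c = VV b J G c + co b J S (fun t => G (xx b J c t)) := by unfold VV; abel
    have hrsadd : ∀ u v : EuclideanSpace ℝ S, rs (fun p => p.2.1 ∉ Finset.range m) (u + v) =
        rs (fun p => p.2.1 ∉ Finset.range m) u + rs (fun p => p.2.1 ∉ Finset.range m) v := by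
      intro u v
      ext i
      simp only [PiLp.add_apply, rs_apply]
      split_ifs <;> simp
    have hpg : Continuous (fun t => PP b (Finset.range m) (G (xx b J c t))) := by fun_prop
    have e2 : rs (fun p => p.2.1 ∉ Finset.range m) (co b J S (fun t => G (xx b J c t))) =
        co b J S (fun t => ((G (xx b J c t) - PP b (Finset.range m) (G (xx b J c t)))
          - al (xx b J c t) • xx b J w t)) + co b J S (fun t => al (xx b J c t) • xx b J w t) := by
      rw [hrs, ← co_PP hb hJ, ← co_add _ _ (by fun_prop) (by fun_prop), sub_eq_iff_eq_add,
        ← co_add _ _ (by fun_prop) (by fun_prop)]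
      congr 1
      ext t
      abel
    rw [e1, hrsadd, e2]
    have n1 := (rs_norm_le (fun p => p.2.1 ∉ Finset.range m) (VV b J G c)).trans hV
    have n2 : ‖co b J S (fun t => ((G (xx b J c t) - PP b (Finset.range m) (G (xx b J c t)))
          - al (xx b J c t) • xx b J w t))‖ ≤ ε m := by
      apply co_norm_le hb hJ _ (by fun_prop)
      intro t
      rw [← exw]
      exact hH.tail m hm _
    have n3 : ‖co b J S (fun t => al (xx b J c t) • xx b J w t)‖ ≤ 2 * Real.pi * ‖w‖ := by
      apply abs_le_of_sq_le_sq' _ (by positivity) |>.2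
      refine (co_norm hb hJ _ (by fun_prop)).trans ?_
      rw [mul_pow, ← xx_sq_int hb hJ w, ← intervalIntegral.integral_const_mul]
      apply intervalIntegral.integral_mono_on zero_le_one
      · apply Continuous.intervalIntegrable; fun_prop
      · apply Continuous.intervalIntegrable; fun_prop
      · intro t _
        rw [norm_smul, mul_pow, Real.norm_of_nonneg (hH.al0 _)]
        have a0 := hH.al0 (xx b J c t)
        have a1 := hH.al1 (xx b J c t)
        have : al (xx b J c t) ≤ 2 * Real.pi := by linarith
        gcongr
    have t1 := norm_add_le (rs (fun p => p.2.1 ∉ Finset.range m) (VV b J G c))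
      (co b J S (fun t => ((G (xx b J c t) - PP b (Finset.range m) (G (xx b J c t)))
          - al (xx b J c t) • xx b J w t)) + co b J S (fun t => al (xx b J c t) • xx b J w t))
    have t2 := norm_add_le (co b J S (fun t => ((G (xx b J c t) - PP b (Finset.range m) (G (xx b J c t)))
          - al (xx b J c t) • xx b J w t))) (co b J S (fun t => al (xx b J c t) • xx b J w t))
    linarith
  rw [exw]
  have hs := xx_sup hb hJ w t₁
  have e : (1 / κ + (1 + 2 * Real.pi / κ)) * (δ + ε m) = (δ + ε m) / κ + (δ + ε m +
    2 * Real.pi * ((δ + ε m) / κ)) := by field_simp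
  rw [e]
  have : 2 * Real.pi * ‖w‖ ≤ 2 * Real.pi * ((δ + ε m) / κ) := by gcongr
  linarith

end gal

end

section

theorem arzela_loops (x : ℕ → ℝ → Z) (hc : ∀ n, Continuous (x n)) (hp : ∀ n t, x n (t + 1) = x n t)
    (K : Set Z) (hK : IsCompact K) (hxK : ∀ n t, x n t ∈ K)
    (heq : ∀ e > 0, ∃ d > 0, ∀ n s t, |s - t| < d → ‖x n t - x n s‖ ≤ e) :
    ∃ φ : ℕ → ℕ, StrictMono φ ∧ ∃ X : ℝ → Z, Continuous X ∧ (∀ t, X (t + 1) = X t) ∧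
      ∀ t, Filter.Tendsto (fun n => x (φ n) t) Filter.atTop (nhds (X t)) := by
  let I := Set.Icc (0:ℝ) 1
  let F : ℕ → BoundedContinuousFunction I Z := fun n =>
    BoundedContinuousFunction.mkOfCompact ⟨fun t : I => x n t, (hc n).comp continuous_subtype_val⟩
  have hcomp : IsCompact (closure (Set.range F)) := by
    apply BoundedContinuousFunction.arzela_ascoli K hK
    · rintro f t ⟨n, rfl⟩
      exact hxK n t
    · intro t0
      rw [Metric.equicontinuousAt_iff]
      intro e he
      obtain ⟨d, hd, h⟩ := heq (e / 2) (by linarith)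
      refine ⟨d, hd, ?_⟩
      rintro s hs ⟨f, n, rfl⟩
      have h1 : |(s:ℝ) - t0| < d := by simpa [Subtype.dist_eq, Real.dist_eq] using hs
      have := h n s t0 h1
      show dist (x n t0) (x n s) < e
      rw [dist_eq_norm]; linarith
  obtain ⟨f, hf, φ, hφ, hlim⟩ := hcomp.tendsto_subseq
    (fun n => subset_closure (Set.mem_range_self n : F n ∈ _))
  have hfr : ∀ n t, x n (Int.fract t) = x n t := by
    intro n t
    have hper : Function.Periodic (x n) 1 := hp n
    rw [Int.fract]
    have := hper.sub_int_mul_eq (x := t) ⌊t⌋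
    simpa using this
  have hfm : ∀ t : ℝ, Int.fract t ∈ I := fun t => ⟨Int.fract_nonneg t, (Int.fract_lt_one t).le⟩
  let X : ℝ → Z := fun t => f ⟨Int.fract t, hfm t⟩
  have hX : ∀ t, Filter.Tendsto (fun n => x (φ n) t) Filter.atTop (nhds (X t)) := by
    intro t
    have h1 := (continuous_eval_const (F := BoundedContinuousFunction I Z)
      (⟨Int.fract t, hfm t⟩ : I)).continuousAt.tendsto.comp hlim
    refine h1.congr fun n => ?_
    exact hfr (φ n) t
  refine ⟨φ, hφ, X, ?_, ?_, hX⟩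
  · rw [Metric.continuous_iff]
    intro t e he
    obtain ⟨d, hd, h⟩ := heq (e / 2) (by linarith)
    refine ⟨d, hd, fun s hs => ?_⟩
    have h2 : ‖X t - X s‖ ≤ e / 2 := by
      apply le_of_tendsto ((hX t).sub (hX s)).norm
      exact Filter.Eventually.of_forall fun n => h _ _ _ (by simpa [Real.dist_eq] using hs)
    rw [dist_comm, dist_eq_norm]; linarith
  · intro t
    refine tendsto_nhds_unique (hX (t + 1)) ?_
    simp only [hp]
    exact hX t

theorem fourier_zero (u : ℝ → ℝ) (hu : Continuous u) (hp : ∀ t, u (t + 1) = u t)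
    (hc : ∀ n : ℤ, ∫ t in (0:ℝ)..1, u t * Real.cos (2 * Real.pi * n * t) = 0)
    (hs : ∀ n : ℤ, ∫ t in (0:ℝ)..1, u t * Real.sin (2 * Real.pi * n * t) = 0) : ∀ t, u t = 0 := by
  have : Fact ((0:ℝ) < 1) := ⟨one_pos⟩
  have hper : Function.Periodic (fun t => (u t : ℂ)) 1 := fun t => by simp [hp]
  let f : C(AddCircle (1:ℝ), ℂ) := ⟨hper.lift, by
    apply continuous_coinduced_dom.2
    show Continuous fun t : ℝ => (u t : ℂ)
    exact Complex.continuous_ofReal.comp hu⟩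
  have hco : ∀ n, fourierCoeff f n = 0 := by
    intro n
    rw [fourierCoeff_eq_intervalIntegral _ _ 0]
    have : ∀ t : ℝ, (fourier (-n) (t : AddCircle (1:ℝ)) : ℂ) • f t =
        ((u t * Real.cos (2 * Real.pi * n * t) : ℝ) : ℂ) -
          ((u t * Real.sin (2 * Real.pi * n * t) : ℝ) : ℂ) * Complex.I := by
      intro t
      have hf : f t = (u t : ℂ) := rfl
      rw [hf, fourier_coe_apply]
      have e : 2 * (Real.pi:ℂ) * Complex.I * ((-n : ℤ) : ℂ) * t / ((1:ℝ):ℂ) =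
        ((-(2 * Real.pi * n * t) : ℝ) : ℂ) * Complex.I := by push_cast; ring
      rw [e, Complex.exp_mul_I, ← Complex.ofReal_cos, ← Complex.ofReal_sin, Real.cos_neg,
        Real.sin_neg, smul_eq_mul]
      push_cast; ring
    simp only [this]
    rw [intervalIntegral.integral_sub, intervalIntegral.integral_mul_const,
      intervalIntegral.integral_ofReal, intervalIntegral.integral_ofReal]
    · simp [hc, hs]
    · apply Continuous.intervalIntegrable; fun_prop
    · apply Continuous.intervalIntegrable; fun_prop
  have hsum : Summable (fourierCoeff f) := by
    have : fourierCoeff f = fun _ => 0 := funext hco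
    rw [this]; exact summable_zero
  have h0 := hasSum_fourier_series_of_summable hsum
  simp only [hco, zero_smul] at h0
  have hf0 : f = 0 := h0.unique hasSum_zero
  intro t
  have : f t = (u t : ℂ) := rfl
  rw [hf0, ContinuousMap.zero_apply] at this
  exact_mod_cast this.symm

theorem compact_of_tails {b : ℕ × Bool → Z} (hb : IsHilbertBasis b) (V : Set Z) (M : ℝ)
    (hM : ∀ v ∈ V, ‖v‖ ≤ M)
    (ht : ∀ e > 0, ∃ m, ∀ v ∈ V, ‖v - PP b (Finset.range m) v‖ ≤ e) : IsCompact (closure V) := by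
  apply TotallyBounded.isCompact_of_isClosed _ isClosed_closure
  apply TotallyBounded.closure
  rw [Metric.totallyBounded_iff]
  intro e he
  obtain ⟨m, hm⟩ := ht (e / 3) (by linarith)
  let K0 : Set Z := (fun f : ℕ × Bool → ℝ => ∑ i ∈ Finset.range m ×ˢ Finset.univ, f i • b i) ''
    (Set.pi Set.univ fun _ => Set.Icc (-M) M)
  have hK0 : IsCompact K0 := by
    refine (isCompact_univ_pi fun _ => isCompact_Icc).image ?_
    fun_prop
  obtain ⟨t, htf, hcov⟩ := Metric.totallyBounded_iff.1 hK0.totallyBounded (e / 3) (by linarith)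
  refine ⟨t, htf, fun v hv => ?_⟩
  have h1 : PP b (Finset.range m) v ∈ K0 := by
    refine ⟨fun i => ⟪b i, v⟫, ?_, ?_⟩
    · intro i _
      have := abs_real_inner_le_norm (b i) v
      rw [hb.1.1, one_mul] at this
      exact abs_le.1 (this.trans (hM v hv))
    · simp [PP_apply]
  have h2 := hcov h1
  simp only [Set.mem_iUnion, Metric.mem_ball] at h2 ⊢
  obtain ⟨y, hy, hd⟩ := h2
  refine ⟨y, hy, ?_⟩
  have := hm v hv
  have h3 := dist_triangle v (PP b (Finset.range m) v) y
  rw [dist_eq_norm v (PP b (Finset.range m) v)] at h3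
  linarith

end

section

section weak
variable {b : ℕ × Bool → Z} {J : Z →L[ℝ] Z}

theorem basis_zero (hb : IsHilbertBasis b) (v : Z) (h : ∀ i, ⟪v, b i⟫ = 0) : v = 0 := by
  have : innerSL ℝ v = (0 : Z →L[ℝ] ℝ) := clm_ext_basis hb fun i => by simpa using h i
  have h2 : ⟪v, v⟫ = 0 := by
    have := congrArg (fun L : Z →L[ℝ] ℝ => L v) this
    simpa using this
  exact inner_self_eq_zero.1 h2

theorem basis_J (hJ : IsJ b J) (i : ℕ × Bool) : ∃ (i' : ℕ × Bool) (s : ℝ), b i = s • J (b i') := by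
  obtain ⟨j, s⟩ := i
  cases s
  · exact ⟨(j, true), -1, by rw [(hJ j).1]; simp⟩
  · exact ⟨(j, false), 1, by rw [(hJ j).2]; simp⟩

set_option maxHeartbeats 2000000 in
theorem ode_of_weak (hb : IsHilbertBasis b) (hJ : IsJ b J) (X g : ℝ → Z) (hX : Continuous X)
    (hXp : ∀ t, X (t + 1) = X t) (hg : Continuous g) (hgp : ∀ t, g (t + 1) = g t)
    (hw : ∀ p : ℤ × (ℕ × Bool), 2 * Real.pi * p.1 * ∫ t in (0:ℝ)..1, ⟪X t, ee b J p t⟫ =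
      ∫ t in (0:ℝ)..1, ⟪g t, ee b J p t⟫) (t : ℝ) : HasDerivAt X (J (g t)) t := by
  have hJg : Continuous fun t => J (g t) := J.continuous.comp hg
  set W : ℝ → Z := fun t => ∫ s in (0:ℝ)..t, J (g s) with hW
  have hWd : ∀ t, HasDerivAt W (J (g t)) t := fun t =>
    intervalIntegral.integral_hasDerivAt_right (hJg.intervalIntegrable _ _)
      hJg.stronglyMeasurable.stronglyMeasurableAtFilter hJg.continuousAt
  have hWc : Continuous W := continuous_iff_continuousAt.2 fun t => (hWd t).continuousAt
  have hg0 : ∫ s in (0:ℝ)..1, g s = 0 := by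
    apply basis_zero hb
    intro i
    have h := hw (0, i)
    have e : ∀ t, ee b J (0, i) t = b i := fun t => by simp [ee]
    simp only [Int.cast_zero, mul_zero, zero_mul, e] at h
    have h2 := (innerSL ℝ (b i)).intervalIntegral_comp_comm (μ := MeasureTheory.volume)
      (hg.intervalIntegrable 0 1)
    simp only [innerSL_apply_apply] at h2
    rw [real_inner_comm, ← h2]
    rw [show (fun x => ⟪b i, g x⟫) = fun x => ⟪g x, b i⟫ from
      funext fun x => real_inner_comm _ _, ← h]
  have hWp : ∀ t, W (t + 1) = W t := by
    intro t
    have hper : Function.Periodic (fun s => J (g s)) 1 := fun s => by simp [hgp]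
    have h1 := hper.intervalIntegral_add_eq t 0
    rw [zero_add, J.intervalIntegral_comp_comm (hg.intervalIntegrable 0 1), hg0, map_zero] at h1
    have h2 := intervalIntegral.integral_add_adjacent_intervals (μ := MeasureTheory.volume)
      (hJg.intervalIntegrable 0 t) (hJg.intervalIntegrable t (t + 1))
    rw [h1, add_zero] at h2
    exact h2.symm
  have hec := fun p => ee_cont (b := b) (J := J) p
  have hJec : ∀ p, Continuous fun t => J (ee b J p t) := fun p => J.continuous.comp (hec p)
  have hip : ∀ p : ℤ × (ℕ × Bool), ∫ t in (0:ℝ)..1, ⟪g t, J (ee b J p t)⟫ =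
      2 * Real.pi * p.1 * ∫ t in (0:ℝ)..1, ⟪W t, J (ee b J p t)⟫ := by
    intro p
    have hd : ∀ t, HasDerivAt (fun t => ⟪W t, ee b J p t⟫)
        (2 * Real.pi * p.1 * ⟪W t, J (ee b J p t)⟫ - ⟪g t, J (ee b J p t)⟫) t := by
      intro t
      have := (hWd t).inner ℝ (ee_deriv hb hJ p t)
      refine this.congr_deriv ?_
      rw [inner_smul_right, J_skew hb hJ]; ring
    have h1 : Continuous fun t => 2 * Real.pi * p.1 * ⟪W t, J (ee b J p t)⟫ :=
      continuous_const.mul (hWc.inner (hJec p))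
    have h2 : Continuous fun t => ⟪g t, J (ee b J p t)⟫ := hg.inner (hJec p)
    have h3 := intervalIntegral.integral_eq_sub_of_hasDerivAt (a := 0) (b := 1)
      (fun t _ => hd t) ((h1.sub h2).intervalIntegrable _ _)
    rw [intervalIntegral.integral_sub (h1.intervalIntegrable _ _) (h2.intervalIntegrable _ _),
      intervalIntegral.integral_const_mul] at h3
    have h4 : W 1 = W 0 := by simpa using hWp 0
    have h5 : ee b J p 1 = ee b J p 0 := by simpa using ee_periodic (b := b) (J := J) p 0
    rw [h4, h5, sub_self] at h3
    linarith
  have hip2 : ∀ p : ℤ × (ℕ × Bool), ∫ t in (0:ℝ)..1, ⟪g t, ee b J p t⟫ =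
      2 * Real.pi * p.1 * ∫ t in (0:ℝ)..1, ⟪W t, ee b J p t⟫ := by
    intro p
    obtain ⟨i', s, hs⟩ := basis_J hJ p.2
    have e : ∀ t, ee b J p t = s • J (ee b J (p.1, i') t) := by
      intro t
      simp only [ee, hs, map_add, map_smul]
      module
    simp only [e, inner_smul_right]
    rw [intervalIntegral.integral_const_mul, intervalIntegral.integral_const_mul, hip]
    ring
  set v := ∫ t in (0:ℝ)..1, (X t - W t) with hv
  set Y : ℝ → Z := fun t => X t - W t - v with hY
  have hYc : Continuous Y := (hX.sub hWc).sub continuous_const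
  have hYp : ∀ t, Y (t + 1) = Y t := fun t => by simp only [hY, hXp, hWp]
  have hYe : ∀ p : ℤ × (ℕ × Bool), ∫ t in (0:ℝ)..1, ⟪Y t, ee b J p t⟫ = 0 := by
    intro p
    have h1 := (hX.inner (𝕜 := ℝ) (hec p)).intervalIntegrable (μ := MeasureTheory.volume) 0 1
    have h2 := (hWc.inner (𝕜 := ℝ) (hec p)).intervalIntegrable (μ := MeasureTheory.volume) 0 1
    have h3 := ((continuous_const (y := v)).inner (𝕜 := ℝ) (hec p)).intervalIntegrable
      (μ := MeasureTheory.volume) 0 1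
    simp only [hY, inner_sub_left]
    rw [intervalIntegral.integral_sub (h1.sub h2) h3]
    by_cases hp : p.1 = 0
    · obtain ⟨k, i⟩ := p
      simp only at hp
      subst hp
      have e : ∀ t, ee b J (0, i) t = b i := fun t => by simp [ee]
      simp only [e]
      have h4 := (innerSL ℝ (b i)).intervalIntegral_comp_comm (μ := MeasureTheory.volume)
        ((hX.sub hWc).intervalIntegrable 0 1)
      simp only [innerSL_apply_apply, Pi.sub_apply] at h4
      have h5 : ∫ t in (0:ℝ)..1, (⟪X t, b i⟫ - ⟪W t, b i⟫) = ⟪v, b i⟫ := by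
        rw [real_inner_comm, hv, ← h4]
        congr 1; ext t; rw [← inner_sub_left, real_inner_comm]
      rw [h5]; simp
    · have hk : (2 * Real.pi * p.1 : ℝ) ≠ 0 := by
        have := Real.pi_pos.ne'
        have : (p.1:ℝ) ≠ 0 := by exact_mod_cast hp
        positivity
      have h4 : ∫ t in (0:ℝ)..1, ⟪X t, ee b J p t⟫ = ∫ t in (0:ℝ)..1, ⟪W t, ee b J p t⟫ :=
        mul_left_cancel₀ hk ((hw p).trans (hip2 p))
      rw [intervalIntegral.integral_sub h1 h2, h4, sub_self, zero_sub, neg_eq_zero]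
      simp only [ee, inner_add_right, inner_smul_right]
      rw [intervalIntegral.integral_add, intervalIntegral.integral_mul_const,
        intervalIntegral.integral_mul_const, int_cos, int_sin, if_neg hp]
      · simp
      · apply Continuous.intervalIntegrable; fun_prop
      · apply Continuous.intervalIntegrable; fun_prop
  have hcos : ∀ i (n : ℤ), ∫ t in (0:ℝ)..1, ⟪Y t, b i⟫ * Real.cos (2 * Real.pi * n * t) = 0 := by
    intro i n
    have e : ∀ t, ⟪Y t, b i⟫ * Real.cos (2 * Real.pi * n * t) =
      (1/2) * (⟪Y t, ee b J (n, i) t⟫ + ⟪Y t, ee b J (-n, i) t⟫) := by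
      intro t
      have : 2 * Real.pi * ((-n : ℤ) : ℝ) * t = -(2 * Real.pi * n * t) := by push_cast; ring
      simp only [ee, this, Real.cos_neg, Real.sin_neg, inner_add_right, inner_smul_right]
      ring
    simp only [e]
    rw [intervalIntegral.integral_const_mul, intervalIntegral.integral_add
      ((hYc.inner (hec _)).intervalIntegrable _ _) ((hYc.inner (hec _)).intervalIntegrable _ _),
      hYe, hYe]
    simp
  have hsin : ∀ i (n : ℤ), ∫ t in (0:ℝ)..1, ⟪Y t, b i⟫ * Real.sin (2 * Real.pi * n * t) = 0 := by
    intro i n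
    obtain ⟨i', s, hs⟩ := basis_J hJ i
    have e : ∀ t, ⟪Y t, b i⟫ * Real.sin (2 * Real.pi * n * t) =
      (s/2) * (⟪Y t, ee b J (n, i') t⟫ - ⟪Y t, ee b J (-n, i') t⟫) := by
      intro t
      have : 2 * Real.pi * ((-n : ℤ) : ℝ) * t = -(2 * Real.pi * n * t) := by push_cast; ring
      simp only [ee, this, hs, Real.cos_neg, Real.sin_neg, inner_add_right, inner_smul_right]
      ring
    simp only [e]
    rw [intervalIntegral.integral_const_mul, intervalIntegral.integral_sub
      ((hYc.inner (hec _)).intervalIntegrable _ _) ((hYc.inner (hec _)).intervalIntegrable _ _),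
      hYe, hYe]
    simp
  have hY0 : ∀ t, Y t = 0 := by
    intro t
    apply basis_zero hb
    intro i
    exact fourier_zero (fun t => ⟪Y t, b i⟫) (hYc.inner continuous_const)
      (fun t => by simp only [hYp]) (hcos i) (hsin i) t
  have hXW : X = fun t => W t + v := by
    ext t
    have := hY0 t
    simp only [hY] at this
    rw [← sub_eq_zero, ← this]; abel
  rw [hXW]
  exact (hWd t).add_const v

theorem int_lim (x : ℕ → ℝ → Z) (hc : ∀ n, Continuous (x n)) (X : ℝ → Z) (K : Set Z)
    (hK : IsCompact K) (hxK : ∀ n t, x n t ∈ K)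
    (hlim : ∀ t, Filter.Tendsto (fun n => x n t) Filter.atTop (nhds (X t)))
    (F : Z × ℝ → ℝ) (hF : Continuous F) :
    Filter.Tendsto (fun n => ∫ t in (0:ℝ)..1, F (x n t, t)) Filter.atTop
      (nhds (∫ t in (0:ℝ)..1, F (X t, t))) := by
  obtain ⟨M, hM⟩ := (hK.prod (isCompact_Icc (a := (0:ℝ)) (b := 1))).exists_bound_of_continuousOn
    hF.continuousOn
  apply intervalIntegral.tendsto_integral_filter_of_dominated_convergence (fun _ => M)
  · refine Filter.Eventually.of_forall fun n => ?_
    exact (hF.comp ((hc n).prodMk continuous_id)).aestronglyMeasurable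
  · refine Filter.Eventually.of_forall fun n => Filter.Eventually.of_forall fun t ht => ?_
    rw [Set.uIoc_of_le zero_le_one] at ht
    exact hM _ ⟨hxK n t, ht.1.le, ht.2⟩
  · exact intervalIntegrable_const
  · refine Filter.Eventually.of_forall fun t _ => ?_
    exact (hF.tendsto (X t, t)).comp ((hlim t).prodMk_nhds tendsto_const_nhds)

theorem PP_xx_SN (hb : IsHilbertBasis b) (hJ : IsJ b J) {N m : ℕ} (h : N ≤ m)
    (c : EuclideanSpace ℝ (SN N)) (t : ℝ) : PP b (Finset.range m) (xx b J c t) = xx b J c t := by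
  rw [PP_xx hb hJ]
  congr 1
  ext i
  rw [rs_apply, if_pos]
  have := i.2
  simp only [SN, Finset.mem_product, Finset.mem_range] at this ⊢
  omega

end weak

end

section

set_option maxHeartbeats 2000000 in
theorem periodic_orbit {b : ℕ × Bool → Z} {J : Z →L[ℝ] Z} (hb : IsHilbertBasis b) (hJ : IsJ b J)
    {j₀ : ℕ} {H : Z → ℝ} {G : Z → Z}
    {al : Z → ℝ} {y0 : Z} {a ν ρ C C0 C1 C2 η : ℝ} {ε : ℕ → ℝ}
    (hH : HamOK b j₀ H G al y0 a ν ρ C C0 C1 C2 η ε)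
    (hε : Filter.Tendsto ε Filter.atTop (nhds 0)) :
    ∃ X : ℝ → Z, Continuous X ∧ (∀ t, X (t + 1) = X t) ∧ (∀ t, HasDerivAt X (J (G (X t))) t) ∧
      0 < 1 / 2 * (∫ t in (0:ℝ)..1, ⟪G (X t), X t⟫) - ∫ t in (0:ℝ)..1, H (X t) := by
  obtain ⟨β, hβ, N0, hcrit⟩ := galerkin_crit hb hJ hH
  obtain ⟨M, hM, hap1⟩ := apriori1 hb hJ hH
  obtain ⟨B, hB, δ0, hδ0, hap2⟩ := apriori2 hb hJ hH β hβ
  have hHc : Continuous H := continuous_iff_continuousAt.2 fun y => (hH.grad y).continuousAt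
  have hGc := hH.Gc
  set δ : ℕ → ℝ := fun n => min δ0 (1 / ((n:ℝ) + 1)) with hδ
  have hδp : ∀ n, 0 < δ n := fun n => lt_min hδ0 (by positivity)
  have hδl : ∀ n, δ n ≤ 1 / ((n:ℝ) + 1) := fun n => min_le_right _ _
  have hδ1 : ∀ n, δ n ≤ 1 := fun n => (hδl n).trans (by
    rw [div_le_one (by positivity)]; have : (0:ℝ) ≤ n := by positivity
    linarith)
  choose c hcV hcA using fun n => hcrit (N0 + n) (Nat.le_add_right _ _) (δ n) (hδp n)
  set x : ℕ → ℝ → Z := fun n => xx b J (c n) with hx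
  have hxc : ∀ n, Continuous (x n) := fun n => xx_cont _
  have hcM : ∀ n, ‖c n‖ ≤ M ∧ ‖LL (c n)‖ ≤ M := fun n => hap1 _ _ ((hcV n).le.trans (hδ1 n))
  have hδ0lim : Filter.Tendsto δ Filter.atTop (nhds 0) :=
    squeeze_zero (fun n => (hδp n).le) hδl tendsto_one_div_add_atTop_nhds_zero_nat
  -- compactness
  set K := closure (Set.range fun p : ℕ × ℝ => x p.1 p.2) with hK
  have hKc : IsCompact K := by
    apply compact_of_tails hb _ (M + M)
    · rintro _ ⟨⟨n, t⟩, rfl⟩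
      exact (xx_sup hb hJ (c n) t).trans (add_le_add (hcM n).1 (hcM n).2)
    · intro e he
      have h1 : ∀ᶠ n in Filter.atTop, B * δ n < e / 2 := by
        have := hδ0lim.const_mul B
        rw [mul_zero] at this
        exact this.eventually_lt_const (by linarith)
      have h2 : ∀ᶠ n in Filter.atTop, B * ε n < e / 2 := by
        have := hε.const_mul B
        rw [mul_zero] at this
        exact this.eventually_lt_const (by linarith)
      obtain ⟨n1, hn1⟩ := Filter.eventually_atTop.1 h1
      obtain ⟨m1, hm1⟩ := Filter.eventually_atTop.1 h2
      refine ⟨max (j₀ + 1) (max m1 (N0 + n1)), ?_⟩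
      set m := max (j₀ + 1) (max m1 (N0 + n1)) with hm
      have hmj : j₀ < m := lt_of_lt_of_le (Nat.lt_succ_self _) (le_max_left _ _)
      have hmm : m1 ≤ m := (le_max_left _ _).trans (le_max_right _ _)
      have hmn : N0 + n1 ≤ m := (le_max_right _ _).trans (le_max_right _ _)
      rintro _ ⟨⟨n, t⟩, rfl⟩
      simp only
      rcases le_total n n1 with h | h
      · rw [hx, PP_xx_SN hb hJ (by omega)]
        simp [he.le]
      · have h3 := hap2 _ (c n) (δ n) (hcV n).le (min_le_left _ _) (hcA n) m hmj t
        have h4 := hn1 n h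
        have h5 := hm1 m hmm
        refine h3.trans ?_
        rw [mul_add]; linarith
  have hxK : ∀ n t, x n t ∈ K := fun n t => subset_closure ⟨(n, t), rfl⟩
  have heq : ∀ e > 0, ∃ d > 0, ∀ n s t, |s - t| < d → ‖x n t - x n s‖ ≤ e := by
    intro e he
    set l := M ^ 2 / e with hl
    have hlp : 0 < l := by positivity
    refine ⟨min 1 (e / l), lt_min one_pos (by positivity), ?_⟩
    have key : ∀ n s t, s ≤ t → t - s < min 1 (e / l) → ‖x n t - x n s‖ ≤ e := by
      intro n s t hst hts
      have h1 := xx_osc hb hJ (c n) l hlp s t hst (by have := hts.trans_le (min_le_left _ _); linarith)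
      have h2 : l / 2 * (t - s) ≤ e / 2 := by
        have h3 := (hts.trans_le (min_le_right _ _)).le
        rw [le_div_iff₀ hlp] at h3
        linarith
      have h4 : ‖LL (c n)‖ ^ 2 / (2 * l) ≤ e / 2 := by
        rw [div_le_iff₀ (by positivity)]
        have : e / 2 * (2 * l) = M ^ 2 := by rw [hl]; field_simp
        rw [this]
        exact pow_le_pow_left₀ (norm_nonneg _) (hcM n).2 2
      exact h1.trans (by linarith)
    intro n s t hst
    rcases le_total s t with h | h
    · exact key n s t h (by rw [abs_sub_comm, abs_of_nonneg (by linarith)] at hst; exact hst)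
    · rw [norm_sub_rev]
      exact key n t s h (by rw [abs_of_nonneg (by linarith)] at hst; exact hst)
  obtain ⟨φ, hφ, X, hXc, hXp, hlim⟩ := arzela_loops x hxc (fun n t => xx_periodic _ _) K hKc hxK heq
  have hδφ : Filter.Tendsto (fun n => δ (φ n)) Filter.atTop (nhds 0) :=
    hδ0lim.comp hφ.tendsto_atTop
  have IL := fun F hF => int_lim (fun n => x (φ n)) (fun n => hxc _) X K hKc
    (fun n t => hxK _ t) hlim F hF
  refine ⟨X, hXc, hXp, ?_, ?_⟩
  · refine ode_of_weak hb hJ X (fun t => G (X t)) hXc hXp (hGc.comp hXc)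
      (fun t => by simp only [hXp]) ?_
    intro p
    have hec := ee_cont (b := b) (J := J) p
    have L1 := IL (fun q => ⟪q.1, ee b J p q.2⟫) (by fun_prop)
    have L2 := IL (fun q => ⟪G q.1, ee b J p q.2⟫) (by fun_prop)
    have L3 := ((L1.const_mul (2 * Real.pi * p.1)).sub L2).norm
    have L4 : Filter.Tendsto (fun n => ‖2 * Real.pi * p.1 * (∫ t in (0:ℝ)..1, ⟪x (φ n) t, ee b J p t⟫)
        - ∫ t in (0:ℝ)..1, ⟪G (x (φ n) t), ee b J p t⟫‖) Filter.atTop (nhds 0) := by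
      apply squeeze_zero' (Filter.Eventually.of_forall fun n => norm_nonneg _) _ hδφ
      filter_upwards [Filter.eventually_ge_atTop (p.1.natAbs + p.2.1 + 1)] with n hn
      have hφn := hφ.id_le n
      simp only [id] at hφn
      have hmem : p ∈ SN (N0 + φ n) := by
        simp only [SN, Finset.mem_product, Finset.mem_range, Finset.mem_Icc, Finset.mem_univ,
          and_true]
        omega
      have h1 := (PiLp.norm_apply_le (VV b J G (c (φ n))) ⟨p, hmem⟩).trans (hcV (φ n)).le
      have h2 : (VV b J G (c (φ n))) ⟨p, hmem⟩ =
        2 * Real.pi * p.1 * (∫ t in (0:ℝ)..1, ⟪x (φ n) t, ee b J p t⟫)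
        - ∫ t in (0:ℝ)..1, ⟪G (x (φ n) t), ee b J p t⟫ := by
        have h3 : (c (φ n)) ⟨p, hmem⟩ = ∫ t in (0:ℝ)..1, ⟪x (φ n) t, ee b J p t⟫ := by
          conv_lhs => rw [← co_xx hb hJ (c (φ n))]
          rfl
        rw [← h3]
        rfl
      rw [← h2]; exact h1
    have := tendsto_nhds_unique L3 L4
    rw [norm_eq_zero] at this
    exact sub_eq_zero.1 this
  · have L1 := IL (fun q => ⟪G q.1, q.1⟫) (by fun_prop)
    have L2 := IL (fun q => H q.1) (by fun_prop)
    have L3 := ((L1.const_mul (1 / 2)).sub L2).add (hδφ.mul_const M)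
    rw [zero_mul, add_zero] at L3
    have : β / 2 ≤ 1 / 2 * (∫ t in (0:ℝ)..1, ⟪G (X t), X t⟫) - ∫ t in (0:ℝ)..1, H (X t) := by
      refine ge_of_tendsto' L3 fun n => ?_
      have h1 := hcA (φ n)
      have h2 : ⟪LL (c (φ n)), c (φ n)⟫ = ⟪VV b J G (c (φ n)), c (φ n)⟫ +
          ∫ t in (0:ℝ)..1, ⟪G (x (φ n) t), x (φ n) t⟫ := by
        rw [← co_inner (b := b) (J := J) (S := SN (N0 + φ n)) (fun t => G (x (φ n) t))
          (hGc.comp (hxc _)) (c (φ n)), ← inner_add_left]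
        congr 1
        unfold VV
        abel
      have h3 : ⟪VV b J G (c (φ n)), c (φ n)⟫ ≤ δ (φ n) * M :=
        (real_inner_le_norm _ _).trans
          (mul_le_mul (hcV _).le (hcM _).1 (norm_nonneg _) (hδp _).le)
      have h4 : 0 ≤ δ (φ n) * M := mul_nonneg (hδp _).le hM.le
      unfold AA at h1
      rw [h2] at h1
      simp only [hx] at h1 ⊢
      linarith
    linarith

end

section

theorem posSq_deriv (x : ℝ) : HasDerivAt (fun x : ℝ => (max x 0) ^ 2) (2 * max x 0) x := by
  rcases lt_trichotomy x 0 with h | h | h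
  · rw [max_eq_right h.le, mul_zero]
    refine (hasDerivAt_const x (0:ℝ)).congr_of_eventuallyEq ?_
    filter_upwards [eventually_lt_nhds h] with y hy
    rw [max_eq_right hy.le]; simp
  · subst h
    rw [max_self, mul_zero, hasDerivAt_iff_isLittleO_nhds_zero]
    have h1 : (fun h : ℝ => (max (0 + h) 0) ^ 2 - (max (0:ℝ) 0) ^ 2 - h • (0:ℝ)) =O[nhds 0]
        fun h : ℝ => h ^ 2 := by
      apply Asymptotics.IsBigO.of_bound 1
      refine Filter.Eventually.of_forall fun y => ?_
      simp only [zero_add, max_self, smul_zero, sub_zero, one_mul]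
      have e : (0:ℝ) ^ 2 = 0 := by norm_num
      rw [e, sub_zero, norm_pow, norm_pow]
      apply pow_le_pow_left₀ (norm_nonneg _)
      rw [Real.norm_eq_abs, Real.norm_eq_abs, abs_of_nonneg (le_max_right _ _)]
      exact max_le (le_abs_self _) (abs_nonneg _)
    refine h1.trans_isLittleO ?_
    have := Asymptotics.isLittleO_pow_id (𝕜 := ℝ) (n := 2) one_lt_two
    exact this
  · rw [max_eq_left h.le]
    have := hasDerivAt_pow 2 x
    simp only [Nat.cast_ofNat] at this
    refine HasDerivAt.congr_of_eventuallyEq (by simpa using this) ?_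
    filter_upwards [eventually_gt_nhds h] with y hy
    rw [max_eq_left hy.le]

/-- clamp function. -/
def clp (u d s : ℝ) : ℝ := (max (s - u) 0 - max (s - u - d) 0) / d
/-- smooth ramp, primitive of `clp`. -/
def rmp (u d s : ℝ) : ℝ := ((max (s - u) 0) ^ 2 - (max (s - u - d) 0) ^ 2) / (2 * d)

theorem clp_cont (u d : ℝ) : Continuous (clp u d) := by unfold clp; fun_prop

theorem rmp_deriv (u d s : ℝ) : HasDerivAt (rmp u d) (clp u d s) s := by
  have h1 := (posSq_deriv (s - u)).comp s ((hasDerivAt_id s).sub_const u)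
  have h2 := (posSq_deriv (s - u - d)).comp s (((hasDerivAt_id s).sub_const u).sub_const d)
  have h3 := (h1.sub h2).div_const (2 * d)
  refine h3.congr_deriv ?_
  unfold clp
  rw [mul_one, mul_one, ← mul_sub, mul_div_mul_left _ _ two_ne_zero]

theorem clp_nonneg {u d s : ℝ} (hd : 0 < d) : 0 ≤ clp u d s := by
  unfold clp
  apply div_nonneg _ hd.le
  have : max (s - u - d) 0 ≤ max (s - u) 0 := max_le_max (by linarith) le_rfl
  linarith

theorem clp_le_one {u d s : ℝ} (hd : 0 < d) : clp u d s ≤ 1 := by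
  unfold clp
  rw [div_le_one hd]
  rcases max_cases (s - u) 0 with h | h <;> rcases max_cases (s - u - d) 0 with h' | h' <;> linarith

theorem clp_zero {u d s : ℝ} (hd : 0 < d) (h : s ≤ u) : clp u d s = 0 := by
  unfold clp
  rw [max_eq_right (by linarith), max_eq_right (by linarith)]; simp

theorem clp_one {u d s : ℝ} (hd : 0 < d) (h : u + d ≤ s) : clp u d s = 1 := by
  unfold clp
  rw [max_eq_left (by linarith), max_eq_left (by linarith)]; field_simp; ring

theorem rmp_mono {u d : ℝ} (hd : 0 < d) : Monotone (rmp u d) :=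
  monotone_of_hasDerivAt_nonneg (fun s => rmp_deriv u d s) fun s => clp_nonneg hd

theorem sub_rmp_mono {u d : ℝ} (hd : 0 < d) : Monotone (fun s => s - rmp u d s) :=
  monotone_of_hasDerivAt_nonneg (fun s => (hasDerivAt_id s).sub (rmp_deriv u d s))
    fun s => by
      have := clp_le_one (u := u) (s := s) hd
      show (0:ℝ) ≤ 1 - clp u d s
      linarith

theorem rmp_zero {u d s : ℝ} (hd : 0 < d) (h : s ≤ u) : rmp u d s = 0 := by
  unfold rmp
  rw [max_eq_right (by linarith), max_eq_right (by linarith)]; simp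

theorem rmp_nonneg {u d s : ℝ} (hd : 0 < d) : 0 ≤ rmp u d s := by
  rcases le_total s u with h | h
  · rw [rmp_zero hd h]
  · rw [← rmp_zero (u := u) hd le_rfl]
    exact rmp_mono hd h

theorem rmp_eq {u d s : ℝ} (hd : 0 < d) (h : u + d ≤ s) : rmp u d s = s - u - d / 2 := by
  unfold rmp
  rw [max_eq_left (by linarith), max_eq_left (by linarith)]; field_simp; ring

theorem rmp_ge {u d s : ℝ} (hd : 0 < d) : s - u - d / 2 ≤ rmp u d s := by
  rcases le_total s (u + d) with h | h
  · have := sub_rmp_mono (u := u) hd h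
    simp only at this
    rw [rmp_eq hd le_rfl] at this
    linarith
  · rw [rmp_eq hd h]

theorem rmp_le {u d s : ℝ} (hd : 0 < d) (hu : 0 ≤ u) (hs : 0 ≤ s) : rmp u d s ≤ s := by
  have := sub_rmp_mono (u := u) hd hs
  simp only at this
  rw [rmp_zero hd hu] at this
  linarith

theorem clp_rmp {u d s : ℝ} (hd : 0 < d) (hu : 0 ≤ u) : s * clp u d s - rmp u d s ≤ u + d / 2 := by
  rcases le_total s u with h | h
  · rw [clp_zero hd h, rmp_zero hd h]; linarith
  · rcases le_total s (u + d) with h' | h'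
    · unfold clp rmp
      rw [max_eq_left (by linarith), max_eq_right (a := s - u - d) (by linarith)]
      have e : s * ((s - u - 0) / d) - ((s - u) ^ 2 - 0 ^ 2) / (2 * d) =
        (u * (s - u) + (s - u) ^ 2 / 2) / d := by field_simp; ring
      rw [e, div_le_iff₀ hd]
      nlinarith
    · rw [clp_one hd h', rmp_eq hd h']; linarith

/-- the profile. -/
def gpr (k u v d s : ℝ) : ℝ := k * (rmp u d s - rmp v d s)
/-- derivative of the profile. -/
def gpr' (k u v d s : ℝ) : ℝ := k * (clp u d s - clp v d s)

theorem gpr_deriv (k u v d s : ℝ) : HasDerivAt (gpr k u v d) (gpr' k u v d s) s :=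
  ((rmp_deriv u d s).sub (rmp_deriv v d s)).const_mul k

theorem gpr'_cont (k u v d : ℝ) : Continuous (gpr' k u v d) := by
  have := clp_cont u d
  have := clp_cont v d
  unfold gpr'; fun_prop

theorem clp_shift (u v d s : ℝ) : clp v d s = clp u d (s - (v - u)) := by
  unfold clp; congr 3 <;> ring_nf
theorem rmp_shift (u v d s : ℝ) : rmp v d s = rmp u d (s - (v - u)) := by
  unfold rmp; congr 4 <;> ring_nf

theorem clp_mono {u d : ℝ} (hd : 0 < d) : Monotone (clp u d) := by
  intro s t hst
  unfold clp
  apply div_le_div_of_nonneg_right _ hd.le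
  rcases max_cases (s - u) 0 with h | h <;> rcases max_cases (s - u - d) 0 with h' | h' <;>
  rcases max_cases (t - u) 0 with k | k <;> rcases max_cases (t - u - d) 0 with k' | k' <;> linarith


theorem gpr'_nonneg {k u v d s : ℝ} (hk : 0 ≤ k) (hd : 0 < d) (huv : u ≤ v) : 0 ≤ gpr' k u v d s := by
  unfold gpr'
  rw [clp_shift u v]
  have : clp u d (s - (v - u)) ≤ clp u d s := clp_mono hd (by linarith)
  exact mul_nonneg hk (by linarith)

theorem gpr'_le {k u v d s : ℝ} (hk : 0 ≤ k) (hd : 0 < d) (huv : u ≤ v) : gpr' k u v d s ≤ k := by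
  unfold gpr'
  have h1 := clp_le_one (u := u) (s := s) hd
  have h2 := clp_nonneg (u := v) (s := s) hd
  nlinarith

theorem gpr'_zero {k u v d s : ℝ} (hk : 0 ≤ k) (hd : 0 < d) (huv : u ≤ v) (h : v + d ≤ s) : gpr' k u v d s = 0 := by
  unfold gpr'
  rw [clp_one hd h, clp_one hd (by linarith)]; simp

theorem gpr_zero {k u v d s : ℝ} (hk : 0 ≤ k) (hd : 0 < d) (huv : u ≤ v) (h : s ≤ u) : gpr k u v d s = 0 := by
  unfold gpr
  rw [rmp_zero hd h, rmp_zero hd (by linarith)]; simp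

theorem gpr_nonneg {k u v d s : ℝ} (hk : 0 ≤ k) (hd : 0 < d) (huv : u ≤ v) : 0 ≤ gpr k u v d s := by
  unfold gpr
  rw [rmp_shift u v]
  have : rmp u d (s - (v - u)) ≤ rmp u d s := rmp_mono hd (by linarith)
  exact mul_nonneg hk (by linarith)

theorem gpr_le {k u v d s : ℝ} (hk : 0 ≤ k) (hd : 0 < d) (huv : u ≤ v) : gpr k u v d s ≤ k * (v - u) := by
  unfold gpr
  rw [rmp_shift u v]
  have := sub_rmp_mono (u := u) hd (show s - (v - u) ≤ s by linarith)
  simp only at this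
  exact mul_le_mul_of_nonneg_left (by linarith) hk

theorem gpr_eq {k u v d s : ℝ} (hk : 0 ≤ k) (hd : 0 < d) (huv : u ≤ v) (h : v + d ≤ s) : gpr k u v d s = k * (v - u) := by
  unfold gpr
  rw [rmp_eq hd h, rmp_eq hd (by linarith)]; ring

theorem gpr'_max {k u v d s : ℝ} (hk : 0 ≤ k) (hd : 0 < d) (huv : u ≤ v) (h : gpr k u v d s = k * (v - u)) : gpr' k u v d s = 0 := by
  have : IsLocalMax (gpr k u v d) s := by
    refine Filter.Eventually.of_forall fun t => ?_
    show gpr k u v d t ≤ gpr k u v d s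
    rw [h]; exact gpr_le hk hd huv
  exact this.hasDerivAt_eq_zero (gpr_deriv k u v d s)

end

section

theorem grad_of_fderiv {f : Z → ℝ} {L : Z →L[ℝ] ℝ} {v y : Z} (h : HasFDerivAt f L y)
    (hL : ∀ w, L w = ⟪v, w⟫) : HasGradientAt f v y := by
  rw [hasGradientAt_iff_hasFDerivAt]
  have e : L = InnerProductSpace.toDual ℝ Z v := by
    ext w
    rw [hL]; simp
  rw [← e]; exact h

theorem grad_fderiv {f : Z → ℝ} {v y : Z} (h : HasGradientAt f v y) :
    HasFDerivAt f (innerSL ℝ v) y := by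
  rw [hasGradientAt_iff_hasFDerivAt] at h
  exact h

theorem grad_normsq (z : Z) : HasGradientAt (fun z : Z => ‖z‖ ^ 2) ((2:ℝ) • z) z := by
  apply grad_of_fderiv ((hasFDerivAt_id z).norm_sq)
  intro w
  simp [inner_smul_left]

/-- elongated quadratic form. -/
def qf (b : ℕ × Bool → Z) (j₀ : ℕ) (ν : ℝ) (y : Z) : ℝ :=
  ‖PP b {j₀} y‖ ^ 2 + ν * ‖y - PP b {j₀} y‖ ^ 2
/-- its half gradient. -/
def lq (b : ℕ × Bool → Z) (j₀ : ℕ) (ν : ℝ) (y : Z) : Z :=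
  PP b {j₀} y + ν • (y - PP b {j₀} y)

theorem PP_orth {b : ℕ × Bool → Z} (hb : IsHilbertBasis b) (R : Finset ℕ) (x w : Z) :
    ⟪x - PP b R x, PP b R w⟫ = 0 := by
  rw [← PP_selfadj, map_sub, PP_idem hb, sub_self, inner_zero_left]

theorem grad_qf {b : ℕ × Bool → Z} (hb : IsHilbertBasis b) (j₀ : ℕ) (ν : ℝ) (y : Z) :
    HasGradientAt (qf b j₀ ν) ((2:ℝ) • lq b j₀ ν y) y := by
  have h1 := ((PP b {j₀}).hasFDerivAt (x := y)).norm_sq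
  have h2 := (((hasFDerivAt_id y).sub (PP b {j₀}).hasFDerivAt).norm_sq).const_mul ν
  apply grad_of_fderiv (h1.add h2)
  intro w
  have e1 := PP_orth hb {j₀} y w
  have e2 := PP_orth hb {j₀} w y
  rw [inner_sub_left] at e2
  have e3 := PP_selfadj (b := b) {j₀} y w
  simp only [ContinuousLinearMap.add_apply, ContinuousLinearMap.smul_apply,
    ContinuousLinearMap.comp_apply, ContinuousLinearMap.sub_apply, innerSL_apply_apply,
    ContinuousLinearMap.id_apply, id, lq, smul_eq_mul, nsmul_eq_mul, inner_smul_left,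
    inner_add_left, inner_sub_right, Nat.cast_ofNat]
  simp only [Pi.sub_apply, id, inner_sub_left] at e1 ⊢
  have e4 : ⟪PP b {j₀} y, w⟫ = ⟪PP b {j₀} y, PP b {j₀} w⟫ := by linarith
  simp only [conj_trivial]
  rw [e4]
  linear_combination (-2 * ν) * e1

theorem lq_inner {b : ℕ × Bool → Z} (hb : IsHilbertBasis b) (j₀ : ℕ) (ν : ℝ) (y : Z) :
    ⟪lq b j₀ ν y, y⟫ = qf b j₀ ν y := by
  have e1 := PP_orth hb {j₀} y y
  unfold lq qf
  rw [inner_add_left, inner_smul_left, ← real_inner_self_eq_norm_sq, ← real_inner_self_eq_norm_sq]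
  rw [inner_sub_right (y - PP b {j₀} y), e1]
  rw [inner_sub_left] at e1
  have e3 := PP_selfadj (b := b) {j₀} y y
  have e2 := real_inner_comm y (PP b {j₀} y)
  simp only [conj_trivial, sub_zero]
  linarith

theorem lq_norm {b : ℕ × Bool → Z} (hb : IsHilbertBasis b) (j₀ : ℕ) {ν : ℝ} (h0 : 0 ≤ ν)
    (h1 : ν ≤ 1) (y : Z) : ‖lq b j₀ ν y‖ ^ 2 ≤ qf b j₀ ν y := by
  have e1 := PP_orth hb {j₀} y y
  unfold lq qf
  rw [norm_add_sq_real, inner_smul_right, real_inner_comm, e1, norm_smul, mul_pow]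
  have : ‖ν‖ ^ 2 ≤ ν := by rw [Real.norm_eq_abs, sq_abs]; nlinarith
  have := mul_le_mul_of_nonneg_right this (sq_nonneg ‖y - PP b {j₀} y‖)
  linarith

theorem qf_le {b : ℕ × Bool → Z} (hb : IsHilbertBasis b) (j₀ : ℕ) {ν : ℝ}
    (h1 : ν ≤ 1) (y : Z) : qf b j₀ ν y ≤ ‖y‖ ^ 2 := by
  have e1 := PP_orth hb {j₀} y y
  have e2 : ‖y‖ ^ 2 = ‖PP b {j₀} y‖ ^ 2 + ‖y - PP b {j₀} y‖ ^ 2 := by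
    have : y = PP b {j₀} y + (y - PP b {j₀} y) := by abel
    conv_lhs => rw [this]
    rw [norm_add_sq_real, real_inner_comm, e1]; ring
  unfold qf
  rw [e2]
  nlinarith [sq_nonneg ‖y - PP b {j₀} y‖]

theorem lq_norm_le {b : ℕ × Bool → Z} (hb : IsHilbertBasis b) (j₀ : ℕ) {ν : ℝ} (h0 : 0 ≤ ν)
    (h1 : ν ≤ 1) (y : Z) : ‖lq b j₀ ν y‖ ≤ ‖y‖ :=
  abs_le_of_sq_le_sq' ((lq_norm hb j₀ h0 h1 y).trans (qf_le hb j₀ h1 y)) (norm_nonneg _) |>.2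

theorem lq_tail {b : ℕ × Bool → Z} (hb : IsHilbertBasis b) {j₀ m : ℕ} (hm : j₀ < m) (ν : ℝ) (y : Z) :
    lq b j₀ ν y - PP b (Finset.range m) (lq b j₀ ν y) = ν • (y - PP b (Finset.range m) y) := by
  have e : PP b (Finset.range m) (PP b {j₀} y) = PP b {j₀} y := by
    conv_rhs => rw [PP_apply]
    rw [PP_apply b {j₀} y, map_sum]
    refine Finset.sum_congr rfl fun i hi => ?_
    rw [map_smul]
    congr 1
    rw [PP_apply]
    simp only [orthonormal_iff_ite.1 hb.1, ite_smul, one_smul, zero_smul]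
    simp only [Finset.mem_product, Finset.mem_singleton, Finset.mem_univ, and_true] at hi
    rw [Finset.sum_ite_eq' , if_pos]
    simp [hi, hm]
  unfold lq
  simp only [map_add, map_smul, map_sub, e]
  module

theorem qf_nonneg {b : ℕ × Bool → Z} (j₀ : ℕ) {ν : ℝ} (h0 : 0 ≤ ν) (y : Z) : 0 ≤ qf b j₀ ν y := by
  unfold qf; positivity

theorem qf_cont (b : ℕ × Bool → Z) (j₀ : ℕ) (ν : ℝ) : Continuous (qf b j₀ ν) := by
  unfold qf; fun_prop

theorem lq_cont (b : ℕ × Bool → Z) (j₀ : ℕ) (ν : ℝ) : Continuous (lq b j₀ ν) := by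
  unfold lq; fun_prop

/-- A symplectic squeezing map, with a tail estimate. -/
structure SqzData (b : ℕ × Bool → Z) (J : Z →L[ℝ] Z) (j₀ : ℕ) (r R : ℝ) (φ φi : Z → Z)
    (D Di : Z → Z →L[ℝ] Z) (M C : ℝ) (ε : ℕ → ℝ) : Prop where
  li : ∀ z, φi (φ z) = z
  ri : ∀ z, φ (φi z) = z
  d : ∀ z, HasFDerivAt φ (D z) z
  dc : Continuous D
  di : ∀ z, HasFDerivAt φi (Di z) z
  sym : ∀ z v w, ⟪J (D z v), D z w⟫ = ⟪J v, w⟫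
  hM : 0 ≤ M
  bd : ∀ z, ‖z‖ < r → ‖φ z‖ ≤ M
  hC : 0 ≤ C
  bD : ∀ z, ‖z‖ < r → ‖D z‖ ≤ C
  sq : ∀ z, ‖z‖ < r → ‖PP b {j₀} (φ z)‖ < R
  hε : Filter.Tendsto ε Filter.atTop (nhds 0)
  tail : ∀ m z, ‖z‖ < r → ‖(J (D z (-J z)) - φ z) -
    PP b (Finset.range m) (J (D z (-J z)) - φ z)‖ ≤ ε m

theorem SqzData.inv {b : ℕ × Bool → Z} {J : Z →L[ℝ] Z} {j₀ : ℕ} {r R : ℝ} {φ φi : Z → Z}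
    {D Di : Z → Z →L[ℝ] Z} {M C : ℝ} {ε : ℕ → ℝ} (h : SqzData b J j₀ r R φ φi D Di M C ε)
    (y w : Z) : D (φi y) (Di y w) = w := by
  have h1 := (h.d (φi y)).comp y (h.di y)
  have h2 : HasFDerivAt (φ ∘ φi) (ContinuousLinearMap.id ℝ Z) y := by
    have : φ ∘ φi = id := funext h.ri
    rw [this]; exact hasFDerivAt_id y
  exact congrArg (fun L : Z →L[ℝ] Z => L w) (h1.unique h2)

theorem SqzData.inv' {b : ℕ × Bool → Z} {J : Z →L[ℝ] Z} {j₀ : ℕ} {r R : ℝ} {φ φi : Z → Z}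
    {D Di : Z → Z →L[ℝ] Z} {M C : ℝ} {ε : ℕ → ℝ} (h : SqzData b J j₀ r R φ φi D Di M C ε)
    (y w : Z) : Di y (D (φi y) w) = w := by
  have h0 : HasFDerivAt φi (Di y) (φ (φi y)) := by rw [h.ri]; exact h.di y
  have h1 := h0.comp (φi y) (h.d (φi y))
  have h2 : HasFDerivAt (φi ∘ φ) (ContinuousLinearMap.id ℝ Z) (φi y) := by
    have : φi ∘ φ = id := funext h.li
    rw [this]; exact hasFDerivAt_id _
  exact congrArg (fun L : Z →L[ℝ] Z => L w) (h1.unique h2)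

theorem exists_consts {P Q : ℝ} (hQ : 0 < Q) (hPQ : Q < P) :
    ∃ k a : ℝ, 0 < k ∧ k < Real.pi ∧ Real.pi < a ∧ a < 2 * Real.pi ∧ a * Q ≤ k * P := by
  have hπ := Real.pi_pos
  set τ := (P - Q) / (2 * (P + Q)) with hτ
  have hPQ' : 0 < P + Q := by linarith
  have h1 : 0 < τ := div_pos (by linarith) (by linarith)
  have h2 : τ < 1 := by rw [hτ, div_lt_one (by linarith)]; linarith
  have h3 : τ * (P + Q) = (P - Q) / 2 := by rw [hτ]; field_simp
  refine ⟨Real.pi * (1 - τ), Real.pi * (1 + τ), by apply mul_pos hπ; linarith, by nlinarith,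
    by nlinarith, by nlinarith, ?_⟩
  rw [mul_assoc, mul_assoc]
  apply mul_le_mul_of_nonneg_left _ hπ.le
  nlinarith

end

section

/-- the Hamiltonian. -/
def HHam (b : ℕ × Bool → Z) (j₀ : ℕ) (φi : Z → Z) (k a ν d S r : ℝ) (y : Z) : ℝ :=
  gpr k d (r ^ 2 - 2 * d) d (‖φi y‖ ^ 2) + a * rmp S d (qf b j₀ ν y)
/-- its gradient. -/
def GHam (b : ℕ × Bool → Z) (J : Z →L[ℝ] Z) (j₀ : ℕ) (φi : Z → Z) (D : Z → Z →L[ℝ] Z)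
    (k a ν d S r : ℝ) (y : Z) : Z :=
  (2 * gpr' k d (r ^ 2 - 2 * d) d (‖φi y‖ ^ 2)) • J (D (φi y) (-J (φi y)))
    + (2 * a * clp S d (qf b j₀ ν y)) • lq b j₀ ν y

/-- Parameter constraints. -/
structure ParOK (r R M k a ν d S : ℝ) : Prop where
  hr : 0 < r
  hR : 0 < R
  k0 : 0 < k
  k1 : k < Real.pi
  a0 : Real.pi < a
  a1 : a < 2 * Real.pi
  d0 : 0 < d
  d1 : d ≤ r ^ 2 - 2 * d
  S0 : 0 < S
  n0 : 0 < ν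
  n1 : ν ≤ 1
  n2 : a * ν ≤ (Real.pi - k) / 2
  n3 : R ^ 2 + ν * M ^ 2 ≤ S
  key : a * (S + d / 2) ≤ k * (r ^ 2 - 2 * d - d)

section hamok
variable {b : ℕ × Bool → Z} {J : Z →L[ℝ] Z} {j₀ : ℕ} {r R : ℝ} {φ φi : Z → Z}
    {D Di : Z → Z →L[ℝ] Z} {M C : ℝ} {ε : ℕ → ℝ} {k a ν d S : ℝ}

theorem gp_ball (p : ParOK r R M k a ν d S) (z : Z)
    (h : gpr' k d (r ^ 2 - 2 * d) d (‖z‖ ^ 2) ≠ 0) : ‖z‖ < r := by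
  by_contra hz
  push Not at hz
  apply h
  apply gpr'_zero p.k0.le p.d0 p.d1
  have := p.d0
  have := pow_le_pow_left₀ p.hr.le hz 2
  linarith

theorem q_ball (hb : IsHilbertBasis b) (h : SqzData b J j₀ r R φ φi D Di M C ε)
    (p : ParOK r R M k a ν d S) (y : Z) (hz : ‖φi y‖ < r) : qf b j₀ ν y < S := by
  have h1 := h.sq _ hz
  have h2 := h.bd _ hz
  rw [h.ri] at h1 h2
  unfold qf
  have h3 := (QQ_norm_le hb {j₀} y).trans h2
  have h4 := pow_le_pow_left₀ (norm_nonneg _) h3 2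
  have h5 := pow_lt_pow_left₀ h1 (norm_nonneg _) two_ne_zero
  have h6 := mul_le_mul_of_nonneg_left h4 p.n0.le
  have := p.n3
  linarith

set_option maxHeartbeats 2000000 in
theorem grad_HHam (hb : IsHilbertBasis b) (hJ : IsJ b J) (h : SqzData b J j₀ r R φ φi D Di M C ε)
    (y : Z) : HasGradientAt (HHam b j₀ φi k a ν d S r) (GHam b J j₀ φi D k a ν d S r y) y := by
  have h1 : HasFDerivAt (fun y => ‖φi y‖ ^ 2) _ y := (h.di y).norm_sq
  have h2 := (gpr_deriv k d (r ^ 2 - 2 * d) d (‖φi y‖ ^ 2)).comp_hasFDerivAt y h1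
  have h3 := ((rmp_deriv S d (qf b j₀ ν y)).comp_hasFDerivAt y
    (grad_fderiv (grad_qf hb j₀ ν y))).const_mul a
  apply grad_of_fderiv (h2.add h3)
  intro w
  have e : ⟪J (D (φi y) (-J (φi y))), w⟫ = ⟪φi y, Di y w⟫ := by
    conv_lhs => rw [← h.inv y w]
    rw [h.sym, map_neg, J_sq hb hJ, neg_neg]
  unfold GHam
  rw [inner_add_left, inner_smul_left, inner_smul_left, e]
  simp only [ContinuousLinearMap.add_apply, ContinuousLinearMap.smul_apply,
    ContinuousLinearMap.comp_apply, innerSL_apply_apply, smul_eq_mul, inner_smul_left,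
    conj_trivial, nsmul_eq_mul, Nat.cast_ofNat]
  ring

set_option maxHeartbeats 2000000 in
theorem hamOK_of_sqz (hb : IsHilbertBasis b) (hJ : IsJ b J)
    (h : SqzData b J j₀ r R φ φi D Di M C ε) (p : ParOK r R M k a ν d S) :
    ∃ ρ C' C0 C1 C2, HamOK b j₀ (HHam b j₀ φi k a ν d S r) (GHam b J j₀ φi D k a ν d S r)
      (fun y => 2 * gpr' k d (r ^ 2 - 2 * d) d (‖φi y‖ ^ 2) + 2 * ν * a * clp S d (qf b j₀ ν y))
      (φ 0) a ν ρ C' C0 C1 C2 (Real.pi - k) (fun m => 2 * k * ε m) := by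
  obtain ⟨hr, hR, k0, k1, a0, a1, d0, d1, S0, n0, n1, n2, n3, key⟩ := id p
  have hπ := Real.pi_pos
  have ha : 0 < a := by linarith
  have gn : ∀ s, 0 ≤ gpr' k d (r ^ 2 - 2 * d) d s := fun s => gpr'_nonneg k0.le d0 d1
  have gl : ∀ s, gpr' k d (r ^ 2 - 2 * d) d s ≤ k := fun s => gpr'_le k0.le d0 d1
  have cn : ∀ s, 0 ≤ clp S d s := fun s => clp_nonneg d0
  have cl : ∀ s, clp S d s ≤ 1 := fun s => clp_le_one d0
  have hφi : Continuous φi := continuous_iff_continuousAt.2 fun y => (h.di y).continuousAt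
  have hqc := qf_cont b j₀ ν
  have hlc := lq_cont b j₀ ν
  have hgc := gpr'_cont k d (r ^ 2 - 2 * d) d
  have hcc := clp_cont S d
  have hDc := h.dc
  have hC := h.hC
  have hεn : ∀ m, 0 ≤ ε m := fun m => (norm_nonneg _).trans (h.tail m 0 (by simpa using hr))
  -- bound on first part
  have hfirst : ∀ y, ‖(2 * gpr' k d (r ^ 2 - 2 * d) d (‖φi y‖ ^ 2)) • J (D (φi y) (-J (φi y)))‖ ≤
      2 * gpr' k d (r ^ 2 - 2 * d) d (‖φi y‖ ^ 2) * (C * r) := by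
    intro y
    by_cases h0 : gpr' k d (r ^ 2 - 2 * d) d (‖φi y‖ ^ 2) = 0
    · rw [h0]; simp
    · have hz := gp_ball p _ h0
      rw [norm_smul, Real.norm_of_nonneg (mul_nonneg zero_le_two (gn _)), J_norm hb hJ]
      apply mul_le_mul_of_nonneg_left _ (mul_nonneg zero_le_two (gn _))
      refine ((D (φi y)).le_opNorm _).trans ?_
      rw [norm_neg, J_norm hb hJ]
      exact mul_le_mul (h.bD _ hz) hz.le (norm_nonneg _) hC
  -- neighbourhood of zero
  have hy0 : φi (φ 0) = 0 := h.li 0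
  have hq0 : qf b j₀ ν (φ 0) < S := q_ball hb h p _ (by rw [hy0]; simpa using hr)
  have hev : ∀ᶠ y in nhds (φ 0), ‖φi y‖ ^ 2 < d ∧ qf b j₀ ν y < S := by
    apply Filter.Eventually.and
    · have hc : Continuous fun y => ‖φi y‖ ^ 2 := by fun_prop
      apply hc.continuousAt.eventually_lt_const
      simp only [hy0]; simpa using d0
    · exact hqc.continuousAt.eventually_lt_const hq0
  obtain ⟨ρ, hρ, hball⟩ := Metric.eventually_nhds_iff.1 hev
  set m := k * (r ^ 2 - 2 * d - d) with hm
  have hm0 : 0 ≤ m := by rw [hm]; apply mul_nonneg k0.le; linarith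
  have hz : ∀ y, ‖y - φ 0‖ < ρ → HHam b j₀ φi k a ν d S r y = 0 := by
    intro y hy
    obtain ⟨h1, h2⟩ := hball (by rw [dist_eq_norm]; exact hy : dist y (φ 0) < ρ)
    unfold HHam
    rw [gpr_zero k0.le d0 d1 h1.le, rmp_zero d0 h2.le]; simp
  refine ⟨ρ, (m + 2 * a * ‖φ 0‖ ^ 2) / ρ ^ 2 + 2 * a, a * (S + d / 2),
    2 * k * (C * r) + 2 * a * (1 + (S + d)), C * r + 1 / ν, ?_⟩
  refine
    { grad := grad_HHam hb hJ h
      Gc := ?_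
      nonneg := fun y => ?_
      hρ := hρ
      zero := hz
      hC := by positivity
      quad := fun y => ?_
      ha1 := a0
      ha2 := a1
      hν1 := n0
      hν2 := by linarith
      low := fun y => ?_
      asym := fun y => ?_
      alc := by fun_prop
      al0 := fun y => ?_
      al1 := fun y => ?_
      hη := by linarith
      tail := fun m hjm y => ?_
      hC2 := by positivity
      Gal := fun y => ?_ }
  · unfold GHam
    have : Continuous fun y => D (φi y) (-J (φi y)) :=
      (hDc.comp hφi).clm_apply (by fun_prop)
    fun_prop
  · unfold HHam
    exact add_nonneg (gpr_nonneg k0.le d0 d1) (mul_nonneg ha.le (rmp_nonneg d0))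
  · rcases lt_or_ge ‖y - φ 0‖ ρ with h1 | h1
    · rw [hz y h1]; positivity
    · have e1 : HHam b j₀ φi k a ν d S r y ≤ m + a * ‖y‖ ^ 2 := by
        unfold HHam
        have q1 := gpr_le (s := ‖φi y‖ ^ 2) k0.le d0 d1
        have q2 := (rmp_le (u := S) d0 S0.le (qf_nonneg (b := b) j₀ n0.le y)).trans (qf_le hb j₀ n1 y)
        exact add_le_add q1 (mul_le_mul_of_nonneg_left q2 ha.le)
      have e2 : ‖y‖ ^ 2 ≤ 2 * ‖φ 0‖ ^ 2 + 2 * ‖y - φ 0‖ ^ 2 := by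
        have q1 : ‖y‖ ≤ ‖y - φ 0‖ + ‖φ 0‖ := by
          have := norm_add_le (y - φ 0) (φ 0)
          simpa using this
        have q2 := pow_le_pow_left₀ (norm_nonneg _) q1 2
        nlinarith [sq_nonneg (‖y - φ 0‖ - ‖φ 0‖)]
      have e3 : m + 2 * a * ‖φ 0‖ ^ 2 ≤ (m + 2 * a * ‖φ 0‖ ^ 2) / ρ ^ 2 * ‖y - φ 0‖ ^ 2 := by
        rw [div_mul_eq_mul_div, le_div_iff₀ (by positivity)]
        have : ρ ^ 2 ≤ ‖y - φ 0‖ ^ 2 := pow_le_pow_left₀ hρ.le h1 2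
        exact mul_le_mul_of_nonneg_left this (by positivity)
      have e4 := mul_le_mul_of_nonneg_left e2 ha.le
      rw [add_mul]
      linarith
  · unfold HHam
    have q1 := gpr_nonneg (s := ‖φi y‖ ^ 2) k0.le d0 d1
    have q2 := mul_le_mul_of_nonneg_left (rmp_ge (u := S) (s := qf b j₀ ν y) d0) ha.le
    show a * qf b j₀ ν y - a * (S + d / 2) ≤ _
    linarith
  · show ‖GHam b J j₀ φi D k a ν d S r y - (2 * a) • lq b j₀ ν y‖ ≤ _
    have e : GHam b J j₀ φi D k a ν d S r y - (2 * a) • lq b j₀ ν y =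
      (2 * gpr' k d (r ^ 2 - 2 * d) d (‖φi y‖ ^ 2)) • J (D (φi y) (-J (φi y)))
      + (2 * a * (clp S d (qf b j₀ ν y) - 1)) • lq b j₀ ν y := by
      unfold GHam; module
    rw [e]
    refine (norm_add_le _ _).trans (add_le_add ((hfirst y).trans ?_) ?_)
    · have := gl (‖φi y‖ ^ 2)
      gcongr
    · rcases le_total (S + d) (qf b j₀ ν y) with h1 | h1
      · rw [clp_one d0 h1]; simp; positivity
      · rw [norm_smul]
        have q1 : ‖2 * a * (clp S d (qf b j₀ ν y) - 1)‖ ≤ 2 * a := by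
          rw [norm_mul, Real.norm_of_nonneg (by positivity : 0 ≤ 2 * a)]
          have : ‖clp S d (qf b j₀ ν y) - 1‖ ≤ 1 := by
            rw [Real.norm_eq_abs, abs_le]
            constructor <;> linarith [cn (qf b j₀ ν y), cl (qf b j₀ ν y)]
          nlinarith
        have q2 : ‖lq b j₀ ν y‖ ≤ 1 + (S + d) := by
          have := lq_norm hb j₀ n0.le n1 y
          nlinarith [sq_nonneg (‖lq b j₀ ν y‖ - 1)]
        exact mul_le_mul q1 q2 (norm_nonneg _) (by positivity)
  · have := gn (‖φi y‖ ^ 2)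
    have := cn (qf b j₀ ν y)
    positivity
  · have q1 := gl (‖φi y‖ ^ 2)
    have q2 := mul_le_mul_of_nonneg_left (cl (qf b j₀ ν y)) (mul_nonneg n0.le ha.le)
    linarith
  · have e1 := lq_tail hb hjm ν y
    have e : GHam b J j₀ φi D k a ν d S r y - PP b (Finset.range m) (GHam b J j₀ φi D k a ν d S r y)
        - (2 * gpr' k d (r ^ 2 - 2 * d) d (‖φi y‖ ^ 2) + 2 * ν * a * clp S d (qf b j₀ ν y)) •
          (y - PP b (Finset.range m) y) =
        (2 * gpr' k d (r ^ 2 - 2 * d) d (‖φi y‖ ^ 2)) • ((J (D (φi y) (-J (φi y))) - y) -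
          PP b (Finset.range m) (J (D (φi y) (-J (φi y))) - y)) +
        (2 * a * clp S d (qf b j₀ ν y)) • ((lq b j₀ ν y - PP b (Finset.range m) (lq b j₀ ν y)) -
          ν • (y - PP b (Finset.range m) y)) := by
      unfold GHam
      rw [map_add, map_smul, map_smul, map_sub]
      module
    rw [e, e1, sub_self, smul_zero, add_zero]
    by_cases h0 : gpr' k d (r ^ 2 - 2 * d) d (‖φi y‖ ^ 2) = 0
    · rw [h0]; simp only [mul_zero, zero_smul, norm_zero]
      have := hεn m
      positivity
    · have hzz := gp_ball p _ h0
      have h2 := h.tail m _ hzz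
      rw [h.ri] at h2
      rw [norm_smul, Real.norm_of_nonneg (mul_nonneg zero_le_two (gn _))]
      have := gl (‖φi y‖ ^ 2)
      have := hεn m
      gcongr
  · have e1 := hfirst y
    have g1 := gn (‖φi y‖ ^ 2)
    have c1 := cn (qf b j₀ ν y)
    have e2 : ‖(2 * a * clp S d (qf b j₀ ν y)) • lq b j₀ ν y‖ ≤
        1 / ν * (2 * ν * a * clp S d (qf b j₀ ν y)) * ‖y‖ := by
      rw [norm_smul, Real.norm_of_nonneg (by positivity)]
      have : 1 / ν * (2 * ν * a * clp S d (qf b j₀ ν y)) = 2 * a * clp S d (qf b j₀ ν y) := by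
        field_simp
      rw [this]
      exact mul_le_mul_of_nonneg_left (lq_norm_le hb j₀ n0.le n1 y) (by positivity)
    refine (norm_add_le _ _).trans ((add_le_add e1 e2).trans ?_)
    generalize gpr' k d (r ^ 2 - 2 * d) d (‖φi y‖ ^ 2) = g at *
    generalize clp S d (qf b j₀ ν y) = c at *
    have hn : 0 < 1 / ν := by positivity
    have hy := norm_nonneg y
    have hCr : 0 ≤ C * r := by positivity
    have hc' : 0 ≤ 2 * ν * a * c := by positivity
    generalize 1 / ν = n at *
    generalize 2 * ν * a * c = c' at *
    generalize C * r = q at *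
    have p1 : 0 ≤ 2 * g * q * ‖y‖ := by positivity
    have p2 : 0 ≤ n * c' := by positivity
    have p3 : 0 ≤ q * c' * (1 + ‖y‖) := by positivity
    have p4 : 0 ≤ n * (2 * g) * (1 + ‖y‖) := by positivity
    nlinarith
end hamok

end

section

set_option maxHeartbeats 2000000 in
theorem sqz_contra {b : ℕ × Bool → Z} {J : Z →L[ℝ] Z} {j₀ : ℕ} {r R : ℝ} {φ φi : Z → Z}
    {D Di : Z → Z →L[ℝ] Z} {M C : ℝ} {ε : ℕ → ℝ} {k a ν d S : ℝ}
    (hb : IsHilbertBasis b) (hJ : IsJ b J)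
    (h : SqzData b J j₀ r R φ φi D Di M C ε) (p : ParOK r R M k a ν d S) : False := by
  obtain ⟨ρ, C', C0, C1, C2, hH⟩ := hamOK_of_sqz hb hJ h p
  have hε : Filter.Tendsto (fun m => 2 * k * ε m) Filter.atTop (nhds 0) := by
    simpa using h.hε.const_mul (2 * k)
  obtain ⟨X, hXc, hXp, hXd, hact⟩ := periodic_orbit hb hJ hH hε
  obtain ⟨hr, hR, k0, k1, a0, a1, d0, d1, S0, n0, n1, n2, n3, key⟩ := id p
  have hπ := Real.pi_pos
  have ha : 0 < a := by linarith
  have hGc := hH.Gc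
  have hHc : Continuous (HHam b j₀ φi k a ν d S r) :=
    continuous_iff_continuousAt.2 fun y => (hH.grad y).continuousAt
  set g' : ℝ → ℝ := gpr' k d (r ^ 2 - 2 * d) d with hg'
  set z : ℝ → Z := fun t => φi (X t) with hz
  have hzd : ∀ t, HasDerivAt z (Di (X t) (J (GHam b J j₀ φi D k a ν d S r (X t)))) t := fun t =>
    (h.di (X t)).comp_hasDerivAt t (hXd t)
  -- inside the ball
  have hin : ∀ t, ‖z t‖ < r → GHam b J j₀ φi D k a ν d S r (X t) =
      (2 * g' (‖z t‖ ^ 2)) • J (D (z t) (-J (z t))) := by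
    intro t ht
    have hq := q_ball hb h p (X t) ht
    unfold GHam
    rw [clp_zero d0 hq.le]
    simp [hz, hg']
  have hzd' : ∀ t, ‖z t‖ < r → HasDerivAt z ((2 * g' (‖z t‖ ^ 2)) • J (z t)) t := by
    intro t ht
    refine (hzd t).congr_deriv ?_
    rw [hin t ht, map_smul, J_sq hb hJ, map_neg, neg_neg, map_smul]
    congr 1
    exact h.inv' (X t) _
  have hFd : ∀ t, HasDerivAt (fun t => gpr k d (r ^ 2 - 2 * d) d (‖z t‖ ^ 2)) 0 t := by
    intro t
    have h1 := (gpr_deriv k d (r ^ 2 - 2 * d) d (‖z t‖ ^ 2)).comp t (hzd t).norm_sq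
    by_cases h0 : g' (‖z t‖ ^ 2) = 0
    · refine h1.congr_deriv ?_
      rw [show gpr' k d (r ^ 2 - 2 * d) d (‖z t‖ ^ 2) = 0 from h0]; simp
    · have ht := gp_ball p (z t) h0
      have h2 := (gpr_deriv k d (r ^ 2 - 2 * d) d (‖z t‖ ^ 2)).comp t (hzd' t ht).norm_sq
      refine h2.congr_deriv ?_
      rw [inner_smul_right, real_inner_comm, J_self hb hJ]; simp
  have hFc : ∀ t, gpr k d (r ^ 2 - 2 * d) d (‖z t‖ ^ 2) = gpr k d (r ^ 2 - 2 * d) d (‖z 0‖ ^ 2) :=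
    fun t => is_const_of_deriv_eq_zero (fun t => (hFd t).differentiableAt)
      (fun t => (hFd t).deriv) t 0
  have hI1 : IntervalIntegrable (fun t => ⟪GHam b J j₀ φi D k a ν d S r (X t), X t⟫)
      MeasureTheory.volume 0 1 := by
    apply Continuous.intervalIntegrable
    exact (hGc.comp hXc).inner hXc
  have hI2 : IntervalIntegrable (fun t => HHam b j₀ φi k a ν d S r (X t))
      MeasureTheory.volume 0 1 := (hHc.comp hXc).intervalIntegrable _ _
  rw [← intervalIntegral.integral_const_mul, ← intervalIntegral.integral_sub
    (hI1.const_mul _) hI2] at hact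
  have hneg : ∀ t, 1 / 2 * ⟪GHam b J j₀ φi D k a ν d S r (X t), X t⟫
      - HHam b j₀ φi k a ν d S r (X t) ≤ 0 := by
    by_cases hcase : gpr k d (r ^ 2 - 2 * d) d (‖z 0‖ ^ 2) = k * (r ^ 2 - 2 * d - d)
    · intro t
      have h1 := (hFc t).trans hcase
      have h2 := gpr'_max k0.le d0 d1 h1
      have h3 : GHam b J j₀ φi D k a ν d S r (X t) =
        (2 * a * clp S d (qf b j₀ ν (X t))) • lq b j₀ ν (X t) := by
        unfold GHam
        rw [show gpr' k d (r ^ 2 - 2 * d) d (‖φi (X t)‖ ^ 2) = 0 from h2]; simp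
      have h4 : HHam b j₀ φi k a ν d S r (X t) = k * (r ^ 2 - 2 * d - d)
          + a * rmp S d (qf b j₀ ν (X t)) := by
        unfold HHam
        rw [show gpr k d (r ^ 2 - 2 * d) d (‖φi (X t)‖ ^ 2) = _ from h1]
      rw [h3, h4, inner_smul_left, lq_inner hb]
      have h5 := mul_le_mul_of_nonneg_left
        (clp_rmp (u := S) (s := qf b j₀ ν (X t)) d0 S0.le) ha.le
      simp only [conj_trivial]
      linarith
    · have hball : ∀ t, ‖z t‖ < r := by
        intro t
        by_contra hc
        push Not at hc
        apply hcase
        rw [← hFc t]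
        apply gpr_eq k0.le d0 d1
        have := pow_le_pow_left₀ hr.le hc 2
        linarith
      have hnd : ∀ t, HasDerivAt (fun t => ‖z t‖ ^ 2) 0 t := by
        intro t
        refine (hzd' t (hball t)).norm_sq.congr_deriv ?_
        rw [inner_smul_right, real_inner_comm, J_self hb hJ]; simp
      have hnc : ∀ t, ‖z t‖ ^ 2 = ‖z 0‖ ^ 2 :=
        fun t => is_const_of_deriv_eq_zero (fun t => (hnd t).differentiableAt)
          (fun t => (hnd t).deriv) t 0
      set θ := 2 * g' (‖z 0‖ ^ 2) with hθ
      have hzd2 : ∀ t, HasDerivAt z (θ • J (z t)) t := by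
        intro t
        have := hzd' t (hball t)
        rwa [hnc t] at this
      have hvd : ∀ t, HasDerivAt (fun t => Real.cos (θ * t) • z t - Real.sin (θ * t) • J (z t)) 0 t := by
        intro t
        have h0 : HasDerivAt (fun t : ℝ => θ * t) θ t := by
          simpa using (hasDerivAt_id t).const_mul θ
        have h1 := h0.cos.smul (hzd2 t)
        have h2 := h0.sin.smul (J.hasFDerivAt.comp_hasDerivAt t (hzd2 t))
        refine (h1.sub h2).congr_deriv ?_
        simp only [map_smul, J_sq hb hJ, Function.comp]
        module
      have hvc : Real.cos (θ * 1) • z 1 - Real.sin (θ * 1) • J (z 1) =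
          Real.cos (θ * 0) • z 0 - Real.sin (θ * 0) • J (z 0) :=
        is_const_of_deriv_eq_zero (fun t => (hvd t).differentiableAt)
          (fun t => (hvd t).deriv) 1 0
      have hz1 : z 1 = z 0 := by
        have := hXp 0
        rw [zero_add] at this
        simp only [hz, this]
      rw [hz1, mul_one, mul_zero, Real.cos_zero, Real.sin_zero, one_smul, zero_smul, sub_zero] at hvc
      have h3 := congrArg (fun w => ⟪w, z 0⟫) hvc
      simp only [inner_sub_left, inner_smul_left, J_self hb hJ, conj_trivial, mul_zero, sub_zero,
        real_inner_self_eq_norm_sq] at h3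
      have hθ0 : 0 ≤ θ := mul_nonneg zero_le_two (gpr'_nonneg k0.le d0 d1)
      have hθ1 : θ < 2 * Real.pi := by
        have : g' (‖z 0‖ ^ 2) ≤ k := gpr'_le k0.le d0 d1
        linarith
      have hθz : ∀ t, θ • z t = 0 := by
        by_cases hzz : ‖z 0‖ ^ 2 = 0
        · intro t
          have := hnc t
          rw [hzz] at this
          have : z t = 0 := by simpa using this
          rw [this, smul_zero]
        · have hcos : Real.cos θ = 1 := mul_right_cancel₀ hzz (by rw [h3, one_mul])
          have : θ = 0 := (Real.cos_eq_one_iff_of_lt_of_lt (by linarith) hθ1).1 hcos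
          intro t; rw [this, zero_smul]
      intro t
      have hG0 : GHam b J j₀ φi D k a ν d S r (X t) = 0 := by
        rw [hin t (hball t), hnc t, ← map_smul, ← map_smul, smul_neg, ← map_smul]
        rw [show (2 * g' (‖z 0‖ ^ 2)) • z t = 0 from hθz t]
        simp
      rw [hG0, inner_zero_left, mul_zero, zero_sub]
      exact neg_nonpos.2 (hH.nonneg _)
  have := intervalIntegral.integral_mono_on zero_le_one ((hI1.const_mul (1/2)).sub hI2)
    (intervalIntegrable_const (c := (0:ℝ))) fun t _ => hneg t
  simp only [intervalIntegral.integral_zero] at this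
  linarith

theorem nonsqueezing_abs {b : ℕ × Bool → Z} {J : Z →L[ℝ] Z} {j₀ : ℕ} {r R : ℝ} {φ φi : Z → Z}
    {D Di : Z → Z →L[ℝ] Z} {M C : ℝ} {ε : ℕ → ℝ}
    (hb : IsHilbertBasis b) (hJ : IsJ b J) (hr : 0 < r) (hR : 0 < R)
    (h : SqzData b J j₀ r R φ φi D Di M C ε) : r ≤ R := by
  by_contra hlt
  push Not at hlt
  have hπ := Real.pi_pos
  set e := r ^ 2 - R ^ 2 with he
  have he0 : 0 < e := by
    have := pow_lt_pow_left₀ hlt hR.le two_ne_zero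
    linarith
  have hR2 : 0 < R ^ 2 := by positivity
  obtain ⟨k, a, k0, k1, a0, a1, hka⟩ := exists_consts (P := r ^ 2 - 3 * (e / 16))
    (Q := R ^ 2 + e / 4 + e / 32) (by linarith) (by linarith)
  have ha : 0 < a := by linarith
  have hM := h.hM
  set ν := min 1 (min ((Real.pi - k) / 2 / a) (e / 4 / (M ^ 2 + 1))) with hν
  have hpk : 0 < Real.pi - k := by linarith
  refine sqz_contra (k := k) (a := a) (ν := ν) (d := e / 16) (S := R ^ 2 + e / 4) hb hJ h
    ⟨hr, hR, k0, k1, a0, a1, by linarith, by linarith, by linarith, ?_, min_le_left _ _, ?_, ?_, ?_⟩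
  · apply lt_min one_pos (lt_min (by positivity) (by positivity))
  · have : ν ≤ (Real.pi - k) / 2 / a := (min_le_right _ _).trans (min_le_left _ _)
    rw [le_div_iff₀ ha] at this
    linarith
  · have h1 : ν ≤ e / 4 / (M ^ 2 + 1) := (min_le_right _ _).trans (min_le_right _ _)
    rw [le_div_iff₀ (by positivity)] at h1
    have h2 : 0 ≤ ν := le_min zero_le_one (le_min (by positivity) (by positivity))
    linarith
  · convert hka using 2 <;> ring

end

section

theorem ham_symplectic {b : ℕ × Bool → Z} {J : Z →L[ℝ] Z} (hb : IsHilbertBasis b) (hJ : IsJ b J)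
    (A : Z →L[ℝ] Z) (hA : ∀ x y : Z, ⟪A x, y⟫ = ⟪x, A y⟫)
    (h : Z → ℝ) (hh : ContDiff ℝ (⊤ : ℕ∞) h) (Φ : ℝ → Z → Z) (h0 : ∀ z : Z, Φ 0 z = z)
    (hode : ∀ (z₀ : Z) (t : ℝ),
      HasDerivAt (fun τ : ℝ => Φ τ z₀) (J (A (Φ t z₀)) + J (gradient h (Φ t z₀))) t)
    (T : ℝ) (z : Z) (DΦ : Z →L[ℝ] Z) (hD : HasFDerivAt (Φ T) DΦ z) (L : ℝ)
    (hL : ∀ τ, |τ| ≤ |T| → ∀ u u', ‖u - z‖ ≤ 1 → ‖u' - z‖ ≤ 1 →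
      ‖Φ τ u - Φ τ u'‖ ≤ L * ‖u - u'‖) (v w : Z) :
    ⟪J (DΦ v), DΦ w⟫ = ⟪J v, w⟫ := by
  let E : (Z →L[ℝ] ℝ) →L[ℝ] Z :=
    LinearMap.mkContinuous
      { toFun := fun l => (InnerProductSpace.toDual ℝ Z).symm l
        map_add' := fun x y => map_add _ x y
        map_smul' := fun c x => by simp } 1 (fun x => by simp)
  have hE : ∀ (l : Z →L[ℝ] ℝ) (x : Z), ⟪E l, x⟫ = l x := fun l x => by
    change ⟪(InnerProductSpace.toDual ℝ Z).symm l, x⟫ = l x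
    exact InnerProductSpace.toDual_symm_apply
  have hd1 : ContDiff ℝ 1 (fderiv ℝ h) := hh.fderiv_right (by norm_cast)
  have hd2 : Continuous (fderiv ℝ (fderiv ℝ h)) := hd1.continuous_fderiv (by norm_num)
  have hdd : ∀ y, HasFDerivAt (fderiv ℝ h) (fderiv ℝ (fderiv ℝ h) y) y := fun y =>
    (hd1.differentiable (by norm_num) y).hasFDerivAt
  have hsy : ∀ y a c, fderiv ℝ (fderiv ℝ h) y a c = fderiv ℝ (fderiv ℝ h) y c a := by
    intro y a c
    exact second_derivative_symmetric
      (fun y => ((hh.differentiable (by norm_num)) y).hasFDerivAt) (hdd y) a c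
  refine symplectic_flow J (J_norm hb hJ) (fun y => J (A y) + J (gradient h y))
    (fun y => J.comp A + J.comp (E.comp (fderiv ℝ (fderiv ℝ h) y))) ?_ ?_ ?_ Φ h0 hode T z DΦ hD L hL
    v w
  · intro y
    refine HasFDerivAt.add (J.comp A).hasFDerivAt ?_
    exact J.hasFDerivAt.comp y (E.hasFDerivAt.comp y (hdd y))
  · fun_prop
  · intro y v w
    simp only [ContinuousLinearMap.add_apply, ContinuousLinearMap.comp_apply, map_add,
      J_sq hb hJ, inner_add_left, inner_add_right, J_inner hb hJ, inner_neg_left, hE]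
    rw [hA, real_inner_comm, real_inner_comm _ v, hE, hsy y v w]
    ring

theorem U_comm {b : ℕ × Bool → Z} {J : Z →L[ℝ] Z} (hb : IsHilbertBasis b) (hJ : IsJ b J)
    (A : Z →L[ℝ] Z) (hA : ∀ x y : Z, ⟪A x, y⟫ = ⟪x, A y⟫)
    (U : ℝ → Z →L[ℝ] Z)
    (hU_zero : U 0 = ContinuousLinearMap.id ℝ Z)
    (hU_group : ∀ s t : ℝ, U (s + t) = (U s).comp (U t))
    (hU_iso : ∀ (t : ℝ) (z : Z), ‖U t z‖ = ‖z‖)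
    (hU_ode : ∀ (z : Z) (t : ℝ), HasDerivAt (fun τ : ℝ => U τ z) (J (A (U t z))) t)
    (T : ℝ) (v : Z) : J (U T v) = U T (J v) := by
  have hs : ∀ v w, ⟪J (U T v), U T w⟫ = ⟪J v, w⟫ := by
    intro v w
    refine symplectic_flow J (J_norm hb hJ) (fun y => J (A y)) (fun y => J.comp A)
      (fun y => (J.comp A).hasFDerivAt) continuous_const ?_ (fun t z => U t z) (by simp [hU_zero])
      hU_ode T 0 (U T) (U T).hasFDerivAt 1 ?_ v w
    · intro y v w
      simp only [ContinuousLinearMap.comp_apply, J_sq hb hJ, J_inner hb hJ, inner_neg_left, hA]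
      ring
    · intro τ _ u u' _ _
      rw [← map_sub, hU_iso, one_mul]
  have hin : ∀ v w, ⟪U T v, U T w⟫ = ⟪v, w⟫ := by
    intro v w
    have h1 := norm_add_sq_real (U T v) (U T w)
    have h2 := norm_add_sq_real v w
    rw [← map_add, hU_iso, hU_iso, hU_iso] at h1
    linarith
  have hsurj : ∀ y, U T (U (-T) y) = y := by
    intro y
    have := hU_group T (-T)
    rw [add_neg_cancel, hU_zero] at this
    simpa using (congrArg (fun L : Z →L[ℝ] Z => L y) this).symm
  refine ext_inner_right ℝ fun y => ?_
  rw [← hsurj y, hs, hin]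

theorem exists_tail_eps {b : ℕ × Bool → Z} (hb : IsHilbertBasis b) {K : Set Z} (hK : IsCompact K) :
    ∃ ε : ℕ → ℝ, Filter.Tendsto ε Filter.atTop (nhds 0) ∧
      ∀ m, ∀ y ∈ K, ‖y - PP b (Finset.range m) y‖ ≤ ε m := by
  have hbd : ∀ m, BddAbove ((fun y => ‖y - PP b (Finset.range m) y‖) '' K) := fun m =>
    (hK.image (by fun_prop)).bddAbove
  refine ⟨fun m => sSup ((fun y => ‖y - PP b (Finset.range m) y‖) '' K), ?_, fun m y hy =>
    le_csSup (hbd m) ⟨y, hy, rfl⟩⟩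
  rw [Metric.tendsto_atTop]
  intro ε hε
  obtain ⟨m0, hm0⟩ := compact_tail hb hK (half_pos hε)
  refine ⟨m0, fun m hm => ?_⟩
  have h1 : 0 ≤ sSup ((fun y => ‖y - PP b (Finset.range m) y‖) '' K) :=
    Real.sSup_nonneg (by rintro _ ⟨y, _, rfl⟩; exact norm_nonneg _)
  have h2 : sSup ((fun y => ‖y - PP b (Finset.range m) y‖) '' K) ≤ ε / 2 :=
    Real.sSup_le (by rintro _ ⟨y, hy, rfl⟩; exact hm0 m hm y hy) (half_pos hε).le
  rw [Real.dist_eq, sub_zero, abs_of_nonneg h1]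
  linarith

end

/-- Abstract non-squeezing theorem: if the time-`T` flow map `Φ_T` of a
Hamiltonian equation `ż = JAz + J∇h(z)` satisfying (H1), (H2), (H3) sends the ball
`B_r(z̄)` into the cylinder `{z : (p_{j₀} - p̄)² + (q_{j₀} - q̄)² < R²}`, then `r ≤ R`. -/
theorem abstract_nonsqueezing
    {Z : Type*} [NormedAddCommGroup Z] [InnerProductSpace ℝ Z] [CompleteSpace Z]
    (b : ℕ × Bool → Z) (J : Z →L[ℝ] Z) (hb : IsHilbertBasis b) (hJ : IsJ b J)
    (A : Z →L[ℝ] Z) (hA_selfadj : ∀ x y : Z, ⟪A x, y⟫ = ⟪x, A y⟫)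
    (lam : ℕ → ℝ) (hA_eig : ∀ (j : ℕ) (s : Bool), A (b (j, s)) = lam j • b (j, s))
    (h : Z → ℝ) (hh : ContDiff ℝ (⊤ : ℕ∞) h)
    -- (H1): the equation `ż = J A z + J ∇h(z)` defines a C¹-smooth global flow `Φ`
    (Φ : ℝ → Z → Z)
    (hΦ_zero : ∀ z : Z, Φ 0 z = z)
    (hΦ_group : ∀ s t : ℝ, ∀ z : Z, Φ (s + t) z = Φ s (Φ t z))
    (hΦ_ode : ∀ (z₀ : Z) (t : ℝ),
      HasDerivAt (fun τ : ℝ => Φ τ z₀) (J (A (Φ t z₀)) + J (gradient h (Φ t z₀))) t)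
    (hΦ_C1 : ∀ t : ℝ, ContDiff ℝ 1 (Φ t))
    -- (H2): the flow is uniformly bounded
    (hH2 : ∀ R T : ℝ, 0 < R → 0 < T → ∃ R' : ℝ, ∀ t : ℝ, |t| ≤ T →
      ∀ z ∈ Metric.ball (0 : Z) R, Φ t z ∈ Metric.ball (0 : Z) R')
    -- the linear group `e^{tJA}`
    (U : ℝ → Z →L[ℝ] Z)
    (hU_zero : U 0 = ContinuousLinearMap.id ℝ Z)
    (hU_group : ∀ s t : ℝ, U (s + t) = (U s).comp (U t))
    (hU_iso : ∀ (t : ℝ) (z : Z), ‖U t z‖ = ‖z‖)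
    (hU_ode : ∀ (z : Z) (t : ℝ), HasDerivAt (fun τ : ℝ => U τ z) (J (A (U t z))) t)
    -- (H3): `Φ_t = e^{tJA}(I + Φ̃_t)` with `Φ̃_t` taking values in a space `Eplus`
    -- compactly embedded in `Z`, Lipschitz from `Z` to `Eplus` on bounded sets
    {Eplus : Type*} [NormedAddCommGroup Eplus] [NormedSpace ℝ Eplus]
    (ι : Eplus →L[ℝ] Z) (hι_inj : Function.Injective ι) (hι_cmp : IsCompactOperator ι)
    (hι_dense : DenseRange ι)
    (Ψ : ℝ → Z → Eplus)
    (hΨ : ∀ (t : ℝ) (z : Z), Φ t z = U t (z + ι (Ψ t z)))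
    (hH3 : ∀ R T : ℝ, 0 < R → 0 < T → ∃ C : ℝ, ∀ t : ℝ, |t| ≤ T →
      ∀ u₀ ∈ Metric.closedBall (0 : Z) R, ∀ u₀' ∈ Metric.closedBall (0 : Z) R,
        ‖Ψ t u₀ - Ψ t u₀'‖ ≤ C * ‖u₀ - u₀'‖)
    (T r R : ℝ) (hr : 0 < r) (hR : 0 < R) (zbar : Z) (j₀ : ℕ) (pbar qbar : ℝ)
    (hsqueeze : Φ T '' Metric.ball zbar r ⊆
      {z : Z | (⟪b (j₀, true), z⟫ - pbar) ^ 2 + (⟪b (j₀, false), z⟫ - qbar) ^ 2 < R ^ 2}) :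
    r ≤ R := by
  obtain ⟨C1, hC1⟩ := hH3 (‖zbar‖ + r) (|T| + 1) (by positivity) (by positivity)
  have hTT : |T| ≤ |T| + 1 := by linarith
  set C := max C1 0 with hCdef
  have hC0 : 0 ≤ C := le_max_right _ _
  have hC : ∀ u u' : Z, ‖u‖ ≤ ‖zbar‖ + r → ‖u'‖ ≤ ‖zbar‖ + r →
      ‖Ψ T u - Ψ T u'‖ ≤ C * ‖u - u'‖ := by
    intro u u' hu hu'
    refine (hC1 T hTT u (by simpa using hu) u' (by simpa using hu')).trans ?_
    gcongr
    exact le_max_left _ _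
  have hUl : ∀ y, U (-T) (U T y) = y := by
    intro y
    have := hU_group (-T) T
    rw [neg_add_cancel, hU_zero] at this
    simpa using (congrArg (fun L : Z →L[ℝ] Z => L y) this).symm
  have hUr : ∀ y, U T (U (-T) y) = y := by
    intro y
    have := hU_group T (-T)
    rw [add_neg_cancel, hU_zero] at this
    simpa using (congrArg (fun L : Z →L[ℝ] Z => L y) this).symm
  have hJU := U_comm hb hJ A hA_selfadj U hU_zero hU_group hU_iso hU_ode T
  have hdiff : ∀ t z, HasFDerivAt (Φ t) (fderiv ℝ (Φ t) z) z := fun t z =>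
    ((hΦ_C1 t).differentiable (by norm_num) z).hasFDerivAt
  have hadd : ∀ z : Z, ‖z‖ < r → ‖z + zbar‖ < ‖zbar‖ + r := fun z hz => by
    have := norm_add_le z zbar
    linarith
  -- the compact part of the derivative
  have hmem : ∀ z, ‖z‖ < r → ∀ v, U (-T) (fderiv ℝ (Φ T) (z + zbar) v) - v ∈
      closure (ι '' closedBall 0 (C * ‖v‖)) := by
    intro z hz v
    have h1 := ((hdiff T (z + zbar)).hasLineDerivAt v).tendsto_slope_zero
    have h2 := (((U (-T)).continuous.tendsto _).comp h1).sub_const v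
    refine mem_closure_of_tendsto h2 ?_
    have h3 : ∀ᶠ t : ℝ in nhds 0, ‖z + zbar + t • v‖ < ‖zbar‖ + r := by
      have : Continuous fun t : ℝ => ‖z + zbar + t • v‖ := by fun_prop
      refine this.continuousAt.eventually_lt continuousAt_const ?_
      simpa using hadd z hz
    filter_upwards [h3.filter_mono nhdsWithin_le_nhds, self_mem_nhdsWithin] with t ht ht0
    have ht0' : t ≠ 0 := ht0
    refine ⟨t⁻¹ • (Ψ T (z + zbar + t • v) - Ψ T (z + zbar)), ?_, ?_⟩
    · rw [mem_closedBall_zero_iff, norm_smul, norm_inv]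
      have := hC _ _ ht.le (hadd z hz).le
      rw [add_sub_cancel_left, norm_smul] at this
      have htn : 0 < ‖t‖ := norm_pos_iff.2 ht0'
      rw [inv_mul_le_iff₀ htn]
      linarith
    · simp only [Function.comp_apply, map_smul, map_sub, hΨ, hUl]
      simp only [smul_sub, smul_add, smul_smul, inv_mul_cancel₀ ht0', one_smul]
      abel
  have hnb : ∀ z, ‖z‖ < r → ∀ v, ‖U (-T) (fderiv ℝ (Φ T) (z + zbar) v) - v‖ ≤ ‖ι‖ * (C * ‖v‖) := by
    intro z hz v
    have hs : closure (ι '' closedBall 0 (C * ‖v‖)) ⊆ closedBall 0 (‖ι‖ * (C * ‖v‖)) := by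
      refine closure_minimal ?_ isClosed_closedBall
      rintro _ ⟨e, he, rfl⟩
      rw [mem_closedBall_zero_iff] at he ⊢
      exact (ι.le_opNorm e).trans (by gcongr)
    simpa using hs (hmem z hz v)
  set c : Z := pbar • b (j₀, true) + qbar • b (j₀, false) with hc
  set P := ‖Ψ T 0‖ + C * (‖zbar‖ + r) with hP
  have hΨb : ∀ z, ‖z‖ < r → ‖Ψ T (z + zbar)‖ ≤ P := by
    intro z hz
    have h1 := hC (z + zbar) 0 (hadd z hz).le (by simp; positivity)
    rw [sub_zero] at h1
    have h2 := norm_le_norm_add_norm_sub' (Ψ T (z + zbar)) (Ψ T 0)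
    have h3 : C * ‖z + zbar‖ ≤ C * (‖zbar‖ + r) := by gcongr; exact (hadd z hz).le
    linarith
  have hK1 : IsCompact (closure (ι '' closedBall 0 (C * r))) :=
    hι_cmp.isCompact_closure_image_closedBall _
  have hK2 : IsCompact (closure (ι '' closedBall 0 P)) :=
    hι_cmp.isCompact_closure_image_closedBall _
  have hK := (hK1.prod hK2).image (f := fun p : Z × Z => J (U T p.1) - U T zbar + c - U T p.2)
    (by fun_prop)
  obtain ⟨ε, hε, hεK⟩ := exists_tail_eps hb hK
  obtain ⟨M, hM⟩ := hH2 (‖zbar‖ + r) (|T| + 1) (by positivity) (by positivity)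
  have hon := fun i j => orthonormal_iff_ite.1 hb.1 i j
  refine nonsqueezing_abs (b := b) (J := J) (j₀ := j₀) (r := r) (R := R)
    (φ := fun z => Φ T (z + zbar) - c)
    (φi := fun y => Φ (-T) (y + c) - zbar) (D := fun z => fderiv ℝ (Φ T) (z + zbar))
    (Di := fun y => fderiv ℝ (Φ (-T)) (y + c)) (M := max M 0 + ‖c‖) (C := 1 + ‖ι‖ * C)
    (ε := ε) hb hJ hr hR
    { li := ?_, ri := ?_, d := ?_, dc := ?_, di := ?_, sym := ?_, hM := ?_, bd := ?_, hC := ?_,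
      bD := ?_, sq := ?_, hε := hε, tail := ?_ }
  · intro z
    simp only [sub_add_cancel]
    rw [← hΦ_group, neg_add_cancel, hΦ_zero, add_sub_cancel_right]
  · intro z
    simp only [sub_add_cancel]
    rw [← hΦ_group, add_neg_cancel, hΦ_zero, add_sub_cancel_right]
  · intro z
    exact ((hasFDerivAt_comp_add_right zbar).2 (hdiff T (z + zbar))).sub_const c
  · exact ((hΦ_C1 T).continuous_fderiv (by norm_num)).comp (continuous_id.add continuous_const)
  · intro z
    exact ((hasFDerivAt_comp_add_right c).2 (hdiff (-T) (z + c))).sub_const zbar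
  · intro z v w
    obtain ⟨C2, hC2⟩ := hH3 (‖z + zbar‖ + 1) (|T| + 1) (by positivity) (by positivity)
    refine ham_symplectic hb hJ A hA_selfadj h hh Φ hΦ_zero hΦ_ode T (z + zbar) _
      (hdiff T (z + zbar)) (1 + ‖ι‖ * C2) ?_ v w
    intro τ hτ u u' hu hu'
    have hn : ∀ u : Z, ‖u - (z + zbar)‖ ≤ 1 → u ∈ closedBall (0 : Z) (‖z + zbar‖ + 1) := by
      intro u hu
      rw [mem_closedBall_zero_iff]
      have := norm_le_norm_add_norm_sub' u (z + zbar)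
      linarith
    have h1 := hC2 τ (hτ.trans hTT) u (hn u hu) u' (hn u' hu')
    rw [hΨ, hΨ, ← map_sub, hU_iso]
    have e : u + ι (Ψ τ u) - (u' + ι (Ψ τ u')) = (u - u') + ι (Ψ τ u - Ψ τ u') := by
      rw [map_sub]; abel
    rw [e]
    calc _ ≤ ‖u - u'‖ + ‖ι (Ψ τ u - Ψ τ u')‖ := norm_add_le _ _
      _ ≤ ‖u - u'‖ + ‖ι‖ * (C2 * ‖u - u'‖) := by
        gcongr
        exact (ι.le_opNorm _).trans (by gcongr)
      _ = _ := by ring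
  · positivity
  · intro z hz
    have h1 := hM T hTT (z + zbar) (by simpa using hadd z hz)
    rw [mem_ball_zero_iff] at h1
    have h2 := norm_sub_le (Φ T (z + zbar)) c
    have h3 := le_max_left M 0
    linarith
  · positivity
  · intro z hz
    refine ContinuousLinearMap.opNorm_le_bound _ (by positivity) fun v => ?_
    have h1 := hnb z hz v
    have h2 := norm_le_norm_add_norm_sub' (U (-T) (fderiv ℝ (Φ T) (z + zbar) v)) v
    rw [hU_iso] at h2
    linarith
  · intro z hz
    have h1 : Φ T (z + zbar) ∈ _ := hsqueeze ⟨z + zbar, by simpa [mem_ball_iff_norm] using hz, rfl⟩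
    rw [Set.mem_setOf_eq] at h1
    have h2 := PP_norm_sq hb {j₀} (Φ T (z + zbar) - c)
    rw [Finset.sum_product, Finset.sum_singleton, Fintype.sum_bool] at h2
    have e1 : ⟪b (j₀, true), Φ T (z + zbar) - c⟫ = ⟪b (j₀, true), Φ T (z + zbar)⟫ - pbar := by
      simp [hc, inner_sub_right, inner_add_right, inner_smul_right, hon, hb.1.1]
    have e2 : ⟪b (j₀, false), Φ T (z + zbar) - c⟫ = ⟪b (j₀, false), Φ T (z + zbar)⟫ - qbar := by
      simp [hc, inner_sub_right, inner_add_right, inner_smul_right, hon, hb.1.1]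
    rw [e1, e2] at h2
    rw [← h2] at h1
    exact lt_of_pow_lt_pow_left₀ 2 hR.le h1
  · intro m z hz
    apply hεK
    have hv : ‖-J z‖ = ‖z‖ := by rw [norm_neg, J_norm hb hJ]
    refine ⟨(U (-T) (fderiv ℝ (Φ T) (z + zbar) (-J z)) - (-J z), ι (Ψ T (z + zbar))), ⟨?_, ?_⟩, ?_⟩
    · refine closure_mono (Set.image_mono (closedBall_subset_closedBall ?_)) (hmem z hz (-J z))
      rw [hv]
      gcongr
    · exact subset_closure ⟨_, by simpa using hΨb z hz, rfl⟩
    · simp only [map_sub, map_neg, hUr, hΨ T (z + zbar), map_add, hJU, J_sq hb hJ]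
      abel

end Kuksin
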